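/- arXiv:1112.4892 — 2 statements merged into one kernel-verified Lean document; each statement's English description precedes it below -/
import Mathlib

section
/- Let d ≥ 1 and let φ: ℝ^d → ℝ be a continuous function with φ(t + 2πe_j) − φ(t) ∈ 2πℤ for all t ∈ ℝ^d and each standard basis vector e_j (so that φ induces a continuous mapping 𝕋^d → 𝕋). Suppose that for all sufficiently large |n| the function t ↦ e^{inφ(t)} (which is 2π-periodic in each variable) has absolutely convergent Fourier series, and that ‖e^{inφ}‖_{A(𝕋^d)} · (log log log |n| / log log |n|)^{1/12} → 0 as |n| → ∞, n ∈ ℤ. Then φ is linear: there exists ν ∈ ℤ^d such that φ(t) = ⟨ν, t⟩ + φ(0) for all t ∈ ℝ^d, where ⟨ν, t⟩ is the inner product. -/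
open scoped Real
open Complex MeasureTheory Filter

/-- The `k`-th Fourier coefficient of a function `f : ℝ^d → ℂ` which is `2π`-periodic
in each coordinate. -/
noncomputable def fourierCoeffTd (d : ℕ) (f : (Fin d → ℝ) → ℂ) (k : Fin d → ℤ) : ℂ :=
  (1 / (2 * (π : ℂ))) ^ d *
    ∫ t in Set.univ.pi fun _ : Fin d => Set.Icc (0 : ℝ) (2 * π),
      f t * Complex.exp (-Complex.I * ∑ j : Fin d, (k j : ℂ) * (t j : ℂ))

/-- The `A(𝕋^d)` norm: the sum of absolute values of the Fourier coefficients. -/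
noncomputable def normATd (d : ℕ) (f : (Fin d → ℝ) → ℂ) : ℝ :=
  ∑' k : Fin d → ℤ, ‖fourierCoeffTd d f k‖

namespace BeurlingHelson

/-- The character `x ↦ exp (2πi r x / p)` of `ZMod p`. -/
noncomputable def chi {p : ℕ} [NeZero p] (r x : ZMod p) : ℂ := ZMod.stdAddChar (r * x)

section Characters
variable {p : ℕ} [NeZero p]

lemma norm_chi (r x : ZMod p) : ‖chi r x‖ = 1 := AddChar.norm_apply _ _

lemma chi_add_left (r s x : ZMod p) : chi (r + s) x = chi r x * chi s x := by
  simp [chi, add_mul, AddChar.map_add_eq_mul]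

lemma chi_add_right (r x y : ZMod p) : chi r (x + y) = chi r x * chi r y := by
  simp [chi, mul_add, AddChar.map_add_eq_mul]

lemma chi_zero_left (x : ZMod p) : chi 0 x = 1 := by simp [chi]

lemma chi_zero_right (r : ZMod p) : chi r 0 = 1 := by simp [chi]

lemma chi_neg_right (r x : ZMod p) : chi r (-x) = star (chi r x) := by
  simp [chi, AddChar.map_neg_eq_conj]

lemma chi_neg_left (r x : ZMod p) : chi (-r) x = star (chi r x) := by
  simp [chi, AddChar.map_neg_eq_conj]

lemma chi_comm (r x : ZMod p) : chi r x = chi x r := by simp [chi, mul_comm]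

lemma sum_chi (r : ZMod p) : ∑ x, chi r x = if r = 0 then (p : ℂ) else 0 := by
  have := AddChar.sum_mulShift (R := ZMod p) (R' := ℂ) r (ZMod.isPrimitive_stdAddChar p)
  simp only [ZMod.card] at this
  simp only [chi, mul_comm r, this]
  split_ifs <;> simp

lemma norm_one_sub_chi_add_left (r s x : ZMod p) :
    ‖1 - chi (r + s) x‖ ≤ ‖1 - chi r x‖ + ‖1 - chi s x‖ := by
  have h : 1 - chi (r + s) x = (1 - chi r x) + chi r x * (1 - chi s x) := by
    rw [chi_add_left]; ring
  rw [h]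
  refine (norm_add_le _ _).trans ?_
  rw [norm_mul, norm_chi, one_mul]

lemma norm_one_sub_chi_add_right (r x y : ZMod p) :
    ‖1 - chi r (x + y)‖ ≤ ‖1 - chi r x‖ + ‖1 - chi r y‖ := by
  simpa only [chi_comm] using norm_one_sub_chi_add_left x y r

lemma norm_one_sub_chi_neg_right (r x : ZMod p) : ‖1 - chi r (-x)‖ = ‖1 - chi r x‖ := by
  rw [chi_neg_right, ← norm_star (1 - chi r x)]
  simp

/-- Correlations in terms of Fourier coefficients. -/
lemma sum_correlation {f c : ZMod p → ℂ} (hf : ∀ x, f x = ∑ r, c r * chi r x) (h : ZMod p) :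
    ∑ j, f (j + h) * star (f j) = ∑ r, ((p : ℂ) * (‖c r‖ ^ 2 : ℝ)) * chi r h := by
  have key : ∀ j, f (j + h) * star (f j) =
      ∑ r, ∑ s, c r * star (c s) * chi r h * chi (r - s) j := by
    intro j
    rw [hf, hf, star_sum, Finset.sum_mul_sum]
    refine Finset.sum_congr rfl fun r _ => Finset.sum_congr rfl fun s _ => ?_
    rw [chi_add_right, star_mul', sub_eq_add_neg, chi_add_left, chi_neg_left]
    ring
  simp_rw [key]
  rw [Finset.sum_comm]
  refine Finset.sum_congr rfl fun r _ => ?_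
  rw [Finset.sum_comm]
  simp_rw [← Finset.mul_sum, sum_chi, sub_eq_zero]
  simp only [mul_ite, mul_zero, Finset.sum_ite_eq, Finset.mem_univ, if_true]
  have : c r * star (c r) = ((‖c r‖ ^ 2 : ℝ) : ℂ) := by
    rw [Complex.star_def, Complex.mul_conj, Complex.normSq_eq_norm_sq]
  rw [this]; ring

/-- Parseval's identity. -/
lemma sum_norm_sq {f c : ZMod p → ℂ} (hf : ∀ x, f x = ∑ r, c r * chi r x) :
    ∑ x, ‖f x‖ ^ 2 = p * ∑ r, ‖c r‖ ^ 2 := by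
  have h := sum_correlation hf 0
  simp only [add_zero, chi_zero_right, mul_one] at h
  have h2 : ∀ x, f x * star (f x) = ((‖f x‖ ^ 2 : ℝ) : ℂ) := fun x => by
    rw [Complex.star_def, Complex.mul_conj, Complex.normSq_eq_norm_sq]
  simp_rw [h2] at h
  rw [Finset.mul_sum]
  exact_mod_cast h

/-- `f` is a combination of characters of `ZMod p` with coefficients of `ℓ¹` norm at most `T`. -/
def WienerLE (f : ZMod p → ℂ) (T : ℝ) : Prop :=
  ∃ c : ZMod p → ℂ, (∀ x, f x = ∑ r, c r * chi r x) ∧ ∑ r, ‖c r‖ ≤ T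

lemma WienerLE.mono {f : ZMod p → ℂ} {S T : ℝ} (h : WienerLE f S) (hST : S ≤ T) :
    WienerLE f T := by
  obtain ⟨c, hc, hs⟩ := h
  exact ⟨c, hc, hs.trans hST⟩

lemma WienerLE.add {f g : ZMod p → ℂ} {S T : ℝ} (hf : WienerLE f S) (hg : WienerLE g T) :
    WienerLE (fun x => f x + g x) (S + T) := by
  obtain ⟨c, hc, hs⟩ := hf
  obtain ⟨d, hd, ht⟩ := hg
  refine ⟨fun r => c r + d r, fun x => ?_, ?_⟩
  · simp_rw [hc, hd, add_mul, Finset.sum_add_distrib]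
  · exact (Finset.sum_le_sum fun r _ => norm_add_le _ _).trans
      (by rw [Finset.sum_add_distrib]; linarith)

lemma WienerLE.const_mul {f : ZMod p → ℂ} {T : ℝ} (hf : WienerLE f T) (a : ℂ) :
    WienerLE (fun x => a * f x) (‖a‖ * T) := by
  obtain ⟨c, hc, hs⟩ := hf
  refine ⟨fun r => a * c r, fun x => ?_, ?_⟩
  · simp_rw [hc, Finset.mul_sum, mul_assoc]
  · simp_rw [norm_mul, ← Finset.mul_sum]
    gcongr

lemma WienerLE.sum {ι : Type*} (s : Finset ι) {f : ι → ZMod p → ℂ} {T : ι → ℝ}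
    (h : ∀ i ∈ s, WienerLE (f i) (T i)) :
    WienerLE (fun x => ∑ i ∈ s, f i x) (∑ i ∈ s, T i) := by
  classical
  induction s using Finset.induction_on with
  | empty => exact ⟨0, by simp, by simp⟩
  | insert a s ha ih =>
    simp_rw [Finset.sum_insert ha]
    exact (h a (by simp)).add (ih fun i hi => h i (by simp [hi]))

lemma WienerLE.mul {f g : ZMod p → ℂ} {S T : ℝ} (hf : WienerLE f S) (hg : WienerLE g T) :
    WienerLE (fun x => f x * g x) (S * T) := by
  obtain ⟨c, hc, hs⟩ := hf
  obtain ⟨d, hd, ht⟩ := hg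
  have hS : 0 ≤ S := (Finset.sum_nonneg fun r _ => norm_nonneg _).trans hs
  refine ⟨fun t => ∑ r, c r * d (t - r), fun x => ?_, ?_⟩
  · simp_rw [Finset.sum_mul]
    rw [Finset.sum_comm, hc, hd, Finset.sum_mul]
    refine Finset.sum_congr rfl fun r _ => ?_
    rw [Finset.mul_sum, ← Equiv.sum_comp (Equiv.subRight r)]
    refine Finset.sum_congr rfl fun t _ => ?_
    have : chi t x = chi r x * chi (t - r) x := by rw [← chi_add_left]; congr 1; ring
    simp only [Equiv.subRight_apply, this]
    ring
  · calc ∑ t, ‖∑ r, c r * d (t - r)‖ ≤ ∑ t, ∑ r, ‖c r‖ * ‖d (t - r)‖ := by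
          refine Finset.sum_le_sum fun t _ => (norm_sum_le _ _).trans ?_
          simp_rw [norm_mul]; rfl
      _ = (∑ r, ‖c r‖) * ∑ r, ‖d r‖ := by
          rw [Finset.sum_comm, Finset.sum_mul]
          refine Finset.sum_congr rfl fun r _ => ?_
          rw [← Finset.mul_sum, ← Equiv.sum_comp (Equiv.subRight r) fun t => ‖d t‖]
          rfl
      _ ≤ S * T := mul_le_mul hs ht (Finset.sum_nonneg fun r _ => norm_nonneg _) hS

lemma WienerLE.star {f : ZMod p → ℂ} {T : ℝ} (hf : WienerLE f T) :
    WienerLE (fun x => star (f x)) T := by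
  obtain ⟨c, hc, hs⟩ := hf
  refine ⟨fun r => Star.star (c (-r)), fun x => ?_, ?_⟩
  · beta_reduce
    rw [hc, star_sum, ← Equiv.sum_comp (Equiv.neg _)]
    refine Finset.sum_congr rfl fun r _ => ?_
    simp [chi_neg_left]
  · simp_rw [norm_star]
    exact (Equiv.sum_comp (Equiv.neg (ZMod p)) fun r => ‖c r‖).trans_le hs

lemma WienerLE.shift {f : ZMod p → ℂ} {T : ℝ} (hf : WienerLE f T) (h : ZMod p) :
    WienerLE (fun x => f (x + h)) T := by
  obtain ⟨c, hc, hs⟩ := hf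
  refine ⟨fun r => c r * chi r h, fun x => ?_, ?_⟩
  · beta_reduce
    rw [hc]
    refine Finset.sum_congr rfl fun r _ => ?_
    rw [chi_add_right]; ring
  · simpa [norm_mul, norm_chi] using hs

lemma wienerLE_of_norm_le {f : ZMod p → ℂ} {ε : ℝ} (hf : ∀ x, ‖f x‖ ≤ ε) :
    WienerLE f (p * ε) := by
  have hp : (p : ℂ) ≠ 0 := by exact_mod_cast NeZero.ne p
  refine ⟨fun r => (p : ℂ)⁻¹ * ∑ y, f y * Star.star (chi r y), fun x => ?_, ?_⟩
  · have : ∀ r, (p : ℂ)⁻¹ * (∑ y, f y * Star.star (chi r y)) * chi r x =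
        (p : ℂ)⁻¹ * ∑ y, f y * chi (x - y) r := by
      intro r
      rw [mul_assoc, Finset.sum_mul]
      congr 1
      refine Finset.sum_congr rfl fun y _ => ?_
      rw [chi_comm (x - y), sub_eq_add_neg, chi_add_right, chi_neg_right]; ring
    simp_rw [this, ← Finset.mul_sum]
    rw [Finset.sum_comm]
    simp_rw [← Finset.mul_sum, sum_chi, sub_eq_zero]
    simp only [mul_ite, mul_zero, Finset.sum_ite_eq, Finset.mem_univ, if_true]
    field_simp
  · have : ∀ r : ZMod p, ‖(p : ℂ)⁻¹ * ∑ y, f y * Star.star (chi r y)‖ ≤ ε := by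
      intro r
      rw [norm_mul, norm_inv, Complex.norm_natCast]
      have h1 : ‖∑ y, f y * Star.star (chi r y)‖ ≤ p * ε := by
        refine (norm_sum_le _ _).trans ?_
        refine (Finset.sum_le_sum (g := fun _ => ε) fun y _ => ?_).trans ?_
        · rw [norm_mul, norm_star, norm_chi, mul_one]; exact hf y
        · simp
      have hp' : (0 : ℝ) < p := by exact_mod_cast Nat.pos_of_neZero p
      rw [inv_mul_le_iff₀ hp']
      exact h1
    exact (Finset.sum_le_sum fun r _ => this r).trans (by simp)

end Characters

/-- The probability weight proportional to `exp (-S)`. -/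
noncomputable def gibbs {p : ℕ} [NeZero p] (S : ZMod p → ℝ) (z : ZMod p) : ℝ :=
  Real.exp (-S z) / ∑ x, Real.exp (-S x)

section Gibbs
variable {p : ℕ} [NeZero p] {S : ZMod p → ℝ}

lemma partition_pos (S : ZMod p → ℝ) : 0 < ∑ x, Real.exp (-S x) :=
  Finset.sum_pos (fun _ _ => Real.exp_pos _) Finset.univ_nonempty

lemma gibbs_nonneg (S : ZMod p → ℝ) (z : ZMod p) : 0 ≤ gibbs S z :=
  div_nonneg (Real.exp_pos _).le (partition_pos S).le

lemma sum_gibbs (S : ZMod p → ℝ) : ∑ z, gibbs S z = 1 := by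
  simp only [gibbs]
  rw [← Finset.sum_div, div_self (partition_pos S).ne']

lemma abs_exp_neg_sub_exp_neg_le (a b : ℝ) :
    |Real.exp (-a) - Real.exp (-b)| ≤ |a - b| * (Real.exp (-a) + Real.exp (-b)) := by
  have key : ∀ a b : ℝ, a ≤ b →
      |Real.exp (-a) - Real.exp (-b)| ≤ |a - b| * (Real.exp (-a) + Real.exp (-b)) := by
    intro a b hab
    have h1 : Real.exp (-b) ≤ Real.exp (-a) := Real.exp_le_exp.2 (by linarith)
    rw [abs_of_nonneg (by linarith), abs_of_nonpos (by linarith)]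
    have h2 : Real.exp (-b) = Real.exp (-a) * Real.exp (a - b) := by
      rw [← Real.exp_add]; congr 1; ring
    have h3 : a - b + 1 ≤ Real.exp (a - b) := Real.add_one_le_exp _
    have h4 : Real.exp (-a) * (a - b + 1) ≤ Real.exp (-b) := by
      rw [h2]; exact mul_le_mul_of_nonneg_left h3 (Real.exp_pos _).le
    nlinarith [mul_nonneg (sub_nonneg.2 hab) (Real.exp_pos (-b)).le]
  rcases le_total a b with h | h
  · exact key a b h
  · have := key b a h
    rw [abs_sub_comm, abs_sub_comm a b, add_comm]
    exact this

lemma sum_abs_gibbs_shift_le (hadd : ∀ x y, S (x + y) ≤ S x + S y) (hneg : ∀ x, S (-x) = S x)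
    (y : ZMod p) : ∑ z, |gibbs S (z + y) - gibbs S z| ≤ 2 * S y := by
  have hZ := partition_pos S
  have h1 : ∀ z, |gibbs S (z + y) - gibbs S z| ≤ S y * (gibbs S (z + y) + gibbs S z) := by
    intro z
    have hd : |S (z + y) - S z| ≤ S y := by
      have h2 := hadd z y
      have h3 := hadd (z + y) (-y)
      rw [add_neg_cancel_right, hneg] at h3
      rw [abs_le]; constructor <;> linarith
    simp only [gibbs]
    rw [← sub_div, ← add_div, abs_div, abs_of_pos hZ, ← mul_div_assoc]
    gcongr
    refine (abs_exp_neg_sub_exp_neg_le _ _).trans ?_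
    gcongr
  refine (Finset.sum_le_sum fun z _ => h1 z).trans ?_
  rw [← Finset.mul_sum, Finset.sum_add_distrib, sum_gibbs,
    show ∑ z, gibbs S (z + y) = 1 from
      (Equiv.sum_comp (Equiv.addRight y) (gibbs S)).trans (sum_gibbs S)]
  linarith

lemma sum_gibbs_mul_le (hS0 : S 0 = 0) : ∑ z, gibbs S z * S z ≤ Real.log p := by
  have hZ := partition_pos S
  have hp : (0 : ℝ) < p := by exact_mod_cast Nat.pos_of_neZero p
  rw [Real.le_log_iff_exp_le hp]
  have hJ := convexOn_exp.map_sum_le (t := Finset.univ) (w := gibbs S) (p := S)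
    (fun z _ => gibbs_nonneg S z) (sum_gibbs S) (fun z _ => Set.mem_univ _)
  simp only [smul_eq_mul] at hJ
  refine hJ.trans ?_
  have h1 : ∀ z, gibbs S z * Real.exp (S z) = 1 / ∑ x, Real.exp (-S x) := by
    intro z
    rw [gibbs, div_mul_eq_mul_div, ← Real.exp_add]
    simp
  simp_rw [h1]
  have h2 : 1 ≤ ∑ x, Real.exp (-S x) := by
    have := Finset.single_le_sum (f := fun x => Real.exp (-S x))
      (fun x _ => (Real.exp_pos _).le) (Finset.mem_univ (0 : ZMod p))
    simpa [hS0] using this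
  simp only [Finset.sum_const, Finset.card_univ, ZMod.card, nsmul_eq_mul]
  rw [mul_one_div]
  exact div_le_self hp.le h2

end Gibbs

section Net
variable {p : ℕ} [NeZero p]

lemma norm_sum_mul_le_one {μ : ZMod p → ℝ} (hμ : ∀ z, 0 ≤ μ z) (hμ1 : ∑ z, μ z = 1)
    {g : ZMod p → ℂ} (hg : ∀ z, ‖g z‖ ≤ 1) : ‖∑ z, g z * μ z‖ ≤ 1 := by
  refine (norm_sum_le _ _).trans ?_
  rw [← hμ1]
  refine Finset.sum_le_sum fun z _ => ?_
  rw [norm_mul, Complex.norm_real, Real.norm_of_nonneg (hμ z)]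
  exact mul_le_of_le_one_left (hμ z) (hg z)

/-- A Bessel type bound for characters that are almost orthogonal with respect to `μ`. -/
lemma card_almost_orthogonal_le {μ : ZMod p → ℝ} (hμ : ∀ z, 0 ≤ μ z) (hμ1 : ∑ z, μ z = 1)
    {g : ZMod p → ℂ} (hg : ∀ z, ‖g z‖ ≤ 1) {δ : ℝ} (hδ : 0 < δ) (R : Finset (ZMod p))
    (hR : ∀ r ∈ R, δ ≤ ‖∑ z, g z * chi r z * μ z‖)
    (hsep : ∀ r ∈ R, ∀ s ∈ R, r ≠ s → ‖∑ z, chi (r - s) z * μ z‖ ≤ δ ^ 2 / 2) :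
    (R.card : ℝ) ≤ 2 / δ ^ 2 := by
  set a : ZMod p → ℂ := fun r => ∑ z, g z * chi r z * μ z with ha
  set Q : ℝ := ∑ r ∈ R, ‖a r‖ ^ 2 with hQ
  set N : ℝ := (R.card : ℝ) with hN
  have hQ0 : 0 ≤ Q := Finset.sum_nonneg fun r _ => sq_nonneg _
  have hN0 : 0 ≤ N := Nat.cast_nonneg _
  set P : ZMod p → ℂ := fun z => ∑ r ∈ R, star (a r) * chi r z with hP
  have h1 : (Q : ℂ) = ∑ z, g z * μ z * P z := by
    rw [hQ, hP]
    push_cast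
    simp_rw [Finset.mul_sum]
    rw [Finset.sum_comm]
    refine Finset.sum_congr rfl fun r _ => ?_
    have : ((‖a r‖ : ℂ)) ^ 2 = star (a r) * a r := by
      rw [Complex.star_def, Complex.conj_mul']
    rw [this]
    conv_lhs => rw [ha]
    simp only
    rw [Finset.mul_sum]
    refine Finset.sum_congr rfl fun z _ => ?_
    ring
  have h2 : Q ≤ ∑ z, μ z * ‖P z‖ := by
    have : Q = ‖(Q : ℂ)‖ := by rw [Complex.norm_real, Real.norm_of_nonneg hQ0]
    rw [this, h1]
    refine (norm_sum_le _ _).trans (Finset.sum_le_sum fun z _ => ?_)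
    rw [norm_mul, norm_mul, Complex.norm_real, Real.norm_of_nonneg (hμ z)]
    have := mul_le_of_le_one_left (hμ z) (hg z)
    gcongr
  have h3 : Q ^ 2 ≤ ∑ z, μ z * ‖P z‖ ^ 2 := by
    have hJ := (convexOn_pow (𝕜 := ℝ) 2).map_sum_le (t := Finset.univ) (w := μ)
      (p := fun z => ‖P z‖) (fun z _ => hμ z) hμ1 (fun z _ => norm_nonneg _)
    simp only [smul_eq_mul] at hJ
    exact (pow_le_pow_left₀ hQ0 h2 2).trans hJ
  have h4 : ((∑ z, μ z * ‖P z‖ ^ 2 : ℝ) : ℂ) =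
      ∑ r ∈ R, ∑ s ∈ R, star (a r) * a s * ∑ z, chi (r - s) z * μ z := by
    push_cast
    have : ∀ z, (μ z : ℂ) * (‖P z‖ : ℂ) ^ 2 =
        ∑ r ∈ R, ∑ s ∈ R, star (a r) * a s * (chi (r - s) z * μ z) := by
      intro z
      rw [← Complex.mul_conj', ← Complex.star_def, hP]
      simp only
      rw [star_sum, Finset.sum_mul_sum, Finset.mul_sum]
      refine Finset.sum_congr rfl fun r _ => ?_
      rw [Finset.mul_sum]
      refine Finset.sum_congr rfl fun s _ => ?_
      rw [sub_eq_add_neg, chi_add_left, chi_neg_left, star_mul', star_star]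
      ring
    simp_rw [this]
    rw [Finset.sum_comm]
    refine Finset.sum_congr rfl fun r _ => ?_
    rw [Finset.sum_comm]
    simp_rw [Finset.mul_sum]
  have hκ : 0 ≤ δ ^ 2 / 2 := by positivity
  have h5 : ∑ z, μ z * ‖P z‖ ^ 2 ≤ Q + δ ^ 2 / 2 * (∑ r ∈ R, ‖a r‖) ^ 2 := by
    have h0 : 0 ≤ ∑ z, μ z * ‖P z‖ ^ 2 :=
      Finset.sum_nonneg fun z _ => mul_nonneg (hμ z) (sq_nonneg _)
    calc ∑ z, μ z * ‖P z‖ ^ 2 = ‖((∑ z, μ z * ‖P z‖ ^ 2 : ℝ) : ℂ)‖ := by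
          rw [Complex.norm_real, Real.norm_of_nonneg h0]
      _ ≤ ∑ r ∈ R, ∑ s ∈ R,
          ((if r = s then ‖a r‖ ^ 2 else 0) + δ ^ 2 / 2 * (‖a r‖ * ‖a s‖)) := by
          rw [h4]
          refine (norm_sum_le _ _).trans (Finset.sum_le_sum fun r hr => ?_)
          refine (norm_sum_le _ _).trans (Finset.sum_le_sum fun s hs => ?_)
          rw [norm_mul, norm_mul, norm_star]
          split_ifs with hrs
          · subst hrs
            have := norm_sum_mul_le_one hμ hμ1 (g := chi (r - r)) fun z => (norm_chi _ _).le
            have h6 : 0 ≤ ‖a r‖ * ‖a r‖ := by positivity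
            nlinarith [mul_nonneg hκ h6, mul_le_mul_of_nonneg_left this h6]
          · rw [zero_add, mul_comm]
            have := hsep r hr s hs hrs
            gcongr
      _ = Q + δ ^ 2 / 2 * (∑ r ∈ R, ‖a r‖) ^ 2 := by
          simp_rw [Finset.sum_add_distrib, Finset.sum_ite_eq, ← Finset.mul_sum]
          rw [sq (∑ r ∈ R, ‖a r‖), Finset.sum_mul, hQ]
          congr 1
          exact Finset.sum_congr rfl fun r hr => if_pos hr
  have h6 : (∑ r ∈ R, ‖a r‖) ^ 2 ≤ N * Q := sq_sum_le_card_mul_sum_sq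
  have h7 : N * δ ^ 2 ≤ Q := by
    rw [hN, ← nsmul_eq_mul, hQ]
    exact Finset.card_nsmul_le_sum _ _ _ fun r hr => pow_le_pow_left₀ hδ.le (hR r hr) 2
  have h8 : Q ^ 2 ≤ Q * (1 + δ ^ 2 / 2 * N) := by
    nlinarith [mul_le_mul_of_nonneg_left h6 hκ]
  have hδ2 : 0 < δ ^ 2 := by positivity
  rw [le_div_iff₀ hδ2]
  rcases hQ0.eq_or_lt with hq | hq
  · nlinarith
  · have : Q ≤ 1 + δ ^ 2 / 2 * N := by
      by_contra hc
      push Not at hc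
      nlinarith [mul_lt_mul_of_pos_left hc hq]
    linarith

/-- Every frequency at which `g μ` has a large Fourier coefficient is close, with respect to `μ`,
to a member of a small set of frequencies. -/
lemma exists_net {μ : ZMod p → ℝ} (hμ : ∀ z, 0 ≤ μ z) (hμ1 : ∑ z, μ z = 1)
    {g : ZMod p → ℂ} (hg : ∀ z, ‖g z‖ ≤ 1) {δ : ℝ} (hδ : 0 < δ) :
    ∃ R : Finset (ZMod p), (R.card : ℝ) ≤ 2 / δ ^ 2 ∧
      ∀ r, δ ≤ ‖∑ z, g z * chi r z * μ z‖ →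
        ∃ s ∈ R, δ ^ 2 / 2 ≤ ‖∑ z, chi (r - s) z * μ z‖ := by
  classical
  set F : Finset (Finset (ZMod p)) := Finset.univ.filter fun R =>
    (∀ r ∈ R, δ ≤ ‖∑ z, g z * chi r z * μ z‖) ∧
    ∀ r ∈ R, ∀ s ∈ R, r ≠ s → ‖∑ z, chi (r - s) z * μ z‖ ≤ δ ^ 2 / 2 with hF
  have hne : F.Nonempty := ⟨∅, by simp [hF]⟩
  obtain ⟨R, hRF, hmax⟩ := Finset.exists_max_image F Finset.card hne
  have hRF' := hRF
  simp only [hF, Finset.mem_filter, Finset.mem_univ, true_and] at hRF'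
  refine ⟨R, card_almost_orthogonal_le hμ hμ1 hg hδ R hRF'.1 hRF'.2, fun r hr => ?_⟩
  by_contra hcon
  push Not at hcon
  have hrR : r ∉ R := by
    intro hrR
    have h1 := hcon r hrR
    have h2 := norm_sum_mul_le_one hμ hμ1 (g := fun z => g z * chi r z)
      fun z => by rw [norm_mul, norm_chi, mul_one]; exact hg z
    have h3 : ∑ z, chi (r - r) z * (μ z : ℂ) = 1 := by
      simp_rw [sub_self, chi_zero_left, one_mul]
      exact_mod_cast hμ1
    rw [h3, norm_one] at h1
    nlinarith
  have hsymm : ∀ s, ‖∑ z, chi (s - r) z * (μ z : ℂ)‖ = ‖∑ z, chi (r - s) z * (μ z : ℂ)‖ := by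
    intro s
    rw [← norm_star, star_sum]
    congr 1
    refine Finset.sum_congr rfl fun z _ => ?_
    rw [star_mul', ← chi_neg_left, neg_sub, Complex.star_def, Complex.conj_ofReal]
  have hins : insert r R ∈ F := by
    simp only [hF, Finset.mem_filter, Finset.mem_univ, true_and, Finset.mem_insert]
    refine ⟨?_, ?_⟩
    · rintro s (rfl | hs)
      · exact hr
      · exact hRF'.1 s hs
    · rintro s (rfl | hs) t (rfl | ht) hst
      · exact absurd rfl hst
      · exact (hcon t ht).le
      · rw [hsymm]; exact (hcon s hs).le
      · exact hRF'.2 s hs t ht hst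
  have := hmax _ hins
  rw [Finset.card_insert_of_notMem hrR] at this
  omega

end Net

/-- The weight `W ∑_{r ∈ Γ} |1 - χ_r|`, small exactly on narrow Bohr sets with frequencies `Γ`. -/
noncomputable def bohrWeight {p : ℕ} [NeZero p] (Γ : Finset (ZMod p)) (W : ℝ) (y : ZMod p) : ℝ :=
  W * ∑ r ∈ Γ, ‖1 - chi r y‖

section BohrWeight
variable {p : ℕ} [NeZero p] {Γ : Finset (ZMod p)} {W : ℝ}

lemma bohrWeight_zero : bohrWeight Γ W 0 = 0 := by simp [bohrWeight, chi_zero_right]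

lemma bohrWeight_neg (y : ZMod p) : bohrWeight Γ W (-y) = bohrWeight Γ W y := by
  simp [bohrWeight, norm_one_sub_chi_neg_right]

lemma bohrWeight_add_le (hW : 0 ≤ W) (x y : ZMod p) :
    bohrWeight Γ W (x + y) ≤ bohrWeight Γ W x + bohrWeight Γ W y := by
  simp only [bohrWeight]
  rw [← mul_add, ← Finset.sum_add_distrib]
  gcongr
  exact norm_one_sub_chi_add_right _ _ _

lemma bohrWeight_mono {Γ' : Finset (ZMod p)} {W' : ℝ} (hΓ : Γ ⊆ Γ') (hW' : 0 ≤ W')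
    (hWW' : W ≤ W') (y : ZMod p) : bohrWeight Γ W y ≤ bohrWeight Γ' W' y := by
  have : ∑ r ∈ Γ, ‖1 - chi r y‖ ≤ ∑ r ∈ Γ', ‖1 - chi r y‖ :=
    Finset.sum_le_sum_of_subset_of_nonneg hΓ fun _ _ _ => norm_nonneg _
  simp only [bohrWeight]
  have h0 : 0 ≤ ∑ r ∈ Γ, ‖1 - chi r y‖ := Finset.sum_nonneg fun _ _ => norm_nonneg _
  exact mul_le_mul hWW' this h0 hW'

/-- Dirichlet's simultaneous approximation, in `ZMod p`. -/
lemma exists_ne_zero_norm_one_sub_chi_le (Γ : Finset (ZMod p)) {m D : ℕ} (hm : 0 < m)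
    (hD : Γ.card ≤ D) (hp : m ^ D < p) :
    ∃ y : ZMod p, y ≠ 0 ∧ ∀ r ∈ Γ, ‖1 - chi r y‖ ≤ 7 / m := by
  have hp0 : 0 < p := Nat.pos_of_neZero p
  let F : ZMod p → (Γ → Fin m) := fun x r =>
    ⟨m * (r.1 * x).val / p, by
      rw [Nat.div_lt_iff_lt_mul hp0]
      exact Nat.mul_lt_mul_of_pos_left (ZMod.val_lt _) hm⟩
  have hcard : Fintype.card (Γ → Fin m) < Fintype.card (ZMod p) := by
    simp only [Fintype.card_fun, Fintype.card_fin, Fintype.card_coe, ZMod.card]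
    exact (Nat.pow_le_pow_right hm hD).trans_lt hp
  obtain ⟨x, x', hne, hF⟩ := Fintype.exists_ne_map_eq_of_card_lt F hcard
  refine ⟨x - x', sub_ne_zero.2 hne, fun r hr => ?_⟩
  have h1 : m * (r * x).val / p = m * (r * x').val / p :=
    congrArg Fin.val (congrFun hF ⟨r, hr⟩)
  set v := (r * x).val with hv
  set v' := (r * x').val with hv'
  have hpR : (0 : ℝ) < p := by exact_mod_cast hp0
  have hmR : (0 : ℝ) < m := by exact_mod_cast hm
  have h2 : |(v : ℝ) - v'| ≤ p / m := by
    rw [le_div_iff₀ hmR]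
    have a1 := Nat.div_add_mod (m * v) p
    have a2 := Nat.div_add_mod (m * v') p
    have a3 := Nat.mod_lt (m * v) hp0
    have a4 := Nat.mod_lt (m * v') hp0
    rw [h1] at a1
    have b1 : m * v ≤ m * v' + p := by omega
    have b2 : m * v' ≤ m * v + p := by omega
    have c1 : (m : ℝ) * v ≤ m * v' + p := by exact_mod_cast b1
    have c2 : (m : ℝ) * v' ≤ m * v + p := by exact_mod_cast b2
    have : |(v : ℝ) - v'| * m = |(m : ℝ) * v - m * v'| := by
      rw [← mul_sub, abs_mul, abs_of_pos hmR, mul_comm]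
    rw [this, abs_le]
    constructor <;> linarith
  have h3 : chi r (x - x') = Complex.exp (I * ((2 * π * ((v : ℝ) - v') / p : ℝ) : ℂ)) := by
    have : r * (x - x') = (((v : ℤ) - (v' : ℤ) : ℤ) : ZMod p) := by
      push_cast
      rw [hv, hv', ZMod.natCast_zmod_val, ZMod.natCast_zmod_val]; ring
    rw [chi, this, ZMod.stdAddChar_coe]
    congr 1
    push_cast
    ring
  rw [h3, norm_sub_rev]
  refine (Real.norm_exp_I_mul_ofReal_sub_one_le).trans ?_
  rw [Real.norm_eq_abs, abs_div, abs_mul, abs_of_pos hpR, abs_of_pos Real.two_pi_pos,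
    div_le_iff₀ hpR]
  calc 2 * π * |(v : ℝ) - v'| ≤ 7 * (p / m) := by
        have := Real.pi_lt_d2
        gcongr
        linarith
    _ = 7 / m * p := by ring

end BohrWeight

section LocalMean
variable {p : ℕ} [NeZero p]

/-- The average of `f` near `x` with respect to the weight `μ`. -/
noncomputable def localMean (f μ : ZMod p → ℝ) (x : ZMod p) : ℝ := ∑ z, f (x + z) * μ z

/-- In `ZMod p` with `p` prime, slowly varying averages take an intermediate value. -/
lemma exists_localMean_mem (hp : p.Prime) {f : ZMod p → ℝ} (hf : ∀ x, f x = 0 ∨ f x = 1)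
    {S : ZMod p → ℝ} (hadd : ∀ x y, S (x + y) ≤ S x + S y) (hneg : ∀ x, S (-x) = S x)
    {y : ZMod p} (hy : y ≠ 0) (hSy : S y ≤ 1 / 4)
    (h0 : ∃ x, 1 / 4 ≤ localMean f (gibbs S) x) (h1 : ∃ x, localMean f (gibbs S) x ≤ 3 / 4) :
    ∃ x, 1 / 4 ≤ localMean f (gibbs S) x ∧ localMean f (gibbs S) x ≤ 3 / 4 := by
  have := Fact.mk hp
  by_contra hcon
  push Not at hcon
  obtain ⟨x₀, hx₀⟩ := h0
  obtain ⟨x₁, hx₁⟩ := h1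
  have hstep : ∀ x, localMean f (gibbs S) x - localMean f (gibbs S) (x + y) ≤ 1 / 2 := by
    intro x
    have e1 : localMean f (gibbs S) x = ∑ z, f (x + y + z) * gibbs S (z + y) := by
      rw [localMean, ← Equiv.sum_comp (Equiv.addRight y)]
      refine Finset.sum_congr rfl fun z _ => ?_
      simp only [Equiv.coe_addRight]
      congr 2; ring
    rw [e1, localMean, ← Finset.sum_sub_distrib]
    calc ∑ z, (f (x + y + z) * gibbs S (z + y) - f (x + y + z) * gibbs S z)
        ≤ ∑ z, |gibbs S (z + y) - gibbs S z| := by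
          refine Finset.sum_le_sum fun z _ => ?_
          rw [← mul_sub]
          rcases hf (x + y + z) with h | h <;> rw [h]
          · rw [zero_mul]; exact abs_nonneg _
          · rw [one_mul]; exact le_abs_self _
      _ ≤ 2 * S y := sum_abs_gibbs_shift_le hadd hneg y
      _ ≤ 1 / 2 := by linarith
  have hall : ∀ n : ℕ, 3 / 4 < localMean f (gibbs S) (x₀ + n * y) := by
    intro n
    induction n with
    | zero => simpa using hcon x₀ hx₀
    | succ n ih =>
      apply hcon
      have := hstep (x₀ + n * y)
      rw [show x₀ + ((n + 1 : ℕ) : ZMod p) * y = x₀ + n * y + y by push_cast; ring]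
      linarith
  have := hall ((x₁ - x₀) / y).val
  rw [ZMod.natCast_zmod_val, div_mul_cancel₀ _ hy, add_sub_cancel] at this
  linarith

/-- The `ℓ²` distance between `f` and its local averages. -/
lemma sum_sub_localMean_sq {f : ZMod p → ℝ} {c : ZMod p → ℂ}
    (hc : ∀ x, (f x : ℂ) = ∑ r, c r * chi r x) (μ : ZMod p → ℝ) :
    ∑ x, (f x - localMean f μ x) ^ 2 =
      p * ∑ r, ‖c r‖ ^ 2 * ‖1 - ∑ z, chi r z * (μ z : ℂ)‖ ^ 2 := by
  have h : ∀ x, ((f x - localMean f μ x : ℝ) : ℂ) =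
      ∑ r, (c r * (1 - ∑ z, chi r z * (μ z : ℂ))) * chi r x := by
    intro x
    have h1 : ((localMean f μ x : ℝ) : ℂ) = ∑ r, c r * (∑ z, chi r z * (μ z : ℂ)) * chi r x := by
      rw [localMean]
      push_cast
      simp_rw [hc, Finset.sum_mul, Finset.mul_sum, Finset.sum_mul]
      rw [Finset.sum_comm]
      refine Finset.sum_congr rfl fun r _ => Finset.sum_congr rfl fun z _ => ?_
      rw [chi_add_right]; ring
    push_cast
    rw [h1, hc, ← Finset.sum_sub_distrib]
    refine Finset.sum_congr rfl fun r _ => ?_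
    ring
  have := sum_norm_sq h
  simp only [norm_mul, mul_pow, Complex.norm_real, Real.norm_eq_abs, sq_abs] at this
  exact this

lemma exists_localMean_ge_and_le {f : ZMod p → ℝ} (hf : ∀ x, f x = 0 ∨ f x = 1) {c : ZMod p → ℂ}
    (hc : ∀ x, (f x : ℂ) = ∑ r, c r * chi r x) {μ : ZMod p → ℝ} {β : ℝ}
    (hβ0 : β * p ≤ ∑ x, f x) (hβ1 : β * p ≤ ∑ x, (1 - f x))
    (hsmall : ∑ r, ‖c r‖ ^ 2 * ‖1 - ∑ z, chi r z * (μ z : ℂ)‖ ^ 2 < 9 / 16 * β) :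
    (∃ x, 1 / 4 ≤ localMean f μ x) ∧ ∃ x, localMean f μ x ≤ 3 / 4 := by
  have hp : (0 : ℝ) < p := by exact_mod_cast Nat.pos_of_neZero p
  have key := sum_sub_localMean_sq hc μ
  have hlt : ∑ x, (f x - localMean f μ x) ^ 2 < 9 / 16 * (β * p) := by
    rw [key]; nlinarith
  constructor
  · by_contra hcon
    push Not at hcon
    have : 9 / 16 * ∑ x, f x ≤ ∑ x, (f x - localMean f μ x) ^ 2 := by
      rw [Finset.mul_sum]
      refine Finset.sum_le_sum fun x _ => ?_
      have := hcon x
      rcases hf x with h | h <;> rw [h]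
      · nlinarith [sq_nonneg (localMean f μ x)]
      · nlinarith
    linarith
  · by_contra hcon
    push Not at hcon
    have : 9 / 16 * ∑ x, (1 - f x) ≤ ∑ x, (f x - localMean f μ x) ^ 2 := by
      rw [Finset.mul_sum]
      refine Finset.sum_le_sum fun x _ => ?_
      have := hcon x
      rcases hf x with h | h <;> rw [h]
      · nlinarith
      · nlinarith [sq_nonneg (1 - localMean f μ x)]
    linarith

end LocalMean

section Increment
variable {p : ℕ} [NeZero p]

open Classical in
/-- The frequencies whose characters are controlled by a Bohr weight. -/
noncomputable def covered (L : ℝ) (Γ : Finset (ZMod p)) (W : ℝ) : Finset (ZMod p) :=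
  Finset.univ.filter fun r => ∀ y, L * ‖1 - chi r y‖ ≤ bohrWeight Γ W y

lemma mem_covered {L : ℝ} {Γ : Finset (ZMod p)} {W : ℝ} {r : ZMod p} :
    r ∈ covered L Γ W ↔ ∀ y, L * ‖1 - chi r y‖ ≤ bohrWeight Γ W y := by
  simp [covered]

lemma covered_mono {L : ℝ} {Γ Γ' : Finset (ZMod p)} {W W' : ℝ} (hΓ : Γ ⊆ Γ') (hW' : 0 ≤ W')
    (hWW' : W ≤ W') : covered L Γ W ⊆ covered L Γ' W' := fun _ hr =>
  mem_covered.2 fun y => (mem_covered.1 hr y).trans (bohrWeight_mono hΓ hW' hWW' y)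

/-- Covered frequencies are almost constant on average. -/
lemma sum_norm_one_sub_chi_le {L : ℝ} (hL : 0 < L) {Γ : Finset (ZMod p)} {W : ℝ} {r : ZMod p}
    (hr : r ∈ covered L Γ W) :
    ∑ z, ‖1 - chi r z‖ * gibbs (bohrWeight Γ W) z ≤ Real.log p / L := by
  rw [le_div_iff₀ hL]
  refine le_trans ?_ (sum_gibbs_mul_le (S := bohrWeight Γ W) bohrWeight_zero)
  rw [Finset.sum_mul]
  refine Finset.sum_le_sum fun z _ => ?_
  have := mul_le_mul_of_nonneg_left (mem_covered.1 hr z) (gibbs_nonneg (bohrWeight Γ W) z)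
  linarith

lemma norm_one_sub_chi_mul_le {S : ZMod p → ℝ} (hadd : ∀ x y, S (x + y) ≤ S x + S y)
    (hneg : ∀ x, S (-x) = S x) (r y : ZMod p) :
    ‖1 - chi r y‖ * ‖∑ z, chi r z * (gibbs S z : ℂ)‖ ≤ 2 * S y := by
  have h : (1 - chi r y) * ∑ z, chi r z * (gibbs S z : ℂ) =
      ∑ z, chi r (z + y) * ((gibbs S (z + y) - gibbs S z : ℝ) : ℂ) := by
    push_cast
    simp_rw [mul_sub, Finset.sum_sub_distrib]
    rw [show ∑ z, chi r (z + y) * (gibbs S (z + y) : ℂ) = ∑ z, chi r z * (gibbs S z : ℂ) from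
      Equiv.sum_comp (Equiv.addRight y) fun z => chi r z * (gibbs S z : ℂ)]
    simp_rw [chi_add_right, sub_mul, one_mul, Finset.mul_sum]
    congr 1
    exact Finset.sum_congr rfl fun z _ => by ring
  rw [← norm_mul, h]
  refine (norm_sum_le _ _).trans ?_
  simp_rw [norm_mul, norm_chi, one_mul, Complex.norm_real, Real.norm_eq_abs]
  exact sum_abs_gibbs_shift_le hadd hneg y

/-- At a place where the local average of a `{0, 1}`-valued function is intermediate, a new portion
of the `ℓ¹` mass of its Fourier coefficients gets covered. -/
lemma exists_increment {f : ZMod p → ℝ} (hf : ∀ x, f x = 0 ∨ f x = 1) {c : ZMod p → ℂ}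
    (hc : ∀ x, (f x : ℂ) = ∑ r, c r * chi r x) {T : ℝ} (hT : 0 < T) (hcT : ∑ r, ‖c r‖ ≤ T)
    {Γ : Finset (ZMod p)} {W L B : ℝ} (hW : 1 ≤ W) (hL : 0 < L) (hpL : 16 * T * Real.log p ≤ L)
    (hB1 : 1 ≤ B) (hB : L * (1024 * T ^ 2 + 1) ≤ B) {x : ZMod p}
    (hx0 : 1 / 4 ≤ localMean f (gibbs (bohrWeight Γ W)) x)
    (hx1 : localMean f (gibbs (bohrWeight Γ W)) x ≤ 3 / 4) :
    ∃ R : Finset (ZMod p), (R.card : ℝ) ≤ 512 * T ^ 2 ∧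
      ∑ r ∈ covered L Γ W, ‖c r‖ + 1 / 8 ≤ ∑ r ∈ covered L (Γ ∪ R) (B * W), ‖c r‖ := by
  classical
  set S := bohrWeight Γ W with hS
  set μ := gibbs S with hμ
  set m := localMean f μ x with hm
  have hW0 : 0 ≤ W := by linarith
  have hμ0 : ∀ z, 0 ≤ μ z := gibbs_nonneg S
  have hμ1 : ∑ z, μ z = 1 := sum_gibbs S
  set g : ZMod p → ℂ := fun z => ((f (x + z) - m : ℝ) : ℂ) with hg
  have hg1 : ∀ z, ‖g z‖ ≤ 1 := by
    intro z
    rw [hg]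
    simp only
    rw [Complex.norm_real, Real.norm_eq_abs, abs_le]
    rcases hf (x + z) with h | h <;> rw [h] <;> constructor <;> linarith
  set δ : ℝ := 1 / (16 * T) with hδ
  have hδ0 : 0 < δ := by positivity
  obtain ⟨R, hRc, hR⟩ := exists_net hμ0 hμ1 hg1 hδ0
  have hδ2 : 2 / δ ^ 2 = 512 * T ^ 2 := by rw [hδ]; field_simp; norm_num
  refine ⟨R, by rwa [hδ2] at hRc, ?_⟩
  set σ : ZMod p → ℂ := fun r => ∑ z, g z * chi r z * (μ z : ℂ) with hσ
  have hσ1 : ∀ r, ‖σ r‖ ≤ 1 := fun r =>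
    norm_sum_mul_le_one hμ0 hμ1 (g := fun z => g z * chi r z)
      fun z => by rw [norm_mul, norm_chi, mul_one]; exact hg1 z
  have hgμ : ∑ z, g z * (μ z : ℂ) = 0 := by
    rw [hg]
    have : ∑ z, (f (x + z) - m) * μ z = 0 := by
      simp_rw [sub_mul, Finset.sum_sub_distrib, ← Finset.mul_sum, hμ1]
      rw [hm, localMean]; ring
    beta_reduce
    exact_mod_cast this
  have hvar : ((m - m * m : ℝ) : ℂ) = ∑ r, c r * chi r x * σ r := by
    have h1 : m - m * m = ∑ z, (f (x + z) - m) * μ z * f (x + z) := by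
      have : ∀ z, (f (x + z) - m) * μ z * f (x + z) = f (x + z) * μ z - m * (f (x + z) * μ z) := by
        intro z
        rcases hf (x + z) with h | h <;> rw [h] <;> ring
      simp_rw [this, Finset.sum_sub_distrib, ← Finset.mul_sum]
      rfl
    rw [h1]
    push_cast
    simp_rw [hc (x + _), Finset.mul_sum]
    rw [Finset.sum_comm]
    refine Finset.sum_congr rfl fun r _ => ?_
    rw [hσ]
    simp only
    rw [Finset.mul_sum]
    refine Finset.sum_congr rfl fun z _ => ?_
    rw [chi_add_right, hg]
    push_cast
    rw [hc]
    ring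
  have hlow : 3 / 16 ≤ ∑ r, ‖c r‖ * ‖σ r‖ := by
    have h1 : 3 / 16 ≤ m - m * m := by nlinarith
    have h2 : m - m * m ≤ ‖((m - m * m : ℝ) : ℂ)‖ := by
      rw [Complex.norm_real]; exact Real.le_norm_self _
    rw [hvar] at h2
    refine (h1.trans h2).trans ((norm_sum_le _ _).trans (le_of_eq ?_))
    simp_rw [norm_mul, norm_chi, mul_one]
  set C := covered L Γ W with hC
  set C' := covered L (Γ ∪ R) (B * W) with hC'
  have hBW : W ≤ B * W := le_mul_of_one_le_left hW0 hB1
  have hCC' : C ⊆ C' :=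
    covered_mono Finset.subset_union_left (hW0.trans hBW) hBW
  have hold : ∀ r ∈ C, ‖σ r‖ ≤ δ := by
    intro r hr
    have h1 : σ r = ∑ z, (g z * (chi r z - 1)) * (μ z : ℂ) := by
      have : ∑ z, (g z * (chi r z - 1)) * (μ z : ℂ) = σ r - ∑ z, g z * (μ z : ℂ) := by
        rw [hσ, ← Finset.sum_sub_distrib]
        exact Finset.sum_congr rfl fun z _ => by ring
      rw [this, hgμ, sub_zero]
    rw [h1]
    refine (norm_sum_le _ _).trans ?_
    refine le_trans (Finset.sum_le_sum fun z _ => ?_)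
      ((sum_norm_one_sub_chi_le hL hr).trans ?_)
    · have hz : ‖((μ z : ℝ) : ℂ)‖ = μ z := by rw [Complex.norm_real, Real.norm_of_nonneg (hμ0 z)]
      rw [norm_mul, norm_mul, hz, norm_sub_rev (chi r z)]
      exact mul_le_mul_of_nonneg_right
        (mul_le_of_le_one_left (norm_nonneg _) (hg1 z)) (hμ0 z)
    · rw [hδ, div_le_div_iff₀ hL (by positivity)]
      linarith
  have hnew : ∀ r, δ ≤ ‖σ r‖ → r ∈ C' := by
    intro r hr
    obtain ⟨s, hsR, hs⟩ := hR r hr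
    rw [hC', mem_covered]
    intro y
    have h1 := norm_one_sub_chi_mul_le (S := S) (bohrWeight_add_le hW0) bohrWeight_neg (r - s) y
    have h2 : ‖1 - chi (r - s) y‖ ≤ 1024 * T ^ 2 * S y := by
      have h3 : ‖1 - chi (r - s) y‖ * (δ ^ 2 / 2) ≤ 2 * S y :=
        (mul_le_mul_of_nonneg_left hs (norm_nonneg _)).trans h1
      have h4 : δ ^ 2 / 2 * (512 * T ^ 2) = 1 := by rw [← hδ2]; field_simp
      have h5 : 0 ≤ 512 * T ^ 2 := by positivity
      have := mul_le_mul_of_nonneg_right h3 h5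
      rw [mul_assoc, h4] at this
      linarith
    have h3 : ‖1 - chi r y‖ ≤ ‖1 - chi (r - s) y‖ + ‖1 - chi s y‖ := by
      simpa using norm_one_sub_chi_add_left (r - s) s y
    set U := ∑ r ∈ Γ ∪ R, ‖1 - chi r y‖ with hU
    have h4 : S y ≤ W * U := bohrWeight_mono Finset.subset_union_left hW0 le_rfl y
    have h5 : ‖1 - chi s y‖ ≤ U :=
      Finset.single_le_sum (f := fun r => ‖1 - chi r y‖) (fun _ _ => norm_nonneg _)
        (Finset.mem_union_right _ hsR)
    have hU0 : 0 ≤ U := Finset.sum_nonneg fun _ _ => norm_nonneg _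
    have h6 : ‖1 - chi r y‖ ≤ (1024 * T ^ 2 + 1) * (W * U) := by
      have h7 : U ≤ W * U := le_mul_of_one_le_left hU0 hW
      have h8 : 1024 * T ^ 2 * S y ≤ 1024 * T ^ 2 * (W * U) := by gcongr
      linarith
    calc L * ‖1 - chi r y‖ ≤ L * ((1024 * T ^ 2 + 1) * (W * U)) := by gcongr
      _ = L * (1024 * T ^ 2 + 1) * (W * U) := by ring
      _ ≤ B * (W * U) := by gcongr
      _ = bohrWeight (Γ ∪ R) (B * W) y := by rw [bohrWeight]; ring
  have hup : ∀ r, ‖c r‖ * ‖σ r‖ ≤ ‖c r‖ * δ + if r ∈ C' \ C then ‖c r‖ else 0 := by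
    intro r
    have h0 := norm_nonneg (c r)
    split_ifs with h
    · have := mul_le_mul_of_nonneg_left (hσ1 r) h0
      nlinarith
    · rw [add_zero]
      refine mul_le_mul_of_nonneg_left ?_ h0
      by_cases hrC : r ∈ C
      · exact hold r hrC
      · by_contra hlt
        push Not at hlt
        exact h (Finset.mem_sdiff.2 ⟨hnew r hlt.le, hrC⟩)
  have hfin := hlow.trans (Finset.sum_le_sum fun r _ => hup r)
  rw [Finset.sum_add_distrib, ← Finset.sum_mul, Finset.sum_ite_mem, Finset.univ_inter] at hfin
  have h1 : (∑ r, ‖c r‖) * δ ≤ 1 / 16 := by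
    calc (∑ r, ‖c r‖) * δ ≤ T * δ := by gcongr
      _ = 1 / 16 := by rw [hδ]; field_simp
  have h2 := Finset.sum_sdiff (f := fun r => ‖c r‖) hCC'
  linarith

end Increment

section Mass
variable {p : ℕ} [NeZero p]

lemma subset_covered {L W : ℝ} (hL : 0 ≤ L) (hLW : L ≤ W) (Γ : Finset (ZMod p)) :
    Γ ⊆ covered L Γ W := by
  intro r hr
  rw [mem_covered]
  intro y
  exact mul_le_mul hLW (Finset.single_le_sum (f := fun r => ‖1 - chi r y‖)
    (fun _ _ => norm_nonneg _) hr) (norm_nonneg _) (hL.trans hLW)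

lemma norm_one_sub_sum_chi_le {μ : ZMod p → ℝ} (hμ0 : ∀ z, 0 ≤ μ z) (hμ1 : ∑ z, μ z = 1)
    (r : ZMod p) : ‖1 - ∑ z, chi r z * (μ z : ℂ)‖ ≤ ∑ z, ‖1 - chi r z‖ * μ z := by
  have h : 1 - ∑ z, chi r z * (μ z : ℂ) = ∑ z, (1 - chi r z) * (μ z : ℂ) := by
    simp_rw [sub_mul, Finset.sum_sub_distrib, one_mul]
    congr 1
    exact_mod_cast hμ1.symm
  rw [h]
  refine (norm_sum_le _ _).trans (Finset.sum_le_sum fun z _ => ?_)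
  rw [norm_mul, Complex.norm_real, Real.norm_of_nonneg (hμ0 z)]

lemma exists_intermediate (hp : p.Prime) {f : ZMod p → ℝ} (hf : ∀ x, f x = 0 ∨ f x = 1)
    {c : ZMod p → ℂ} (hc : ∀ x, (f x : ℂ) = ∑ r, c r * chi r x) {T : ℝ} (hT : 0 < T)
    (hcT : ∑ r, ‖c r‖ ≤ T) {β : ℝ} (hβ : 0 < β) (hβ0 : β * p ≤ ∑ x, f x)
    (hβ1 : β * p ≤ ∑ x, (1 - f x)) {Γ : Finset (ZMod p)} {L W : ℝ} (hL : 0 < L) (hLW : L ≤ W)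
    (hpL : (Real.log p / L) ^ 2 ≤ β / 16) (hΓ : ∀ r, β / (16 * T) ≤ ‖c r‖ → r ∈ Γ)
    {m D : ℕ} (hm : 0 < m) (hD : Γ.card ≤ D) (hmp : m ^ D < p) (hWm : W * (D * (7 / m)) ≤ 1 / 4) :
    ∃ x, 1 / 4 ≤ localMean f (gibbs (bohrWeight Γ W)) x ∧
      localMean f (gibbs (bohrWeight Γ W)) x ≤ 3 / 4 := by
  have hW0 : 0 ≤ W := hL.le.trans hLW
  have hp0 : (0 : ℝ) < p := by exact_mod_cast hp.pos
  obtain ⟨y, hy, hyΓ⟩ := exists_ne_zero_norm_one_sub_chi_le Γ hm hD hmp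
  have hSy : bohrWeight Γ W y ≤ 1 / 4 := by
    refine le_trans (mul_le_mul_of_nonneg_left ?_ hW0) hWm
    refine (Finset.sum_le_card_nsmul _ _ _ hyΓ).trans ?_
    rw [nsmul_eq_mul]
    gcongr
  set μ := gibbs (bohrWeight Γ W) with hμ
  have hμ0 : ∀ z, 0 ≤ μ z := gibbs_nonneg _
  have hμ1 : ∑ z, μ z = 1 := sum_gibbs _
  have hsq : ∑ r, ‖c r‖ ^ 2 ≤ 1 := by
    have h := sum_norm_sq hc
    have h1 : ∑ x, ‖(f x : ℂ)‖ ^ 2 ≤ p := by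
      calc ∑ x, ‖(f x : ℂ)‖ ^ 2 ≤ ∑ _x : ZMod p, (1 : ℝ) := by
            refine Finset.sum_le_sum fun x _ => ?_
            rcases hf x with h | h <;> rw [h] <;> simp
        _ = p := by simp [ZMod.card]
    rw [h] at h1
    by_contra hcon
    push Not at hcon
    nlinarith
  have hsmall : ∑ r, ‖c r‖ ^ 2 * ‖1 - ∑ z, chi r z * (μ z : ℂ)‖ ^ 2 < 9 / 16 * β := by
    have hterm : ∀ r, ‖c r‖ ^ 2 * ‖1 - ∑ z, chi r z * (μ z : ℂ)‖ ^ 2 ≤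
        ‖c r‖ ^ 2 * (β / 16) + ‖c r‖ * (β / (4 * T)) := by
      intro r
      have hn := norm_one_sub_sum_chi_le hμ0 hμ1 r
      have h0 := norm_nonneg (1 - ∑ z, chi r z * (μ z : ℂ))
      have hc0 := norm_nonneg (c r)
      by_cases hr : β / (16 * T) ≤ ‖c r‖
      · have h1 := sum_norm_one_sub_chi_le hL (subset_covered hL.le hLW Γ (hΓ r hr))
        have h2 : ‖1 - ∑ z, chi r z * (μ z : ℂ)‖ ^ 2 ≤ β / 16 :=
          (pow_le_pow_left₀ h0 (hn.trans h1) 2).trans hpL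
        have h3 : 0 ≤ ‖c r‖ * (β / (4 * T)) := by positivity
        have h4 := mul_le_mul_of_nonneg_left h2 (sq_nonneg ‖c r‖)
        linarith
      · push Not at hr
        have h1 : ‖1 - ∑ z, chi r z * (μ z : ℂ)‖ ≤ 2 := by
          refine hn.trans ?_
          calc ∑ z, ‖1 - chi r z‖ * μ z ≤ ∑ z, 2 * μ z := by
                refine Finset.sum_le_sum fun z _ => mul_le_mul_of_nonneg_right ?_ (hμ0 z)
                refine (norm_sub_le _ _).trans ?_
                rw [norm_one, norm_chi]; norm_num
            _ = 2 := by rw [← Finset.mul_sum, hμ1, mul_one]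
        have h2 : ‖1 - ∑ z, chi r z * (μ z : ℂ)‖ ^ 2 ≤ 4 := by nlinarith
        have h3 : ‖c r‖ ^ 2 * ‖1 - ∑ z, chi r z * (μ z : ℂ)‖ ^ 2 ≤ ‖c r‖ ^ 2 * 4 := by gcongr
        have h4 : ‖c r‖ ^ 2 * 4 ≤ ‖c r‖ * (β / (4 * T)) := by
          have : β / (4 * T) = 4 * (β / (16 * T)) := by field_simp; norm_num
          rw [this]
          nlinarith
        have h5 : 0 ≤ ‖c r‖ ^ 2 * (β / 16) := by positivity
        linarith
    refine (Finset.sum_le_sum fun r _ => hterm r).trans_lt ?_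
    rw [Finset.sum_add_distrib, ← Finset.sum_mul, ← Finset.sum_mul]
    have h1 : (∑ r, ‖c r‖) * (β / (4 * T)) ≤ β / 4 := by
      calc (∑ r, ‖c r‖) * (β / (4 * T)) ≤ T * (β / (4 * T)) := by gcongr
        _ = β / 4 := by field_simp
    have h2 : (∑ r, ‖c r‖ ^ 2) * (β / 16) ≤ 1 * (β / 16) := by gcongr
    linarith
  obtain ⟨h0, h1⟩ := exists_localMean_ge_and_le hf hc hβ0 hβ1 hsmall
  exact exists_localMean_mem hp hf (bohrWeight_add_le hW0) bohrWeight_neg hy hSy h0 h1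

/-- A quantitative form of the fact that a subset of `ZMod p` which is neither very small nor
very large has an indicator function of large Wiener norm. -/
theorem not_wienerLE_indicator (hp : p.Prime) {q : ℕ} (hq : 100000 ≤ q) (hp1 : 2 ^ q ^ 11 ≤ p)
    (hp2 : p ≤ 2 ^ (q ^ 11 + 1)) {f : ZMod p → ℝ} (hf : ∀ x, f x = 0 ∨ f x = 1)
    (hw : WienerLE (fun x => (f x : ℂ)) (2 * (q : ℝ) ^ 2))
    (hβ0 : 1 / (4 * (q : ℝ) ^ 2) * p ≤ ∑ x, f x)
    (hβ1 : 1 / (4 * (q : ℝ) ^ 2) * p ≤ ∑ x, (1 - f x)) : False := by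
  classical
  obtain ⟨c, hc, hcT⟩ := hw
  have hqR : (100000 : ℝ) ≤ q := by exact_mod_cast hq
  have hq0 : (0 : ℝ) < q := by linarith
  have hq1 : (1 : ℝ) ≤ q := by linarith
  have hp0 : (0 : ℝ) < p := by exact_mod_cast hp.pos
  set T : ℝ := 2 * (q : ℝ) ^ 2 with hT
  set L : ℝ := (q : ℝ) ^ 15 with hL
  set B : ℝ := (q : ℝ) ^ 21 with hB
  set β : ℝ := 1 / (4 * (q : ℝ) ^ 2) with hβ
  have hT0 : 0 < T := by positivity
  have hL0 : 0 < L := by positivity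
  have hβpos : 0 < β := by positivity
  have hB1 : 1 ≤ B := one_le_pow₀ hq1
  have hlog0 : 0 ≤ Real.log p := Real.log_natCast_nonneg p
  have hlog : Real.log p ≤ (q : ℝ) ^ 12 := by
    have h1 : Real.log p ≤ Real.log ((2 : ℝ) ^ (q ^ 11 + 1)) :=
      Real.log_le_log hp0 (by exact_mod_cast hp2)
    rw [Real.log_pow] at h1
    push_cast at h1
    have h2 := Real.log_two_lt_d9
    have h3 : (1 : ℝ) ≤ (q : ℝ) ^ 11 := one_le_pow₀ hq1
    have h4 : ((q : ℝ) ^ 11 + 1) * Real.log 2 ≤ ((q : ℝ) ^ 11 + 1) * 1 := by gcongr; linarith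
    have h5 : (q : ℝ) ^ 12 = q * (q : ℝ) ^ 11 := by ring
    nlinarith
  set ρ : ℝ := β / (16 * T) with hρ
  have hρ' : ρ = 1 / (128 * (q : ℝ) ^ 4) := by rw [hρ, hβ, hT]; field_simp; norm_num
  have hρ0 : 0 < ρ := by positivity
  set R₀ : Finset (ZMod p) := Finset.univ.filter fun r => ρ ≤ ‖c r‖ with hR₀
  have hR₀c : (R₀.card : ℝ) ≤ 256 * (q : ℝ) ^ 6 := by
    have h1 : (R₀.card : ℝ) * ρ ≤ T := by
      rw [← nsmul_eq_mul]
      refine (Finset.card_nsmul_le_sum _ (fun r => ‖c r‖) _ fun r hr => ?_).trans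
        ((Finset.sum_le_univ_sum_of_nonneg fun _ => norm_nonneg _).trans hcT)
      exact (Finset.mem_filter.1 hr).2
    rw [hρ', mul_one_div, div_le_iff₀ (by positivity)] at h1
    rw [hT] at h1
    linarith [h1, show 2 * (q : ℝ) ^ 2 * (128 * (q : ℝ) ^ 4) = 256 * (q : ℝ) ^ 6 by ring]
  have key : ∀ i : ℕ, i ≤ 16 * q ^ 2 + 1 → ∃ Γ : Finset (ZMod p), R₀ ⊆ Γ ∧
      (Γ.card : ℝ) ≤ 256 * (q : ℝ) ^ 6 + i * (2048 * (q : ℝ) ^ 4) ∧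
      (i : ℝ) / 8 ≤ ∑ r ∈ covered L Γ (B ^ (i + 1)), ‖c r‖ := by
    intro i
    induction i with
    | zero =>
      intro _
      exact ⟨R₀, subset_rfl, by simpa using hR₀c, by
        simpa using Finset.sum_nonneg fun _ _ => norm_nonneg _⟩
    | succ i ih =>
      intro hi
      have hi' : i ≤ 16 * q ^ 2 := by omega
      obtain ⟨Γ, hΓR, hΓc, hΓm⟩ := ih (by omega)
      have hiR : (i : ℝ) ≤ 16 * (q : ℝ) ^ 2 := by exact_mod_cast hi'
      have hW1 : 1 ≤ B ^ (i + 1) := one_le_pow₀ hB1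
      have hLB : L ≤ B := pow_le_pow_right₀ hq1 (by norm_num)
      have hLW : L ≤ B ^ (i + 1) := hLB.trans (le_self_pow₀ hB1 (by omega))
      have hWq : B ^ (i + 1) ≤ (q : ℝ) ^ (357 * q ^ 2) := by
        rw [hB, ← pow_mul]
        refine pow_le_pow_right₀ hq1 ?_
        have : 1 ≤ q ^ 2 := Nat.one_le_pow _ _ (by omega)
        omega
      have hD : Γ.card ≤ 33024 * q ^ 6 := by
        have : (Γ.card : ℝ) ≤ 33024 * (q : ℝ) ^ 6 := by
          refine hΓc.trans ?_
          have : (i : ℝ) * (2048 * (q : ℝ) ^ 4) ≤ 16 * (q : ℝ) ^ 2 * (2048 * (q : ℝ) ^ 4) := by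
            gcongr
          linarith [this, show 16 * (q : ℝ) ^ 2 * (2048 * (q : ℝ) ^ 4) = 32768 * (q : ℝ) ^ 6 by ring]
        exact_mod_cast this
      have hm0 : 0 < q ^ (357 * q ^ 2 + 8) := Nat.pow_pos (by omega)
      have hmp : (q ^ (357 * q ^ 2 + 8)) ^ (33024 * q ^ 6) < p := by
        refine lt_of_lt_of_le ?_ hp1
        rw [← pow_mul]
        have he : q * ((357 * q ^ 2 + 8) * (33024 * q ^ 6)) ≤ q ^ 11 := by
          have h1 : 357 * q ^ 2 + 8 ≤ 365 * q ^ 2 := by nlinarith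
          have h2 : 365 * 33024 ≤ q ^ 2 := by nlinarith
          calc q * ((357 * q ^ 2 + 8) * (33024 * q ^ 6))
              ≤ q * ((365 * q ^ 2) * (33024 * q ^ 6)) := by gcongr
            _ = (365 * 33024) * q ^ 9 := by ring
            _ ≤ q ^ 2 * q ^ 9 := by gcongr
            _ = q ^ 11 := by ring
        calc q ^ ((357 * q ^ 2 + 8) * (33024 * q ^ 6))
            < (2 ^ q) ^ ((357 * q ^ 2 + 8) * (33024 * q ^ 6)) :=
              Nat.pow_lt_pow_left Nat.lt_two_pow_self (by positivity)
          _ = 2 ^ (q * ((357 * q ^ 2 + 8) * (33024 * q ^ 6))) := by rw [← pow_mul]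
          _ ≤ 2 ^ q ^ 11 := Nat.pow_le_pow_right (by norm_num) he
      have hWm : B ^ (i + 1) * (((33024 * q ^ 6 : ℕ) : ℝ) *
          (7 / ((q ^ (357 * q ^ 2 + 8) : ℕ) : ℝ))) ≤ 1 / 4 := by
        push_cast
        rw [pow_add (q : ℝ)]
        calc B ^ (i + 1) * (33024 * (q : ℝ) ^ 6 * (7 / ((q : ℝ) ^ (357 * q ^ 2) * (q : ℝ) ^ 8)))
            ≤ (q : ℝ) ^ (357 * q ^ 2) *
              (33024 * (q : ℝ) ^ 6 * (7 / ((q : ℝ) ^ (357 * q ^ 2) * (q : ℝ) ^ 8))) := by gcongr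
          _ = 231168 / (q : ℝ) ^ 2 := by
            have : (q : ℝ) ^ (357 * q ^ 2) ≠ 0 := by positivity
            generalize (q : ℝ) ^ (357 * q ^ 2) = X at *
            field_simp
            norm_num
          _ ≤ 1 / 4 := by
            rw [div_le_div_iff₀ (by positivity) (by norm_num)]
            nlinarith
      have hpL2 : (Real.log p / L) ^ 2 ≤ β / 16 := by
        have h1 : Real.log p / L ≤ 1 / (q : ℝ) ^ 3 := by
          rw [div_le_div_iff₀ hL0 (by positivity), one_mul]
          calc Real.log p * (q : ℝ) ^ 3 ≤ (q : ℝ) ^ 12 * (q : ℝ) ^ 3 := by gcongr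
            _ = L := by rw [hL]; ring
        calc (Real.log p / L) ^ 2 ≤ (1 / (q : ℝ) ^ 3) ^ 2 := by gcongr
          _ = 1 / ((q : ℝ) ^ 2 * (q : ℝ) ^ 4) := by field_simp
          _ ≤ 1 / ((q : ℝ) ^ 2 * 64) := by
            gcongr
            nlinarith [sq_nonneg ((q : ℝ) ^ 2 - 8)]
          _ = β / 16 := by rw [hβ]; field_simp; norm_num
      obtain ⟨x, hx0, hx1⟩ := exists_intermediate hp hf hc hT0 hcT hβpos hβ0 hβ1 hL0 hLW hpL2
        (fun r hr => hΓR (Finset.mem_filter.2 ⟨Finset.mem_univ _, hr⟩)) hm0 hD hmp hWm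
      have hLB' : L * (1024 * T ^ 2 + 1) ≤ B := by
        have h1 : 1024 * T ^ 2 + 1 ≤ (q : ℝ) ^ 6 := by
          rw [hT]
          have h2 : (1 : ℝ) ≤ (q : ℝ) ^ 4 := one_le_pow₀ hq1
          have h3 : (10000 : ℝ) ≤ (q : ℝ) ^ 2 := by nlinarith
          calc 1024 * (2 * (q : ℝ) ^ 2) ^ 2 + 1 ≤ 10000 * (q : ℝ) ^ 4 := by
                ring_nf; linarith
            _ ≤ (q : ℝ) ^ 2 * (q : ℝ) ^ 4 := by gcongr
            _ = (q : ℝ) ^ 6 := by ring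
        calc L * (1024 * T ^ 2 + 1) ≤ L * (q : ℝ) ^ 6 := by gcongr
          _ = B := by rw [hL, hB]; ring
      have hpL : 16 * T * Real.log p ≤ L := by
        calc 16 * T * Real.log p ≤ 16 * T * (q : ℝ) ^ 12 := by gcongr
          _ = 32 * (q : ℝ) ^ 14 := by rw [hT]; ring
          _ ≤ q * (q : ℝ) ^ 14 := by gcongr; linarith
          _ = L := by rw [hL]; ring
      obtain ⟨R, hRc, hR⟩ := exists_increment hf hc hT0 hcT hW1 hL0 hpL hB1 hLB' hx0 hx1
      refine ⟨Γ ∪ R, hΓR.trans Finset.subset_union_left, ?_, ?_⟩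
      · have h1 : ((Γ ∪ R).card : ℝ) ≤ Γ.card + R.card := by
          exact_mod_cast Finset.card_union_le Γ R
        have h2 : 512 * T ^ 2 = 2048 * (q : ℝ) ^ 4 := by rw [hT]; ring
        push_cast
        linarith
      · rw [pow_succ' B (i + 1)]
        push_cast
        linarith
  obtain ⟨Γ, _, _, hm⟩ := key (16 * q ^ 2 + 1) le_rfl
  have h1 := hm.trans ((Finset.sum_le_univ_sum_of_nonneg fun _ => norm_nonneg _).trans hcT)
  push_cast at h1
  rw [hT] at h1
  linarith

end Mass

section AvgPow

/-- The average of the powers `u ^ k`, `k < K`. -/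
noncomputable def avgPow (K : ℕ) (u : ℂ) : ℂ := (K : ℂ)⁻¹ * ∑ k ∈ Finset.range K, u ^ k

lemma norm_pow_sub_one_le {u : ℂ} (hu : ‖u‖ = 1) (k : ℕ) : ‖u ^ k - 1‖ ≤ k * ‖u - 1‖ := by
  rw [← mul_geom_sum, norm_mul, mul_comm]
  gcongr
  refine (norm_sum_le _ _).trans ?_
  simp [norm_pow, hu]

lemma norm_avgPow_sub_one_le {u : ℂ} (hu : ‖u‖ = 1) {K : ℕ} (hK : 0 < K) :
    ‖avgPow K u - 1‖ ≤ K * ‖u - 1‖ := by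
  have hK' : (0 : ℝ) < K := by exact_mod_cast hK
  have hKc : (K : ℂ) ≠ 0 := by exact_mod_cast hK.ne'
  have h : avgPow K u - 1 = (K : ℂ)⁻¹ * ∑ k ∈ Finset.range K, (u ^ k - 1) := by
    rw [avgPow, Finset.sum_sub_distrib, mul_sub]
    simp [hKc]
  rw [h, norm_mul, norm_inv, Complex.norm_natCast, inv_mul_le_iff₀ hK']
  calc ‖∑ k ∈ Finset.range K, (u ^ k - 1)‖ ≤ ∑ k ∈ Finset.range K, K * ‖u - 1‖ := by
        refine norm_sum_le_of_le _ fun k hk => (norm_pow_sub_one_le hu k).trans ?_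
        gcongr
        exact (Finset.mem_range.1 hk).le
    _ = K * (K * ‖u - 1‖) := by simp

lemma norm_avgPow_le_one {u : ℂ} (hu : ‖u‖ = 1) (K : ℕ) : ‖avgPow K u‖ ≤ 1 := by
  rw [avgPow, norm_mul, norm_inv, Complex.norm_natCast]
  refine inv_mul_le_one_of_le₀ ((norm_sum_le _ _).trans ?_) (Nat.cast_nonneg _)
  simp [norm_pow, hu]

lemma norm_avgPow_mul_le {u : ℂ} (hu : ‖u‖ = 1) {K : ℕ} (hK : 0 < K) :
    ‖avgPow K u‖ * (K * ‖u - 1‖) ≤ 2 := by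
  have hK' : (K : ℝ) ≠ 0 := by exact_mod_cast hK.ne'
  have h : ‖avgPow K u‖ * (K * ‖u - 1‖) = ‖u ^ K - 1‖ := by
    rw [avgPow, norm_mul, norm_inv, Complex.norm_natCast, ← mul_geom_sum, norm_mul]
    field_simp
  rw [h]
  refine (norm_sub_le _ _).trans ?_
  rw [norm_pow, hu, norm_one]; norm_num

/-- A finite family of reals avoids one of many disjoint scales. -/
lemma exists_gap {ι : Type*} [Fintype ι] (δ : ι → ℝ) {s : ℝ} (hs0 : 0 < s) (hs1 : s < 1) :
    ∃ l ≤ Fintype.card ι, ∀ i, δ i ≤ s ^ l → δ i ≤ s ^ (l + 1) := by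
  by_contra hcon
  push Not at hcon
  choose i hi hi' using fun l : Fin (Fintype.card ι + 1) => hcon l (Nat.lt_succ_iff.1 l.2)
  have hinj : Function.Injective i := by
    have aux : ∀ l l' : Fin (Fintype.card ι + 1), l < l' → i l ≠ i l' := by
      intro l l' hll' heq
      have h1 := hi' l
      have h2 := hi l'
      rw [← heq] at h2
      have h3 : s ^ (l' : ℕ) ≤ s ^ ((l : ℕ) + 1) :=
        pow_le_pow_of_le_one hs0.le hs1.le (by exact_mod_cast hll')
      linarith
    intro l l' heq
    rcases lt_trichotomy l l' with h | h | h
    · exact absurd heq (aux _ _ h)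
    · exact h
    · exact absurd heq.symm (aux _ _ h)
  have := Fintype.card_le_of_injective i hinj
  simp at this

end AvgPow

section Energy
variable {p : ℕ} [NeZero p]

lemma energy_ge {F : ZMod p → ℂ} (hF : ∀ x, ‖F x‖ = 1) {Q : ℝ} (hQ : 0 < Q)
    (hw : WienerLE F Q) :
    (p : ℝ) ^ 3 / Q ^ 2 ≤ ∑ h, ‖∑ j, F (j + h) * star (F j)‖ ^ 2 := by
  obtain ⟨c, hc, hcQ⟩ := hw
  have hp : (0 : ℝ) < p := by exact_mod_cast Nat.pos_of_neZero p
  have h2 : ∑ r, ‖c r‖ ^ 2 = 1 := by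
    have := sum_norm_sq hc
    simp only [hF, one_pow, Finset.sum_const, Finset.card_univ, ZMod.card, nsmul_eq_mul,
      mul_one] at this
    exact (mul_left_cancel₀ hp.ne' (by rw [mul_one]; exact this)).symm
  have h3 : 1 ≤ Q * ∑ r, ‖c r‖ ^ 3 := by
    have := Finset.sum_sq_le_sum_mul_sum_of_sq_le_mul Finset.univ
      (r := fun r => ‖c r‖ ^ 2) (f := fun r => ‖c r‖) (g := fun r => ‖c r‖ ^ 3)
      (fun _ _ => norm_nonneg _) (fun _ _ => by positivity) (fun _ _ => le_of_eq (by ring))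
    rw [h2] at this
    calc (1 : ℝ) = 1 ^ 2 := by norm_num
      _ ≤ _ := this
      _ ≤ _ := by gcongr
  have h4 : (∑ r, ‖c r‖ ^ 3) ^ 2 ≤ ∑ r, ‖c r‖ ^ 4 := by
    have := Finset.sum_sq_le_sum_mul_sum_of_sq_le_mul Finset.univ
      (r := fun r => ‖c r‖ ^ 3) (f := fun r => ‖c r‖ ^ 2) (g := fun r => ‖c r‖ ^ 4)
      (fun _ _ => by positivity) (fun _ _ => by positivity) (fun _ _ => le_of_eq (by ring))
    rwa [h2, one_mul] at this
  have h5 := sum_norm_sq (f := fun h => ∑ j, F (j + h) * star (F j)) (sum_correlation hc)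
  rw [h5]
  have h6 : ∑ r, ‖(p : ℂ) * ((‖c r‖ ^ 2 : ℝ) : ℂ)‖ ^ 2 = (p : ℝ) ^ 2 * ∑ r, ‖c r‖ ^ 4 := by
    rw [Finset.mul_sum]
    refine Finset.sum_congr rfl fun r _ => ?_
    rw [norm_mul, Complex.norm_natCast, Complex.norm_real, Real.norm_of_nonneg (by positivity)]
    ring
  rw [h6, div_le_iff₀ (by positivity)]
  have h7 : 1 ≤ Q ^ 2 * ∑ r, ‖c r‖ ^ 4 := by
    calc (1 : ℝ) ≤ (Q * ∑ r, ‖c r‖ ^ 3) ^ 2 := one_le_pow₀ h3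
      _ = Q ^ 2 * (∑ r, ‖c r‖ ^ 3) ^ 2 := by ring
      _ ≤ _ := by gcongr
  calc (p : ℝ) ^ 3 = p ^ 3 * 1 := by ring
    _ ≤ p ^ 3 * (Q ^ 2 * ∑ r, ‖c r‖ ^ 4) := by gcongr
    _ = _ := by ring

/-- The phase difference `z (j + h) / z j`. -/
noncomputable def phaseDiff (z : ZMod p → ℂ) (h j : ZMod p) : ℂ := z (j + h) * star (z j)

lemma norm_phaseDiff {z : ZMod p → ℂ} (hz : ∀ x, ‖z x‖ = 1) (h j : ZMod p) :
    ‖phaseDiff z h j‖ = 1 := by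
  rw [phaseDiff, norm_mul, norm_star, hz, hz, one_mul]

lemma norm_mul_star_sub_one {a b : ℂ} (hb : ‖b‖ = 1) : ‖a * star b - 1‖ = ‖a - b‖ := by
  have h : b * star b = 1 := by
    rw [← starRingEnd_apply, Complex.mul_conj, Complex.normSq_eq_norm_sq, hb]; norm_num
  rw [← h, ← sub_mul, norm_mul, norm_star, hb, mul_one]

lemma sum_re_avgPow_ge {z : ZMod p → ℂ} (hz : ∀ x, ‖z x‖ = 1) {Q : ℝ} (hQ : 0 < Q) {K : ℕ}
    (hK : 0 < K) (hw : ∀ k < K, WienerLE (fun x => z x ^ k) Q) :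
    (p : ℝ) ^ 3 / Q ^ 2 ≤
      ∑ h, ∑ i, ∑ j, (avgPow K (phaseDiff z h i * star (phaseDiff z h j))).re := by
  have hK' : (0 : ℝ) < K := by exact_mod_cast hK
  have hk : ∀ k < K, (p : ℝ) ^ 3 / Q ^ 2 ≤
      ∑ h, ∑ i, ∑ j, ((phaseDiff z h i * star (phaseDiff z h j)) ^ k).re := by
    intro k hk
    refine (energy_ge (fun x => by rw [norm_pow, hz, one_pow]) hQ (hw k hk)).trans (le_of_eq ?_)
    refine Finset.sum_congr rfl fun h _ => ?_
    have hs : ∑ j, z (j + h) ^ k * star (z j ^ k) = ∑ j, phaseDiff z h j ^ k :=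
      Finset.sum_congr rfl fun j _ => by rw [phaseDiff, mul_pow, star_pow]
    rw [hs]
    have h1 : ((‖∑ j, phaseDiff z h j ^ k‖ ^ 2 : ℝ) : ℂ) =
        ∑ i, ∑ j, (phaseDiff z h i * star (phaseDiff z h j)) ^ k := by
      push_cast
      rw [← Complex.mul_conj', map_sum, Finset.sum_mul_sum]
      refine Finset.sum_congr rfl fun i _ => Finset.sum_congr rfl fun j _ => ?_
      rw [mul_pow, map_pow, starRingEnd_apply]
    have h2 := congrArg Complex.re h1
    rw [Complex.ofReal_re] at h2
    rw [h2]
    simp only [Complex.re_sum]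
  have hsum := Finset.card_nsmul_le_sum (Finset.range K) _ _ fun k hkK => hk k (Finset.mem_range.1 hkK)
  rw [Finset.card_range, nsmul_eq_mul] at hsum
  have hav : ∀ u : ℂ, (avgPow K u).re = (K : ℝ)⁻¹ * ∑ k ∈ Finset.range K, (u ^ k).re := by
    intro u
    rw [avgPow, show (K : ℂ)⁻¹ = (((K : ℝ)⁻¹ : ℝ) : ℂ) by push_cast; rfl, Complex.re_ofReal_mul,
      Complex.re_sum]
  simp_rw [hav, ← Finset.mul_sum]
  rw [le_inv_mul_iff₀ hK']
  refine hsum.trans (le_of_eq ?_)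
  rw [Finset.sum_comm]
  refine Finset.sum_congr rfl fun h _ => ?_
  rw [Finset.sum_comm]
  refine Finset.sum_congr rfl fun i _ => ?_
  rw [Finset.sum_comm]

end Energy

section Phase
variable {p : ℕ} [NeZero p]

open Classical in
/-- The indices `j` at which the phase difference is within `η` of its value at `j₀`. -/
noncomputable def phaseClass (z : ZMod p → ℂ) (η : ℝ) (h j₀ : ZMod p) : Finset (ZMod p) :=
  Finset.univ.filter fun j => ‖phaseDiff z h j - phaseDiff z h j₀‖ ≤ η

lemma mem_phaseClass {z : ZMod p → ℂ} {η : ℝ} {h j₀ j : ZMod p} :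
    j ∈ phaseClass z η h j₀ ↔ ‖phaseDiff z h j - phaseDiff z h j₀‖ ≤ η := by
  simp [phaseClass]

lemma phaseDiff_add (z : ZMod p → ℂ) (hz : ∀ x, ‖z x‖ = 1) (h₁ h₂ j : ZMod p) :
    phaseDiff z (h₁ + h₂) j = phaseDiff z h₁ (j + h₂) * phaseDiff z h₂ j := by
  have h : star (z (j + h₂)) * z (j + h₂) = 1 := by
    rw [← starRingEnd_apply, Complex.conj_mul', hz]; norm_num
  simp only [phaseDiff]
  rw [show j + (h₁ + h₂) = j + h₂ + h₁ by ring]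
  calc z (j + h₂ + h₁) * star (z j) =
      z (j + h₂ + h₁) * (star (z (j + h₂)) * z (j + h₂)) * star (z j) := by rw [h, mul_one]
    _ = _ := by ring

/-- Most phase differences lie in large classes for some nonzero shift. -/
lemma exists_large_phaseClass {z : ZMod p → ℂ} (hz : ∀ x, ‖z x‖ = 1) {Q : ℝ} (hQ : 1 ≤ Q)
    {K : ℕ} (hw : ∀ k < K, WienerLE (fun x => z x ^ k) Q) {η : ℝ}
    (hgap : ∀ h i j : ZMod p, η < ‖phaseDiff z h i - phaseDiff z h j‖ →
      4 * Q ^ 2 ≤ K * ‖phaseDiff z h i - phaseDiff z h j‖)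
    (hK : 0 < K) (hpQ : 4 * Q ^ 2 < p) :
    ∃ h ≠ 0, ∃ j₀, 1 / (4 * Q ^ 2) * (p : ℝ) ≤ (phaseClass z η h j₀).card := by
  classical
  have hp : (0 : ℝ) < p := by exact_mod_cast Nat.pos_of_neZero p
  have hK' : (0 : ℝ) < K := by exact_mod_cast hK
  by_contra hcon
  push Not at hcon
  have hre : ∀ h i j, (avgPow K (phaseDiff z h i * star (phaseDiff z h j))).re ≤
      (if i ∈ phaseClass z η h j then 1 else 0) + 1 / (2 * Q ^ 2) := by
    intro h i j
    have hu : ‖phaseDiff z h i * star (phaseDiff z h j)‖ = 1 := by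
      rw [norm_mul, norm_star, norm_phaseDiff hz, norm_phaseDiff hz, one_mul]
    refine (Complex.re_le_norm _).trans ?_
    split_ifs with hij
    · have := norm_avgPow_le_one hu K
      have h2 : 0 ≤ 1 / (2 * Q ^ 2) := by positivity
      linarith
    · rw [zero_add, le_div_iff₀ (by positivity)]
      rw [mem_phaseClass, not_le] at hij
      have h1 := norm_avgPow_mul_le hu hK
      rw [norm_mul_star_sub_one (norm_phaseDiff hz h j)] at h1
      have h2 := mul_le_mul_of_nonneg_left (hgap h i j hij)
        (norm_nonneg (avgPow K (phaseDiff z h i * star (phaseDiff z h j))))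
      linarith
  have h1 := sum_re_avgPow_ge hz (by linarith : (0 : ℝ) < Q) hK hw
  have h2 : ∑ h, ∑ i, ∑ j, (avgPow K (phaseDiff z h i * star (phaseDiff z h j))).re ≤
      ∑ h, ∑ j, (((phaseClass z η h j).card : ℝ) + p * (1 / (2 * Q ^ 2))) := by
    refine Finset.sum_le_sum fun h _ => ?_
    rw [Finset.sum_comm]
    refine Finset.sum_le_sum fun j _ => ?_
    refine (Finset.sum_le_sum fun i _ => hre h i j).trans (le_of_eq ?_)
    rw [Finset.sum_add_distrib]
    simp [ZMod.card]
  have h3 : ∀ h j, ((phaseClass z η h j).card : ℝ) ≤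
      (if h = 0 then (p : ℝ) else 0) + 1 / (4 * Q ^ 2) * p := by
    intro h j
    have h0 : 0 ≤ 1 / (4 * Q ^ 2) * (p : ℝ) := by positivity
    split_ifs with hh
    · have : (phaseClass z η h j).card ≤ p := by
        simpa [ZMod.card] using Finset.card_le_univ (phaseClass z η h j)
      have : ((phaseClass z η h j).card : ℝ) ≤ p := by exact_mod_cast this
      linarith
    · rw [zero_add]
      exact (hcon h hh j).le
  have h4 : ∑ h, ∑ j, (((phaseClass z η h j).card : ℝ) + p * (1 / (2 * Q ^ 2))) ≤
      p * p + p * (p * (1 / (4 * Q ^ 2) * p)) + p * (p * (p * (1 / (2 * Q ^ 2)))) := by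
    refine (Finset.sum_le_sum fun h _ => Finset.sum_le_sum fun j _ =>
      add_le_add_left (h3 h j) _).trans (le_of_eq ?_)
    simp only [Finset.sum_add_distrib, Finset.sum_const, Finset.card_univ, ZMod.card, nsmul_eq_mul,
      Finset.sum_ite_eq', Finset.mem_univ, if_true, mul_ite, mul_zero]
  have h5 := h1.trans (h2.trans h4)
  have hQ0 : 0 < Q := by linarith
  have h6 : (p : ℝ) * p + p * (p * (1 / (4 * Q ^ 2) * p)) + p * (p * (p * (1 / (2 * Q ^ 2)))) =
      p ^ 2 * (1 - p / (4 * Q ^ 2)) + p ^ 3 / Q ^ 2 := by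
    field_simp; ring
  rw [h6] at h5
  have h7 : 1 < (p : ℝ) / (4 * Q ^ 2) := by rwa [one_lt_div (by positivity)]
  have h8 : (0 : ℝ) < p ^ 2 := by positivity
  nlinarith

/-- The indicator function of a class isolated by a gap has controlled Wiener norm. -/
lemma wienerLE_phaseClass {z : ZMod p → ℂ} (hz : ∀ x, ‖z x‖ = 1) {Q : ℝ} (hQ : 1 ≤ Q)
    {K : ℕ} (hw : ∀ k < K, WienerLE (fun x => z x ^ k) Q) {η : ℝ}
    (hgap : ∀ h i j : ZMod p, η < ‖phaseDiff z h i - phaseDiff z h j‖ →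
      2 * p ≤ K * ‖phaseDiff z h i - phaseDiff z h j‖)
    (hK : 0 < K) (hη : p * (K * η) ≤ 1) (h j₀ : ZMod p) :
    WienerLE (fun j => ((if j ∈ phaseClass z η h j₀ then (1 : ℝ) else 0 : ℝ) : ℂ))
      (2 * Q ^ 2) := by
  have hp : (0 : ℝ) < p := by exact_mod_cast Nat.pos_of_neZero p
  have hK' : (0 : ℝ) < K := by exact_mod_cast hK
  set w := star (phaseDiff z h j₀) with hwdef
  have hwn : ‖w‖ = 1 := by rw [hwdef, norm_star, norm_phaseDiff hz]
  have hmain : WienerLE (fun j => avgPow K (phaseDiff z h j * w)) (Q ^ 2) := by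
    have h1 : WienerLE (fun j => ∑ k ∈ Finset.range K, w ^ k *
        (z (j + h) ^ k * star (z j ^ k))) (∑ k ∈ Finset.range K, ‖w ^ k‖ * (Q * Q)) :=
      WienerLE.sum _ fun k hk => by
        have h2 := hw k (Finset.mem_range.1 hk)
        exact ((h2.shift h).mul h2.star).const_mul _
    have h3 := h1.const_mul (K : ℂ)⁻¹
    simp only [norm_pow, hwn, one_pow, one_mul, Finset.sum_const, Finset.card_range,
      nsmul_eq_mul, norm_inv, Complex.norm_natCast] at h3
    rw [inv_mul_cancel_left₀ hK'.ne', ← sq] at h3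
    convert h3 using 2 with j
    rw [avgPow]
    congr 1
    refine Finset.sum_congr rfl fun k _ => ?_
    rw [phaseDiff, mul_pow, mul_pow, star_pow]
    ring
  have herr : WienerLE (fun j => ((if j ∈ phaseClass z η h j₀ then (1 : ℝ) else 0 : ℝ) : ℂ) -
      avgPow K (phaseDiff z h j * w)) (p * (1 / p)) := by
    refine wienerLE_of_norm_le fun j => ?_
    have hu : ‖phaseDiff z h j * w‖ = 1 := by rw [norm_mul, hwn, norm_phaseDiff hz, one_mul]
    split_ifs with hj
    · rw [mem_phaseClass] at hj
      rw [Complex.ofReal_one, norm_sub_rev]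
      refine (norm_avgPow_sub_one_le hu hK).trans ?_
      rw [hwdef, norm_mul_star_sub_one (norm_phaseDiff hz h j₀), le_div_iff₀ hp]
      calc K * ‖phaseDiff z h j - phaseDiff z h j₀‖ * p ≤ K * η * p := by gcongr
        _ ≤ 1 := by linarith
    · rw [mem_phaseClass, not_le] at hj
      rw [Complex.ofReal_zero, zero_sub, norm_neg, le_div_iff₀ hp]
      have h1 := norm_avgPow_mul_le hu hK
      rw [hwdef, norm_mul_star_sub_one (norm_phaseDiff hz h j₀), ← hwdef] at h1
      have h2 := mul_le_mul_of_nonneg_left (hgap h j j₀ hj)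
        (norm_nonneg (avgPow K (phaseDiff z h j * w)))
      linarith
  have hQ2 : 1 ≤ Q ^ 2 := one_le_pow₀ hQ
  refine WienerLE.mono (T := 2 * Q ^ 2) (S := p * (1 / p) + Q ^ 2) ?_ ?_
  · simpa using herr.add hmain
  · rw [mul_one_div_cancel hp.ne']; linarith

/-- If all small powers of a unimodular function on `ZMod p` have small Wiener norm, then every
phase difference is nearly constant. -/
theorem exists_phaseClass_card_gt (hp : p.Prime) {q : ℕ} (hq : 100000 ≤ q)
    (hp1 : 2 ^ q ^ 11 ≤ p) (hp2 : p ≤ 2 ^ (q ^ 11 + 1)) {z : ZMod p → ℂ} (hz : ∀ x, ‖z x‖ = 1)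
    (hw : ∀ k < (4 * p) ^ (3 * p ^ 3 + 2), WienerLE (fun x => z x ^ k) q) (h : ZMod p) :
    ∃ j₀, (p : ℝ) - 1 / (4 * (q : ℝ) ^ 2) * p < (phaseClass z (1 / (4 * p)) h j₀).card := by
  classical
  have := Fact.mk hp
  have hp0 : (0 : ℝ) < p := by exact_mod_cast hp.pos
  have hqR : (100000 : ℝ) ≤ q := by exact_mod_cast hq
  have hq1 : (1 : ℝ) ≤ q := by linarith
  have hpq : 4 * (q : ℝ) ^ 2 < p := by
    have h1 : 4 * q ^ 2 < 2 ^ q ^ 11 := by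
      calc 4 * q ^ 2 ≤ q * q ^ 2 := by gcongr; omega
        _ = q ^ 3 := by ring
        _ ≤ q ^ 11 := Nat.pow_le_pow_right (by omega) (by norm_num)
        _ < 2 ^ q ^ 11 := Nat.lt_two_pow_self
    exact_mod_cast h1.trans_le hp1
  have hp1R : (1 : ℝ) ≤ p := by nlinarith
  set E : ℝ := 4 * p with hE
  have hE1 : 4 ≤ E := by linarith
  have hE0 : 0 < E := by linarith
  have hs1 : (E ^ 3)⁻¹ < 1 := inv_lt_one_of_one_lt₀ (one_lt_pow₀ (by linarith) (by norm_num))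
  obtain ⟨l, hl, hgap⟩ := exists_gap
    (fun t : ZMod p × ZMod p × ZMod p => ‖phaseDiff z t.1 t.2.1 - phaseDiff z t.1 t.2.2‖)
    (s := (E ^ 3)⁻¹) (by positivity) hs1
  have hl' : l ≤ p ^ 3 := by
    refine hl.trans (le_of_eq ?_)
    simp only [Fintype.card_prod, ZMod.card]; ring
  set η : ℝ := (E ^ 3)⁻¹ ^ (l + 1) with hη
  set K : ℕ := (4 * p) ^ (3 * l + 2) with hK
  have hKR : (K : ℝ) = E ^ (3 * l + 2) := by rw [hK, hE]; push_cast; rfl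
  have hKpos : 0 < K := Nat.pow_pos (by have := hp.pos; omega)
  have hη0 : 0 < η := by positivity
  have hηE : E ^ 3 * η = (E ^ 3)⁻¹ ^ l := by
    rw [hη, pow_succ' (E ^ 3)⁻¹, mul_inv_cancel_left₀ (by positivity : E ^ 3 ≠ 0)]
  have hKη : K * η = 1 / E := by
    rw [hKR, hη, inv_pow, ← pow_mul, show 3 * (l + 1) = 3 * l + 2 + 1 by ring, pow_succ E (3 * l + 2)]
    field_simp
  have h4η : 4 * η ≤ (E ^ 3)⁻¹ ^ l := by
    rw [← hηE]
    gcongr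
    nlinarith [sq_nonneg E]
  have hfar : ∀ h i j : ZMod p, η < ‖phaseDiff z h i - phaseDiff z h j‖ →
      E ^ 2 ≤ K * ‖phaseDiff z h i - phaseDiff z h j‖ := by
    intro h i j hij
    have h1 : (E ^ 3)⁻¹ ^ l < ‖phaseDiff z h i - phaseDiff z h j‖ := by
      by_contra hle
      push Not at hle
      exact absurd (hgap (h, i, j) hle) (not_le.2 hij)
    have h2 : K * (E ^ 3 * η) = E ^ 2 := by
      calc K * (E ^ 3 * η) = E ^ 3 * (K * η) := by ring
        _ = E ^ 2 := by rw [hKη]; field_simp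
    rw [← h2, hηE]
    gcongr
  have hwK : ∀ k < K, WienerLE (fun x => z x ^ k) q := fun k hk => by
    refine hw k (hk.trans_le ?_)
    exact Nat.pow_le_pow_right (by have := hp.pos; omega) (by omega)
  have hdich : ∀ h j, 1 / (4 * (q : ℝ) ^ 2) * p ≤ (phaseClass z η h j).card →
      (p : ℝ) - 1 / (4 * (q : ℝ) ^ 2) * p < (phaseClass z η h j).card := by
    intro h j hj
    by_contra hcon
    push Not at hcon
    have hww := wienerLE_phaseClass hz hq1 hwK (η := η)
      (fun h i j hij => le_trans (by rw [hE]; nlinarith) (hfar h i j hij)) hKpos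
      (by rw [hKη, hE]; field_simp; norm_num) h j
    have hsum : ∑ x, (if x ∈ phaseClass z η h j then (1 : ℝ) else 0) =
        (phaseClass z η h j).card := by simp
    refine not_wienerLE_indicator hp hq hp1 hp2 (fun x => ?_) hww ?_ ?_
    · split_ifs <;> simp
    · rw [hsum]; exact hj
    · rw [Finset.sum_sub_distrib, hsum]
      simp only [Finset.sum_const, Finset.card_univ, ZMod.card, nsmul_eq_mul, mul_one]
      linarith
  set α : ℝ := 1 / (4 * (q : ℝ) ^ 2) * p with hα
  have hα3 : 3 * α < p := by
    have h1 : 1 / (4 * (q : ℝ) ^ 2) < 1 / 3 := by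
      rw [div_lt_div_iff₀ (by positivity) (by norm_num)]; nlinarith
    rw [hα]; nlinarith
  have hα0 : 0 < α := by positivity
  have hadd : ∀ h₁ h₂ : ZMod p, (∃ j, (p : ℝ) - α < (phaseClass z η h₁ j).card) →
      (∃ j, (p : ℝ) - α < (phaseClass z η h₂ j).card) →
      ∃ j, (p : ℝ) - α < (phaseClass z η (h₁ + h₂) j).card := by
    rintro h₁ h₂ ⟨j₁, hj₁⟩ ⟨j₂, hj₂⟩
    set A := (phaseClass z η h₁ j₁).map (Equiv.subRight h₂).toEmbedding with hA
    set S := A ∩ phaseClass z η h₂ j₂ with hS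
    have hScard : (p : ℝ) - 2 * α < S.card := by
      have h1 := Finset.card_union_add_card_inter A (phaseClass z η h₂ j₂)
      have h2 : (A ∪ phaseClass z η h₂ j₂).card ≤ p := by
        simpa [ZMod.card] using Finset.card_le_univ (A ∪ phaseClass z η h₂ j₂)
      rw [hA, Finset.card_map, ← hA, ← hS] at h1
      have h1R : ((A ∪ phaseClass z η h₂ j₂).card : ℝ) + S.card =
        (phaseClass z η h₁ j₁).card + (phaseClass z η h₂ j₂).card := by exact_mod_cast h1
      have h2R : ((A ∪ phaseClass z η h₂ j₂).card : ℝ) ≤ p := by exact_mod_cast h2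
      linarith
    have hne : S.Nonempty := by
      rw [← Finset.card_pos]
      have : (0 : ℝ) < S.card := by linarith
      exact_mod_cast this
    obtain ⟨j, hj⟩ := hne
    have hSmem : ∀ i ∈ S, ‖phaseDiff z h₁ (i + h₂) - phaseDiff z h₁ j₁‖ ≤ η ∧
        ‖phaseDiff z h₂ i - phaseDiff z h₂ j₂‖ ≤ η := by
      intro i hi
      obtain ⟨hi1, hi2⟩ := Finset.mem_inter.1 hi
      refine ⟨?_, mem_phaseClass.1 hi2⟩
      obtain ⟨x, hx, rfl⟩ := Finset.mem_map.1 hi1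
      have := mem_phaseClass.1 hx
      simpa using this
    refine ⟨j, hdich _ _ ?_⟩
    have hsub : S ⊆ phaseClass z η (h₁ + h₂) j := by
      intro i hi
      rw [mem_phaseClass]
      refine hgap (h₁ + h₂, i, j) (le_trans ?_ h4η)
      simp only
      obtain ⟨a1, a2⟩ := hSmem i hi
      obtain ⟨b1, b2⟩ := hSmem j hj
      rw [phaseDiff_add z hz, phaseDiff_add z hz]
      have c1 : ‖phaseDiff z h₁ (i + h₂) - phaseDiff z h₁ (j + h₂)‖ ≤ 2 * η := by
        have := norm_sub_le_norm_sub_add_norm_sub (phaseDiff z h₁ (i + h₂)) (phaseDiff z h₁ j₁)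
          (phaseDiff z h₁ (j + h₂))
        rw [norm_sub_rev (phaseDiff z h₁ j₁)] at this
        linarith
      have c2 : ‖phaseDiff z h₂ i - phaseDiff z h₂ j‖ ≤ 2 * η := by
        have := norm_sub_le_norm_sub_add_norm_sub (phaseDiff z h₂ i) (phaseDiff z h₂ j₂)
          (phaseDiff z h₂ j)
        rw [norm_sub_rev (phaseDiff z h₂ j₂)] at this
        linarith
      calc ‖phaseDiff z h₁ (i + h₂) * phaseDiff z h₂ i -
            phaseDiff z h₁ (j + h₂) * phaseDiff z h₂ j‖
          = ‖(phaseDiff z h₁ (i + h₂) - phaseDiff z h₁ (j + h₂)) * phaseDiff z h₂ i +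
            phaseDiff z h₁ (j + h₂) * (phaseDiff z h₂ i - phaseDiff z h₂ j)‖ := by
            congr 1; ring
        _ ≤ 2 * η * 1 + 1 * (2 * η) := by
            refine (norm_add_le _ _).trans ?_
            rw [norm_mul, norm_mul, norm_phaseDiff hz, norm_phaseDiff hz]
            gcongr
        _ = 4 * η := by ring
    have : (S.card : ℝ) ≤ (phaseClass z η (h₁ + h₂) j).card := by
      exact_mod_cast Finset.card_le_card hsub
    linarith
  obtain ⟨h₀, hh₀, j₀, hj₀⟩ := exists_large_phaseClass hz hq1 hwK (η := η)
    (fun h i j hij => le_trans (by rw [hE]; nlinarith) (hfar h i j hij)) hKpos hpq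
  have hall : ∀ n : ℕ, ∃ j, (p : ℝ) - α < (phaseClass z η (n * h₀) j).card := by
    intro n
    induction n with
    | zero =>
      refine ⟨0, ?_⟩
      have : phaseClass z η (((0 : ℕ) : ZMod p) * h₀) 0 = Finset.univ := by
        ext j
        simp only [mem_phaseClass, Finset.mem_univ, iff_true]
        have h1 : ∀ i, phaseDiff z (((0 : ℕ) : ZMod p) * h₀) i = 1 := by
          intro i
          rw [Nat.cast_zero, zero_mul, phaseDiff, add_zero, ← starRingEnd_apply,
            Complex.mul_conj', hz]
          norm_num
        rw [h1, h1, sub_self, norm_zero]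
        exact hη0.le
      rw [this, Finset.card_univ, ZMod.card]
      linarith
    | succ n ih =>
      have := hadd _ _ ih ⟨j₀, hdich _ _ hj₀⟩
      rwa [show ((n + 1 : ℕ) : ZMod p) * h₀ = n * h₀ + h₀ by push_cast; ring]
  obtain ⟨j, hj⟩ := hall (h / h₀).val
  rw [ZMod.natCast_zmod_val, div_mul_cancel₀ _ hh₀] at hj
  refine ⟨j, hj.trans_le ?_⟩
  have hηle : η ≤ 1 / (4 * p) := by
    rw [← hE, ← hKη]
    have : (1 : ℝ) ≤ K := by exact_mod_cast hKpos
    nlinarith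
  have : phaseClass z η h j ⊆ phaseClass z (1 / (4 * p)) h j := fun i hi =>
    mem_phaseClass.2 ((mem_phaseClass.1 hi).trans hηle)
  exact Nat.cast_le.2 (Finset.card_le_card this)

end Phase

section Fourier
variable {d : ℕ}

lemma periodic_int {f : (Fin d → ℝ) → ℂ}
    (hf : ∀ t j, f (t + (2 * π) • (Pi.single j 1 : Fin d → ℝ)) = f t) (t : Fin d → ℝ)
    (n : Fin d → ℤ) : f (fun i => t i + 2 * π * n i) = f t := by
  have h : ∀ s : Finset (Fin d), Function.Periodic f
      (∑ j ∈ s, n j • ((2 * π) • (Pi.single j 1 : Fin d → ℝ))) := by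
    intro s
    induction s using Finset.induction_on with
    | empty => intro t; simp
    | insert a s ha ih =>
      rw [Finset.sum_insert ha]
      exact Function.Periodic.add_period
        (Function.Periodic.zsmul (fun t => hf t a) (n a)) ih
  rw [← h Finset.univ t]
  congr 1
  ext i
  rw [Pi.add_apply, Finset.sum_apply, Finset.sum_eq_single i]
  · simp; ring
  · intro j _ hj; simp [Pi.single_eq_of_ne' hj]
  · simp

lemma mFourier_coe (n : Fin d → ℤ) (s : Fin d → ℝ) :
    UnitAddTorus.mFourier n (fun i => (s i : UnitAddCircle)) =
      Complex.exp (I * ∑ j, (n j : ℂ) * ((2 * π * s j : ℝ) : ℂ)) := by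
  simp only [UnitAddTorus.mFourier, ContinuousMap.coe_mk, fourier_coe_apply]
  rw [← Complex.exp_sum, Finset.mul_sum]
  congr 1
  refine Finset.sum_congr rfl fun j _ => ?_
  push_cast
  ring

lemma exists_torus_lift {f : (Fin d → ℝ) → ℂ} (hcont : Continuous f)
    (hf : ∀ t j, f (t + (2 * π) • (Pi.single j 1 : Fin d → ℝ)) = f t) :
    ∃ g : C(UnitAddTorus (Fin d), ℂ), ∀ s : Fin d → ℝ,
      g (fun i => (s i : UnitAddCircle)) = f ((2 * π) • s) := by
  have hq : IsOpenQuotientMap (Pi.map fun (_ : Fin d) (x : ℝ) => (x : UnitAddCircle)) :=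
    IsOpenQuotientMap.piMap fun _ => QuotientAddGroup.isOpenQuotientMap_mk
  let g : UnitAddTorus (Fin d) → ℂ := fun x => f ((2 * π) • fun i => (x i).out)
  have hg : ∀ s : Fin d → ℝ, g (fun i => (s i : UnitAddCircle)) = f ((2 * π) • s) := by
    intro s
    have h1 : ∀ i, ∃ n : ℤ, s i + n = (Quotient.out (s i : UnitAddCircle) : ℝ) := by
      intro i
      have : ((Quotient.out (s i : UnitAddCircle) : ℝ) : UnitAddCircle) = (s i : UnitAddCircle) :=
        Quotient.out_eq _
      rw [eq_comm, ← sub_eq_zero, ← AddCircle.coe_sub, AddCircle.coe_eq_zero_iff] at this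
      obtain ⟨n, hn⟩ := this
      refine ⟨-n, ?_⟩
      rw [zsmul_eq_mul, mul_one] at hn
      push_cast
      linarith
    choose n hn using h1
    rw [← periodic_int hf ((2 * π) • s) n]
    simp only [g]
    congr 1
    ext i
    simp only [Pi.smul_apply, smul_eq_mul, ← hn]
    ring
  refine ⟨⟨g, hq.isQuotientMap.continuous_iff.2 ?_⟩, hg⟩
  have : g ∘ (Pi.map fun (_ : Fin d) (x : ℝ) => (x : UnitAddCircle)) = fun s => f ((2 * π) • s) :=
    funext hg
  rw [this]
  exact hcont.comp (continuous_const_smul _)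

open scoped Pointwise in
lemma mFourierCoeff_lift {f : (Fin d → ℝ) → ℂ} {g : C(UnitAddTorus (Fin d), ℂ)}
    (hg : ∀ s : Fin d → ℝ, g (fun i => (s i : UnitAddCircle)) = f ((2 * π) • s))
    (k : Fin d → ℤ) : UnitAddTorus.mFourierCoeff g k = fourierCoeffTd d f k := by
  rw [UnitAddTorus.mFourierCoeff_eq_integral _ _ 0, fourierCoeffTd]
  set G : (Fin d → ℝ) → ℂ :=
    fun t => f t * Complex.exp (-Complex.I * ∑ j : Fin d, (k j : ℂ) * (t j : ℂ)) with hG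
  have h1 : ∀ s : Fin d → ℝ, UnitAddTorus.mFourier (-k) (fun i => (s i : UnitAddCircle)) •
      g (fun i => (s i : UnitAddCircle)) = G ((2 * π) • s) := by
    intro s
    rw [mFourier_coe, hg, hG, smul_eq_mul, mul_comm]
    simp only [Pi.neg_apply, Pi.smul_apply, smul_eq_mul, Int.cast_neg, neg_mul,
      Finset.sum_neg_distrib, mul_neg]
  simp_rw [h1]
  have hset : {x : Fin d → ℝ | ∀ i, x i ∈ Set.Ioc ((0 : Fin d → ℝ) i) ((0 : Fin d → ℝ) i + 1)} =
      Set.univ.pi fun i => Set.Ioc ((0 : Fin d → ℝ) i) ((1 : Fin d → ℝ) i) := by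
    ext x; simp
  have hae : (Set.univ.pi fun i => Set.Ioc ((0 : Fin d → ℝ) i) ((1 : Fin d → ℝ) i))
      =ᵐ[volume] Set.Icc (0 : Fin d → ℝ) 1 := Measure.univ_pi_Ioc_ae_eq_Icc
  rw [hset, setIntegral_congr_set hae, ← Set.pi_univ_Icc, Measure.setIntegral_comp_smul_of_pos _ _ _ Real.two_pi_pos,
    Set.smul_set_univ_pi]
  have hset2 : (Set.univ.pi ((2 * π) • fun i : Fin d => Set.Icc ((0 : Fin d → ℝ) i)
      ((1 : Fin d → ℝ) i))) = Set.univ.pi fun _ : Fin d => Set.Icc (0 : ℝ) (2 * π) := by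
    congr 1
    ext1 i
    rw [Pi.smul_apply, LinearOrderedField.smul_Icc Real.two_pi_pos]
    simp
  rw [hset2, Module.finrank_fin_fun, Complex.real_smul]
  congr 1
  push_cast
  rw [one_div, inv_pow]

/-- Pointwise Fourier inversion for absolutely convergent Fourier series. -/
lemma hasSum_fourierCoeffTd {f : (Fin d → ℝ) → ℂ} (hcont : Continuous f)
    (hf : ∀ t j, f (t + (2 * π) • (Pi.single j 1 : Fin d → ℝ)) = f t)
    (hs : Summable fun k => ‖fourierCoeffTd d f k‖) (t : Fin d → ℝ) :
    HasSum (fun k : Fin d → ℤ => fourierCoeffTd d f k *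
      Complex.exp (I * ∑ j, (k j : ℂ) * (t j : ℂ))) (f t) := by
  obtain ⟨g, hg⟩ := exists_torus_lift hcont hf
  have hs' : Summable (UnitAddTorus.mFourierCoeff g) := by
    have : UnitAddTorus.mFourierCoeff g = fourierCoeffTd d f := funext (mFourierCoeff_lift hg)
    rw [this]
    exact hs.of_norm
  have h := UnitAddTorus.hasSum_mFourier_series_apply_of_summable hs'
    (fun i => (((2 * π)⁻¹ * t i : ℝ) : UnitAddCircle))
  have hpi : (2 * π) ≠ 0 := Real.two_pi_pos.ne'
  have ht : (2 * π) • (fun i => (2 * π)⁻¹ * t i) = t := by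
    ext i; simp only [Pi.smul_apply, smul_eq_mul]; rw [mul_inv_cancel_left₀ hpi]
  rw [hg fun i => (2 * π)⁻¹ * t i, ht] at h
  convert h using 2 with k
  rw [mFourierCoeff_lift hg, mFourier_coe k fun i => (2 * π)⁻¹ * t i, smul_eq_mul]
  simp only [mul_inv_cancel_left₀ hpi]

lemma wienerLE_of_hasSum {p : ℕ} [NeZero p] {ι : Type*} {b : ι → ℂ} (hb : Summable fun k => ‖b k‖)
    (ρ : ι → ZMod p) {f : ZMod p → ℂ} (hf : ∀ x, HasSum (fun k => b k * chi (ρ k) x) (f x)) :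
    WienerLE f (∑' k, ‖b k‖) := by
  classical
  have hsum : ∀ r, Summable fun k => ‖if ρ k = r then b k else 0‖ := fun r =>
    Summable.of_nonneg_of_le (fun _ => norm_nonneg _)
      (fun k => by split_ifs <;> simp) hb
  refine ⟨fun r => ∑' k, if ρ k = r then b k else 0, fun x => ?_, ?_⟩
  · rw [← (hf x).tsum_eq]
    simp_rw [← tsum_mul_right]
    rw [← Summable.tsum_finsetSum fun r _ => ((hsum r).of_norm).mul_right _]
    refine tsum_congr fun k => ?_
    simp [ite_mul]
  · refine (Finset.sum_le_sum fun r _ => norm_tsum_le_tsum_norm (hsum r)).trans (le_of_eq ?_)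
    rw [← Summable.tsum_finsetSum fun r _ => hsum r]
    refine tsum_congr fun k => ?_
    simp [apply_ite norm]

/-- Sampling along an arithmetic progression in a coordinate direction does not increase the
Wiener norm. -/
lemma wienerLE_sample {f : (Fin d → ℝ) → ℂ} (hcont : Continuous f)
    (hf : ∀ t j, f (t + (2 * π) • (Pi.single j 1 : Fin d → ℝ)) = f t)
    (hs : Summable fun k => ‖fourierCoeffTd d f k‖) (t : Fin d → ℝ) (j : Fin d)
    (p : ℕ) [NeZero p] :
    WienerLE (fun x : ZMod p => f (t + (2 * π * x.val / p) • (Pi.single j 1 : Fin d → ℝ)))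
      (normATd d f) := by
  set e : (Fin d → ℤ) → ℂ := fun k => Complex.exp (I * ∑ i, (k i : ℂ) * (t i : ℂ)) with he
  have hen : ∀ k, ‖e k‖ = 1 := by
    intro k
    simp only [he]
    rw [mul_comm I, show (∑ i, (k i : ℂ) * (t i : ℂ)) = ((∑ i, (k i : ℝ) * t i : ℝ) : ℂ) by push_cast; rfl,
      Complex.norm_exp_ofReal_mul_I]
  have hb : ∀ k, ‖fourierCoeffTd d f k * e k‖ = ‖fourierCoeffTd d f k‖ := fun k => by
    rw [norm_mul, hen, mul_one]
  rw [normATd, ← tsum_congr hb]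
  refine wienerLE_of_hasSum (by simp_rw [hb]; exact hs) (fun k => (k j : ZMod p)) fun x => ?_
  convert hasSum_fourierCoeffTd hcont hf hs
    (t + (2 * π * x.val / p) • (Pi.single j 1 : Fin d → ℝ)) using 2 with k
  rw [mul_assoc]
  congr 1
  have h1 : ∑ i, (k i : ℂ) *
      (((t + (2 * π * x.val / p) • (Pi.single j 1 : Fin d → ℝ)) i : ℝ) : ℂ) =
      ∑ i, (k i : ℂ) * (t i : ℂ) + (k j : ℂ) * ((2 * π * x.val / p : ℝ) : ℂ) := by
    simp only [Pi.add_apply, Pi.smul_apply, Pi.single_apply, smul_eq_mul, mul_ite, mul_one,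
      mul_zero, Complex.ofReal_add, mul_add, Finset.sum_add_distrib]
    congr 1
    rw [Finset.sum_eq_single j]
    · simp
    · intro i _ hij; simp [hij]
    · simp
  rw [h1, mul_add, Complex.exp_add, he]
  congr 1
  rw [chi, show (k j : ZMod p) * x = ((k j * (x.val : ℤ) : ℤ) : ZMod p) by
    push_cast; rw [ZMod.natCast_zmod_val], ZMod.stdAddChar_coe]
  congr 1
  push_cast
  ring

end Fourier

section Growth

lemma eventually_le_log_log_rpow {N : ℤ → ℝ} (hN : ∀ n, 0 ≤ N n)
    (h : Tendsto (fun n : ℤ => N n * (Real.log (Real.log (Real.log |(n : ℝ)|)) /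
      Real.log (Real.log |(n : ℝ)|)) ^ ((1 : ℝ) / 12)) cofinite (nhds 0)) :
    ∀ᶠ n : ℕ in atTop, N n ≤ Real.log (Real.log n) ^ ((1 : ℝ) / 12) := by
  have hcast : Tendsto (fun n : ℕ => (n : ℤ)) atTop cofinite := by
    rw [← Nat.cofinite_eq_atTop]
    exact Nat.cast_injective.tendsto_cofinite
  have h1 : ∀ᶠ n : ℕ in atTop, N n * (Real.log (Real.log (Real.log |((n : ℤ) : ℝ)|)) /
      Real.log (Real.log |((n : ℤ) : ℝ)|)) ^ ((1 : ℝ) / 12) < 1 :=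
    (h.comp hcast).eventually_lt_const zero_lt_one
  have hlog : Tendsto (fun n : ℕ => Real.log (Real.log n)) atTop atTop :=
    Real.tendsto_log_atTop.comp (Real.tendsto_log_atTop.comp tendsto_natCast_atTop_atTop)
  filter_upwards [h1, hlog.eventually_gt_atTop 0,
    (Real.tendsto_log_atTop.comp hlog).eventually_ge_atTop 1] with n hn hpos hge
  simp only [Int.cast_natCast, Nat.abs_cast] at hn
  simp only [Function.comp_apply] at hge
  set L := Real.log (Real.log n) with hL
  have h2 : (1 / L) ^ ((1 : ℝ) / 12) ≤ (Real.log L / L) ^ ((1 : ℝ) / 12) := by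
    apply Real.rpow_le_rpow (by positivity) _ (by norm_num)
    gcongr
  have h3 := mul_le_mul_of_nonneg_left h2 (hN n)
  rw [Real.div_rpow zero_le_one hpos.le, Real.one_rpow, mul_one_div] at h3
  have h4 : 0 < L ^ ((1 : ℝ) / 12) := Real.rpow_pos_of_pos hpos _
  have h5 : N n / L ^ ((1 : ℝ) / 12) ≤ 1 := by linarith
  rwa [div_le_one h4] at h5

lemma log_log_mul_le {p q k n : ℕ} (hq : 100 ≤ q) (hqp : q ≤ p) (hp : p ≤ 2 ^ (q ^ 11 + 1))
    (hk : k < (4 * p) ^ (3 * p ^ 3 + 2)) (hn : n ≤ q) (hkn : 2 ≤ k * n) :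
    Real.log (Real.log ((k * n : ℕ) : ℝ)) ≤ (q : ℝ) ^ 12 := by
  have hp0 : (100 : ℝ) ≤ p := by exact_mod_cast hq.trans hqp
  have hq0 : (100 : ℝ) ≤ q := by exact_mod_cast hq
  have h1 : k * n ≤ (4 * p) ^ (3 * p ^ 3 + 3) := by
    rw [pow_succ]
    exact Nat.mul_le_mul hk.le (by omega)
  have h2 : Real.log ((k * n : ℕ) : ℝ) ≤ (p : ℝ) ^ 6 := by
    calc Real.log ((k * n : ℕ) : ℝ)
        ≤ Real.log ((4 * p : ℝ) ^ (3 * p ^ 3 + 3)) := by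
          apply Real.log_le_log
          · exact_mod_cast (by omega : 0 < k * n)
          · exact_mod_cast h1
      _ = (3 * (p : ℝ) ^ 3 + 3) * Real.log (4 * p) := by
          rw [Real.log_pow]; push_cast; ring
      _ ≤ (3 * (p : ℝ) ^ 3 + 3) * (4 * p) := by
          gcongr
          exact Real.log_le_self (by positivity)
      _ ≤ (p : ℝ) ^ 6 := by
          have h3 : (3 : ℝ) ≤ 3 * (p : ℝ) ^ 3 := by
            have := one_le_pow₀ (by linarith : (1 : ℝ) ≤ p) (n := 3)
            linarith
          have h4 : (24 : ℝ) ≤ (p : ℝ) ^ 2 := by nlinarith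
          calc (3 * (p : ℝ) ^ 3 + 3) * (4 * p) ≤ (3 * (p : ℝ) ^ 3 + 3 * (p : ℝ) ^ 3) * (4 * p) := by
                gcongr
            _ = 24 * (p : ℝ) ^ 4 := by ring
            _ ≤ (p : ℝ) ^ 2 * (p : ℝ) ^ 4 := by gcongr
            _ = (p : ℝ) ^ 6 := by ring
  have hpos : 0 < Real.log ((k * n : ℕ) : ℝ) :=
    Real.log_pos (by exact_mod_cast (by omega : 1 < k * n))
  have h3 : Real.log p ≤ (q : ℝ) ^ 11 + 1 := by
    calc Real.log p ≤ Real.log ((2 : ℝ) ^ (q ^ 11 + 1)) := by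
          apply Real.log_le_log (by linarith)
          exact_mod_cast hp
      _ = ((q : ℝ) ^ 11 + 1) * Real.log 2 := by rw [Real.log_pow]; push_cast; ring
      _ ≤ ((q : ℝ) ^ 11 + 1) * 1 := by
          gcongr
          linarith [Real.log_two_lt_d9]
      _ = _ := mul_one _
  calc Real.log (Real.log ((k * n : ℕ) : ℝ)) ≤ Real.log ((p : ℝ) ^ 6) := Real.log_le_log hpos h2
    _ = 6 * Real.log p := by rw [Real.log_pow]; norm_num
    _ ≤ 6 * ((q : ℝ) ^ 11 + 1) := by gcongr
    _ ≤ 6 * ((q : ℝ) ^ 11 + (q : ℝ) ^ 11) := by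
        gcongr
        exact one_le_pow₀ (by linarith)
    _ = 12 * (q : ℝ) ^ 11 := by ring
    _ ≤ (q : ℝ) * (q : ℝ) ^ 11 := by gcongr; linarith
    _ = (q : ℝ) ^ 12 := by ring

end Growth

section Limit

lemma exists_add_natCast_mem {p : ℕ} [NeZero p] {q : ℕ} (hq : 1 ≤ q) {C : Finset (ZMod p)}
    (hC : (p : ℝ) - 1 / (4 * (q : ℝ) ^ 2) * p < C.card) (a : ℤ) :
    ∃ m : ℕ, (m : ℝ) ≤ p / (4 * (q : ℝ) ^ 2) ∧ ((a + m : ℤ) : ZMod p) ∈ C := by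
  classical
  by_contra! hcon
  have hp0 : (0 : ℝ) < p := by exact_mod_cast NeZero.pos p
  have hq0 : (1 : ℝ) ≤ q := by exact_mod_cast hq
  set y : ℝ := p / (4 * (q : ℝ) ^ 2) with hy
  have hy0 : 0 ≤ y := by positivity
  have hyp : y < p := by
    rw [hy, div_lt_iff₀ (by positivity)]
    have hq2 : 1 < 4 * (q : ℝ) ^ 2 := by nlinarith
    exact lt_mul_of_one_lt_right hp0 hq2
  have hM : ⌊y⌋₊ + 1 ≤ p := Nat.succ_le_of_lt ((Nat.floor_lt hy0).2 hyp)
  set A : Finset (ZMod p) := (Finset.range (⌊y⌋₊ + 1)).image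
    fun m : ℕ => ((a + m : ℤ) : ZMod p) with hA
  have hcard : A.card = ⌊y⌋₊ + 1 := by
    rw [hA, Finset.card_image_of_injOn, Finset.card_range]
    intro m hm m' hm' h
    simp only [Finset.coe_range, Set.mem_Iio] at hm hm'
    simp only [Int.cast_add, Int.cast_natCast, add_right_inj] at h
    rw [ZMod.natCast_eq_natCast_iff'] at h
    rwa [Nat.mod_eq_of_lt (hm.trans_le hM), Nat.mod_eq_of_lt (hm'.trans_le hM)] at h
  have hdisj : Disjoint A C := by
    rw [Finset.disjoint_left]
    intro x hx
    obtain ⟨m, hm, rfl⟩ := Finset.mem_image.1 hx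
    apply hcon
    exact (Nat.le_floor_iff hy0).1 (Nat.lt_succ_iff.1 (Finset.mem_range.1 hm))
  have h1 : A.card + C.card ≤ p := by
    rw [← Finset.card_union_of_disjoint hdisj]
    exact (Finset.card_le_univ _).trans (ZMod.card p).le
  have h2 : ((⌊y⌋₊ + 1 : ℕ) : ℝ) + C.card ≤ p := by exact_mod_cast hcard ▸ h1
  have h3 := Nat.lt_floor_add_one y
  push_cast at h2
  have h4 : 1 / (4 * (q : ℝ) ^ 2) * p = y := by rw [hy]; ring
  linarith

lemma apply_two_pi_mul_val {g : ℝ → ℂ} (hper : Function.Periodic g (2 * π)) {p : ℕ} [NeZero p]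
    (n : ℤ) : g (2 * π * (n : ZMod p).val / p) = g (2 * π * n / p) := by
  have hp0 : (p : ℝ) ≠ 0 := by exact_mod_cast NeZero.ne p
  have h1 : (((n : ZMod p).val : ℤ) : ℝ) = ((n - p * (n / p) : ℤ) : ℝ) := by
    rw [ZMod.val_intCast, Int.emod_def]
  rw [Int.cast_natCast] at h1
  rw [h1, ← hper.sub_int_mul_eq (n / p : ℤ) (x := 2 * π * n / p)]
  congr 1
  push_cast
  field_simp

lemma exists_points {g : ℝ → ℂ} (hper : Function.Periodic g (2 * π)) {p : ℕ} [NeZero p] {q : ℕ}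
    (hq : 1 ≤ q) (hqp : q ≤ p)
    (hclass : ∀ h : ZMod p, ∃ j₀, (p : ℝ) - 1 / (4 * (q : ℝ) ^ 2) * p <
      (phaseClass (fun x : ZMod p => g (2 * π * x.val / p)) (1 / (4 * p)) h j₀).card)
    (t t' H : ℝ) :
    ∃ a a' b b' : ℝ, |a - t| ≤ 30 / q ∧ |a' - (t + H)| ≤ 30 / q ∧ |b - t'| ≤ 30 / q ∧
      |b' - (t' + H)| ≤ 30 / q ∧ ‖g a' * star (g a) - g b' * star (g b)‖ ≤ 30 / q := by
  have hp0 : (0 : ℝ) < p := by exact_mod_cast NeZero.pos p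
  have hq0 : (1 : ℝ) ≤ q := by exact_mod_cast hq
  have hqp' : (q : ℝ) ≤ p := by exact_mod_cast hqp
  have hclose : ∀ (s : ℝ) (n : ℤ) (m : ℕ), (m : ℝ) ≤ p / (4 * (q : ℝ) ^ 2) →
      |n - p * s / (2 * π)| ≤ m + 2 → |2 * π * n / p - s| ≤ 30 / q := by
    intro s n m hm hn
    have h1 : 2 * π * n / p - s = (2 * π / p) * (n - p * s / (2 * π)) := by
      have := Real.pi_pos.ne'
      field_simp
    rw [h1, abs_mul, abs_of_pos (by positivity)]
    have h2 : (m : ℝ) + 2 ≤ 3 * p / q := by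
      have h3 : p / (4 * (q : ℝ) ^ 2) ≤ p / q := by
        gcongr
        nlinarith
      have h4 : (2 : ℝ) ≤ 2 * p / q := by
        rw [le_div_iff₀ (by positivity)]; linarith
      calc (m : ℝ) + 2 ≤ p / q + 2 * p / q := by linarith
        _ = 3 * p / q := by ring
    calc 2 * π / p * |n - p * s / (2 * π)| ≤ 2 * π / p * (3 * p / q) := by
          gcongr
          exact hn.trans h2
      _ = 6 * π / q := by field_simp; ring
      _ ≤ 30 / q := by
          gcongr
          linarith [Real.pi_lt_four]
  set h : ℤ := ⌊p * H / (2 * π)⌋ with hh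
  obtain ⟨j₀, hj₀⟩ := hclass (h : ZMod p)
  have hfl : ∀ x : ℝ, (⌊x⌋ : ℝ) ≤ x ∧ x < ⌊x⌋ + 1 := fun x => ⟨Int.floor_le x, Int.lt_floor_add_one x⟩
  have key : ∀ s : ℝ, ∃ a a' : ℝ, |a - s| ≤ 30 / q ∧ |a' - (s + H)| ≤ 30 / q ∧
      ‖g a' * star (g a) - phaseDiff (fun x : ZMod p => g (2 * π * x.val / p)) h j₀‖
        ≤ 1 / (4 * p) := by
    intro s
    obtain ⟨m, hm, hmem⟩ := exists_add_natCast_mem hq hj₀ ⌊p * s / (2 * π)⌋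
    set n : ℤ := ⌊p * s / (2 * π)⌋ + m with hn
    have hs1 := hfl (p * s / (2 * π))
    have hs2 := hfl (p * H / (2 * π))
    have hm0 : (0 : ℝ) ≤ m := m.cast_nonneg
    refine ⟨2 * π * n / p, 2 * π * (n + h : ℤ) / p, hclose _ _ m hm ?_, hclose _ _ m hm ?_, ?_⟩
    · rw [hn, abs_le]
      push_cast
      constructor <;> linarith
    · have : p * (s + H) / (2 * π) = p * s / (2 * π) + p * H / (2 * π) := by ring
      rw [this, hn, hh, abs_le]
      push_cast
      constructor <;> linarith
    · have h5 := mem_phaseClass.1 hmem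
      rw [phaseDiff, ← Int.cast_add, apply_two_pi_mul_val hper,
        apply_two_pi_mul_val hper] at h5
      exact h5
  obtain ⟨a, a', ha, ha', hga⟩ := key t
  obtain ⟨b, b', hb, hb', hgb⟩ := key t'
  refine ⟨a, a', b, b', ha, ha', hb, hb', ?_⟩
  have h6 : (1 : ℝ) / (4 * p) ≤ 1 / q := by
    gcongr
    linarith
  have h7 : (1 : ℝ) / q + 1 / q ≤ 30 / q := by
    rw [← add_div]; gcongr; norm_num
  calc ‖g a' * star (g a) - g b' * star (g b)‖
      ≤ _ := norm_sub_le_norm_sub_add_norm_sub _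
        (phaseDiff (fun x : ZMod p => g (2 * π * x.val / p)) h j₀) _
    _ ≤ 1 / (4 * p) + 1 / (4 * p) := by
        rw [norm_sub_rev _ (g b' * star (g b))]
        exact add_le_add hga hgb
    _ ≤ 30 / q := by linarith

lemma mul_star_eq_of_eventually {g : ℝ → ℂ} (hcont : Continuous g)
    (hper : Function.Periodic g (2 * π))
    (hclass : ∀ᶠ q : ℕ in atTop, ∃ (p : ℕ) (_ : NeZero p), q ≤ p ∧
      ∀ h : ZMod p, ∃ j₀, (p : ℝ) - 1 / (4 * (q : ℝ) ^ 2) * p <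
        (phaseClass (fun x : ZMod p => g (2 * π * x.val / p)) (1 / (4 * p)) h j₀).card)
    (t t' H : ℝ) : g (t + H) * star (g t) = g (t' + H) * star (g t') := by
  have h1 : ∀ᶠ q : ℕ in atTop, ∃ a a' b b' : ℝ, |a - t| ≤ 30 / q ∧ |a' - (t + H)| ≤ 30 / q ∧
      |b - t'| ≤ 30 / q ∧ |b' - (t' + H)| ≤ 30 / q ∧
      ‖g a' * star (g a) - g b' * star (g b)‖ ≤ 30 / q := by
    filter_upwards [hclass, eventually_ge_atTop 1] with q hq hq1
    obtain ⟨p, _, hqp, hp⟩ := hq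
    exact exists_points hper hq1 hqp hp t t' H
  obtain ⟨Q, hQ⟩ := eventually_atTop.1 h1
  choose a a' b b' ha ha' hb hb' hg using fun n : ℕ => hQ (n + Q) (Nat.le_add_left _ _)
  have hlim : Tendsto (fun n : ℕ => (30 : ℝ) / (n + Q : ℕ)) atTop (nhds 0) :=
    (tendsto_const_div_atTop_nhds_zero_nat 30).comp (tendsto_add_atTop_nat Q)
  have hto : ∀ {u : ℕ → ℝ} {s : ℝ}, (∀ n, |u n - s| ≤ 30 / (n + Q : ℕ)) →
      Tendsto (fun n => g (u n)) atTop (nhds (g s)) := by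
    intro u s hu
    refine (hcont.tendsto s).comp ?_
    rw [tendsto_iff_dist_tendsto_zero]
    exact squeeze_zero (fun _ => dist_nonneg) hu hlim
  have h2 := ((hto ha').mul (hto ha).star).sub ((hto hb').mul (hto hb).star)
  have h3 := squeeze_zero_norm hg hlim
  exact sub_eq_zero.1 (tendsto_nhds_unique h2 h3)

end Limit

section Affine

lemma eq_of_continuous_int_valued {X : Type*} [TopologicalSpace X] [PreconnectedSpace X]
    {u : X → ℝ} (hu : Continuous u) (hval : ∀ x, ∃ n : ℤ, u x = n) (x y : X) : u x = u y := by
  choose n hn using hval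
  have hn' : Continuous n := by
    rw [Int.isClosedEmbedding_coe_real.isEmbedding.continuous_iff]
    exact hu.congr hn
  rw [hn, hn, PreconnectedSpace.constant inferInstance hn']

lemma sub_eq_sub_of_exp_mul_star_eq {n : ℕ} (hn : n ≠ 0) {ψ : ℝ → ℝ} (hψ : Continuous ψ)
    (h : ∀ t t' H : ℝ,
      exp (I * n * ψ (t + H)) * star (exp (I * n * ψ t)) =
        exp (I * n * ψ (t' + H)) * star (exp (I * n * ψ t'))) (t t' H : ℝ) :
    ψ (t + H) - ψ t = ψ (t' + H) - ψ t' := by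
  have hstar : ∀ x : ℝ, star (exp (I * n * x)) = exp (-(I * n * x)) := by
    intro x
    rw [Complex.star_def, ← Complex.exp_conj]
    simp
  have hn' : (n : ℝ) ≠ 0 := by exact_mod_cast hn
  let u : ℝ → ℝ := fun H => n * ((ψ (t + H) - ψ t) - (ψ (t' + H) - ψ t')) / (2 * π)
  have hu : Continuous u := by fun_prop
  have hval : ∀ H, ∃ m : ℤ, u H = m := by
    intro H
    have h1 := h t t' H
    rw [hstar, hstar, ← Complex.exp_add, ← Complex.exp_add, Complex.exp_eq_exp_iff_exists_int] at h1
    obtain ⟨m, hm⟩ := h1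
    refine ⟨m, ?_⟩
    have h2 : I * ((n * ((ψ (t + H) - ψ t) - (ψ (t' + H) - ψ t')) : ℝ) : ℂ) =
        I * ((m * (2 * π) : ℝ) : ℂ) := by
      push_cast
      linear_combination hm
    have h3 := Complex.ofReal_injective (mul_left_cancel₀ Complex.I_ne_zero h2)
    simp only [u]
    rw [h3]
    field_simp
  have h0 := eq_of_continuous_int_valued hu hval H 0
  have hpi := Real.pi_pos.ne'
  simp only [u, add_zero, sub_self, mul_zero, zero_div, div_eq_zero_iff, mul_eq_zero, hn', hpi,
    false_or, or_false, OfNat.ofNat_ne_zero] at h0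
  linarith

lemma eq_mul_of_sub_eq_sub {ψ : ℝ → ℝ} (hψ : Continuous ψ)
    (h : ∀ t t' H : ℝ, ψ (t + H) - ψ t = ψ (t' + H) - ψ t') (s : ℝ) :
    ψ s - ψ 0 = s * (ψ 1 - ψ 0) := by
  let A : ℝ →+ ℝ := AddMonoidHom.mk' (fun s => ψ s - ψ 0) fun a b => by
    have := h a 0 b
    rw [zero_add] at this
    linarith
  have hA : Continuous A := by
    change Continuous fun s => ψ s - ψ 0
    fun_prop
  have := map_real_smul A hA s 1
  rwa [smul_eq_mul, smul_eq_mul, mul_one] at this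

lemma eq_sum_of_eq_mul {d : ℕ} {φ : (Fin d → ℝ) → ℝ} (hφ : Continuous φ)
    (hper : ∀ (t : Fin d → ℝ) (j : Fin d), ∃ m : ℤ,
      φ (t + (2 * π) • (Pi.single j 1 : Fin d → ℝ)) - φ t = 2 * π * m)
    (h : ∀ (t : Fin d → ℝ) (j : Fin d) (s : ℝ), φ (t + s • (Pi.single j 1 : Fin d → ℝ)) - φ t =
      s * (φ (t + (Pi.single j 1 : Fin d → ℝ)) - φ t)) :
    ∃ ν : Fin d → ℤ, ∀ t : Fin d → ℝ, φ t = (∑ j : Fin d, (ν j : ℝ) * t j) + φ 0 := by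
  have hval : ∀ (j : Fin d) (t : Fin d → ℝ), ∃ m : ℤ,
      φ (t + (Pi.single j 1 : Fin d → ℝ)) - φ t = m := by
    intro j t
    obtain ⟨m, hm⟩ := hper t j
    rw [h] at hm
    exact ⟨m, mul_left_cancel₀ Real.two_pi_pos.ne' hm⟩
  choose ν hν using fun j => hval j 0
  have hslope : ∀ j t, φ (t + (Pi.single j 1 : Fin d → ℝ)) - φ t = ν j := fun j t => by
    rw [← hν]
    exact eq_of_continuous_int_valued (by fun_prop) (hval j) t 0
  refine ⟨ν, fun t => ?_⟩
  have hs : ∀ s : Finset (Fin d), φ (∑ j ∈ s, t j • (Pi.single j 1 : Fin d → ℝ)) =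
      ∑ j ∈ s, (ν j : ℝ) * t j + φ 0 := by
    intro s
    induction s using Finset.induction_on with
    | empty => simp
    | insert a s ha ih =>
      rw [Finset.sum_insert ha, Finset.sum_insert ha, add_comm (t a • _)]
      have := h (∑ j ∈ s, t j • (Pi.single j 1 : Fin d → ℝ)) a (t a)
      rw [hslope, ih] at this
      linarith
  rw [← hs]
  congr 1
  ext i
  simp [Finset.sum_apply, Pi.single_apply]

end Affine

section Main
variable {d : ℕ}

lemma periodic_exp {φ : (Fin d → ℝ) → ℝ}
    (hper : ∀ (t : Fin d → ℝ) (j : Fin d), ∃ m : ℤ,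
      φ (t + (2 * π) • (Pi.single j 1 : Fin d → ℝ)) - φ t = 2 * π * m) (n : ℤ)
    (t : Fin d → ℝ) (j : Fin d) :
    exp (I * n * φ (t + (2 * π) • (Pi.single j 1 : Fin d → ℝ))) = exp (I * n * φ t) := by
  obtain ⟨m, hm⟩ := hper t j
  rw [Complex.exp_eq_exp_iff_exists_int]
  refine ⟨n * m, ?_⟩
  rw [sub_eq_iff_eq_add.1 hm]
  push_cast
  ring

lemma wienerLE_one {p : ℕ} [NeZero p] : WienerLE (fun _ : ZMod p => (1 : ℂ)) 1 := by
  have h := wienerLE_of_hasSum (p := p) (b := fun _ : Unit => (1 : ℂ)) (.of_finite) (fun _ => 0)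
    (f := fun _ => 1) fun x => by
      simp [chi_zero_left]
  simpa using h

lemma exists_prime_phaseClass {φ : (Fin d → ℝ) → ℝ} (hcont : Continuous φ)
    (hper : ∀ (t : Fin d → ℝ) (j : Fin d), ∃ m : ℤ,
      φ (t + (2 * π) • (Pi.single j 1 : Fin d → ℝ)) - φ t = 2 * π * m)
    {N : ℕ} (hN : 2 ≤ N)
    (hsum : ∀ n : ℕ, N ≤ n → Summable fun k : Fin d → ℤ =>
      ‖fourierCoeffTd d (fun t => exp (I * ((n : ℤ) : ℂ) * (φ t : ℂ))) k‖)
    (hnorm : ∀ n : ℕ, N ≤ n → 0 ≤ Real.log (Real.log n) ∧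
      normATd d (fun t => exp (I * ((n : ℤ) : ℂ) * (φ t : ℂ))) ≤
        Real.log (Real.log n) ^ ((1 : ℝ) / 12))
    (t : Fin d → ℝ) (j : Fin d) {q : ℕ} (hq : 100000 ≤ q) (hNq : N ≤ q) :
    ∃ (p : ℕ) (_ : NeZero p), q ≤ p ∧
      ∀ h : ZMod p, ∃ j₀, (p : ℝ) - 1 / (4 * (q : ℝ) ^ 2) * p <
        (phaseClass (fun x : ZMod p =>
          exp (I * N * φ (t + (2 * π * x.val / p : ℝ) • (Pi.single j 1 : Fin d → ℝ))))
          (1 / (4 * p)) h j₀).card := by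
  obtain ⟨p, hp, hp1, hp2⟩ := Nat.exists_prime_lt_and_le_two_mul (2 ^ q ^ 11) (by positivity)
  rw [← pow_succ'] at hp2
  have hqp : q ≤ p :=
    ((Nat.lt_two_pow_self (n := q)).le.trans
      (Nat.pow_le_pow_right two_pos (Nat.le_self_pow (by norm_num) q))).trans hp1.le
  have : NeZero p := ⟨hp.ne_zero⟩
  refine ⟨p, inferInstance, hqp, fun h => ?_⟩
  refine exists_phaseClass_card_gt hp hq hp1.le hp2 (fun x => ?_) (fun k hk => ?_) h
  · rw [show I * N * φ (t + (2 * π * x.val / p : ℝ) • (Pi.single j 1 : Fin d → ℝ)) =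
      ((N * φ (t + (2 * π * x.val / p : ℝ) • (Pi.single j 1 : Fin d → ℝ)) : ℝ) : ℂ) * I by
        push_cast; ring, Complex.norm_exp_ofReal_mul_I]
  have hq1 : (1 : ℝ) ≤ q := by exact_mod_cast (by omega : 1 ≤ q)
  rcases Nat.eq_zero_or_pos k with rfl | hk0
  · simpa using wienerLE_one.mono hq1
  have hNk : N ≤ k * N := Nat.le_mul_of_pos_left N hk0
  have hle : normATd d (fun t => exp (I * ((k * N : ℕ) : ℤ) * (φ t : ℂ))) ≤ q := by
    obtain ⟨h0, h1⟩ := hnorm (k * N) hNk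
    refine h1.trans ?_
    have h2 := log_log_mul_le (by omega) hqp hp2 hk hNq (hN.trans hNk)
    calc Real.log (Real.log ((k * N : ℕ) : ℝ)) ^ ((1 : ℝ) / 12)
        ≤ ((q : ℝ) ^ 12) ^ ((1 : ℝ) / 12) := Real.rpow_le_rpow h0 h2 (by norm_num)
      _ = q := by
        rw [one_div]
        exact_mod_cast Real.pow_rpow_inv_natCast (by positivity : (0 : ℝ) ≤ q) (n := 12) (by norm_num)
  have h3 := (wienerLE_sample (f := fun t => exp (I * ((k * N : ℕ) : ℤ) * (φ t : ℂ)))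
    (by fun_prop) (periodic_exp hper _) (hsum _ hNk) t j p).mono hle
  convert h3 using 2 with x
  rw [← Complex.exp_nat_mul]
  congr 1
  push_cast
  ring

end Main

end BeurlingHelson

theorem beurling_helson_improvement_multidimensional
    (d : ℕ) (hd : 1 ≤ d)
    (φ : (Fin d → ℝ) → ℝ) (hcont : Continuous φ)
    (hper : ∀ (t : Fin d → ℝ) (j : Fin d), ∃ m : ℤ,
      φ (t + (2 * π) • (Pi.single j 1 : Fin d → ℝ)) - φ t = 2 * π * m)
    (hsum : ∃ n₀ : ℤ, ∀ n : ℤ, n₀ ≤ |n| →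
      Summable fun k : Fin d → ℤ =>
        ‖fourierCoeffTd d (fun t => Complex.exp (Complex.I * (n : ℂ) * (φ t : ℂ))) k‖)
    (hdecay : Tendsto
      (fun n : ℤ =>
        normATd d (fun t => Complex.exp (Complex.I * (n : ℂ) * (φ t : ℂ))) *
          (Real.log (Real.log (Real.log |(n : ℝ)|)) /
            Real.log (Real.log |(n : ℝ)|)) ^ ((1 : ℝ) / 12))
      cofinite (nhds 0)) :
    ∃ ν : Fin d → ℤ, ∀ t : Fin d → ℝ, φ t = (∑ j : Fin d, (ν j : ℝ) * t j) + φ 0 := by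
  obtain ⟨n₀, hn₀⟩ := hsum
  have hlog : Tendsto (fun n : ℕ => Real.log (Real.log n)) atTop atTop :=
    Real.tendsto_log_atTop.comp (Real.tendsto_log_atTop.comp tendsto_natCast_atTop_atTop)
  have hnorm := BeurlingHelson.eventually_le_log_log_rpow
    (fun n : ℤ => (tsum_nonneg fun _ => norm_nonneg _ :
      0 ≤ normATd d (fun t => exp (I * (n : ℂ) * (φ t : ℂ))))) hdecay
  obtain ⟨N₁, hN₁⟩ := eventually_atTop.1 ((hlog.eventually_ge_atTop 0).and hnorm)
  set N : ℕ := max 2 (max N₁ n₀.toNat) with hN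
  have hN2 : 2 ≤ N := le_max_left _ _
  have hs : ∀ n : ℕ, N ≤ n → Summable fun k : Fin d → ℤ =>
      ‖fourierCoeffTd d (fun t => exp (I * ((n : ℤ) : ℂ) * (φ t : ℂ))) k‖ := fun n hn => by
    apply hn₀
    rw [Nat.abs_cast]
    omega
  refine BeurlingHelson.eq_sum_of_eq_mul hcont hper fun t j s => ?_
  have hψ : Continuous fun s : ℝ => φ (t + s • (Pi.single j 1 : Fin d → ℝ)) := by fun_prop
  have hmul := BeurlingHelson.mul_star_eq_of_eventually
    (g := fun s : ℝ => exp (I * N * φ (t + s • (Pi.single j 1 : Fin d → ℝ)))) (by fun_prop)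
    (fun s => by
      have := BeurlingHelson.periodic_exp hper N (t + s • (Pi.single j 1 : Fin d → ℝ)) j
      rw [add_assoc, ← add_smul] at this
      exact_mod_cast this)
    (by
      filter_upwards [eventually_ge_atTop 100000, eventually_ge_atTop N] with q hq hNq
      exact BeurlingHelson.exists_prime_phaseClass hcont hper hN2 hs
        (fun n hn => hN₁ n (by omega)) t j hq hNq)
  have := BeurlingHelson.eq_mul_of_sub_eq_sub hψ (BeurlingHelson.sub_eq_sub_of_exp_mul_star_eq (by omega : N ≠ 0) hψ hmul) s
  simpa only [zero_smul, add_zero, one_smul] using this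
end

section
/- There exists a constant c > 0 such that for every sufficiently large prime number N and every subset E ⊆ ℤ/Nℤ, one has min(card(E)/N, 1 − card(E)/N) ≤ c · (log log N / log N)^{1/3} · ‖1_E‖_{A(𝕋_N)}, where 1_E is the characteristic function of E. -/
open scoped Real
open Complex Filter

/-- The Fourier transform on the cyclic group `ℤ/Nℤ`. -/
noncomputable def dftN (N : ℕ) [NeZero N] (g : ZMod N → ℂ) (k : ZMod N) : ℂ :=
  (1 / (N : ℂ)) * ∑ j : ZMod N,
    g j * Complex.exp (-(2 * (π : ℂ) * Complex.I) * (j.val : ℂ) * (k.val : ℂ) / (N : ℂ))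

/-- The `A(𝕋_N)` norm on the cyclic group `ℤ/Nℤ`. -/
noncomputable def normAN (N : ℕ) [NeZero N] (g : ZMod N → ℂ) : ℝ :=
  ∑ k : ZMod N, ‖dftN N g k‖

/-- `BoundedSpan Λ n r` says that `r` is a signed sum of at most `n` elements of `Λ`. -/
inductive BoundedSpan {G : Type*} [AddCommGroup G] (Λ : Finset G) : ℕ → G → Prop
  | zero (n : ℕ) : BoundedSpan Λ n 0
  | add {n : ℕ} {r s : G} : BoundedSpan Λ n r → s ∈ Λ → BoundedSpan Λ (n + 1) (r + s)
  | sub {n : ℕ} {r s : G} : BoundedSpan Λ n r → s ∈ Λ → BoundedSpan Λ (n + 1) (r - s)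

namespace BoundedSpan

variable {G : Type*} [AddCommGroup G] {Λ Λ' : Finset G} {m n : ℕ} {r s : G}

lemma mono_left (h : BoundedSpan Λ n r) (hΛ : Λ ⊆ Λ') : BoundedSpan Λ' n r := by
  induction h with
  | zero n => exact zero n
  | add _ hs ih => exact add ih (hΛ hs)
  | sub _ hs ih => exact sub ih (hΛ hs)

lemma mono_right (h : BoundedSpan Λ n r) (hnm : n ≤ m) : BoundedSpan Λ m r := by
  induction h generalizing m with
  | zero n => exact zero m
  | add _ hs ih =>
    obtain ⟨k, rfl⟩ : ∃ k, m = k + 1 := ⟨m - 1, by omega⟩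
    exact add (ih (by omega)) hs
  | sub _ hs ih =>
    obtain ⟨k, rfl⟩ : ∃ k, m = k + 1 := ⟨m - 1, by omega⟩
    exact sub (ih (by omega)) hs

lemma add_add (hr : BoundedSpan Λ n r) (hs : BoundedSpan Λ m s) :
    BoundedSpan Λ (n + m) (r + s) := by
  induction hs with
  | zero m => simpa using hr.mono_right (Nat.le_add_right n m)
  | add _ hs ih => rw [← add_assoc, ← add_assoc]; exact add ih hs
  | sub _ hs ih => rw [← add_assoc, ← add_sub_assoc]; exact sub ih hs

lemma neg (hr : BoundedSpan Λ n r) : BoundedSpan Λ n (-r) := by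
  induction hr with
  | zero n => simpa using zero n
  | add _ hs ih => rw [neg_add, ← sub_eq_add_neg]; exact sub ih hs
  | sub _ hs ih => rw [neg_sub', sub_neg_eq_add]; exact add ih hs

lemma sub_sub (hr : BoundedSpan Λ n r) (hs : BoundedSpan Λ m s) :
    BoundedSpan Λ (n + m) (r - s) := by
  rw [sub_eq_add_neg]; exact hr.add_add hs.neg

lemma nsmul_mem (hs : s ∈ Λ) (n : ℕ) : BoundedSpan Λ n (n • s) := by
  induction n with
  | zero => simpa using zero 0
  | succ n ih => rw [succ_nsmul]; exact add ih hs

end BoundedSpan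

open scoped Classical in
/-- Either the frequencies outside `R` have few weighted coincidences modulo the bounded span of
`Λ`, or a few translates of the bounded span capture a substantial part of their weight. -/
lemma exists_capturing_translates {G : Type*} [AddCommGroup G] [Fintype G] (w : G → ℝ)
    (hw : ∀ r, 0 ≤ w r) (hw1 : ∑ r, w r ≤ 1) (R Λ : Finset G) (l : ℕ) (ε : ℝ)
    (hQ : ε ^ 2 ≤ ∑ s ∈ Rᶜ, ∑ r ∈ Rᶜ with BoundedSpan Λ l (r - s), w s * w r) :
    ∃ T : Finset G,
      T.card * (ε ^ 2 / 2) ≤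
        ∑ r ∈ Rᶜ with ∃ s ∈ T, BoundedSpan Λ (3 * l) (r - s), w r ∧
      ε ^ 2 / 2 ≤ (∑ r ∈ Rᶜ with ∃ s ∈ T, BoundedSpan Λ (3 * l) (r - s), w r) ^ 2 := by
  set t : G → ℝ := fun s => ∑ r ∈ Rᶜ with BoundedSpan Λ l (r - s), w r with ht
  set S : Finset G := Rᶜ.filter fun s => ε ^ 2 / 2 ≤ t s with hS
  set Disj : Finset G → Prop := fun T => ∀ s ∈ T, ∀ s' ∈ T, s ≠ s' →
    ∀ r, BoundedSpan Λ l (r - s) → ¬ BoundedSpan Λ l (r - s') with hDisj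
  obtain ⟨T, hT, hmax⟩ := Finset.exists_max_image (S.powerset.filter Disj) Finset.card
    ⟨∅, by simp [hDisj]⟩
  simp only [Finset.mem_filter, Finset.mem_powerset] at hT hmax
  obtain ⟨hTS, hTD⟩ := hT
  refine ⟨T, ?_⟩
  set m := ∑ r ∈ Rᶜ with ∃ s ∈ T, BoundedSpan Λ (3 * l) (r - s), w r with hm
  have hm0 : 0 ≤ m := Finset.sum_nonneg fun r _ => hw r
  have hSnear : ∀ s ∈ S, ∃ s' ∈ T, ∃ r, BoundedSpan Λ l (r - s) ∧ BoundedSpan Λ l (r - s') := by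
    intro s hs
    by_contra! hcon
    have hsT : s ∉ T := fun h => hcon s h s (by simpa using .zero l) (by simpa using .zero l)
    have := hmax (insert s T) ⟨Finset.insert_subset hs hTS, by
      intro a ha b hb hab r hra hrb
      rw [Finset.mem_insert] at ha hb
      rcases ha with rfl | ha <;> rcases hb with rfl | hb
      · exact hab rfl
      · exact hcon b hb r hra hrb
      · exact hcon a ha r hrb hra
      · exact hTD a ha b hb hab r hra hrb⟩
    rw [Finset.card_insert_of_notMem hsT] at this
    omega
  have hcap : ∀ s ∈ S, ∀ r, BoundedSpan Λ l (r - s) →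
      ∃ s' ∈ T, BoundedSpan Λ (3 * l) (r - s') := by
    intro s hs r hr
    obtain ⟨s', hs', q, hq, hq'⟩ := hSnear s hs
    refine ⟨s', hs', ?_⟩
    have := (hr.sub_sub hq).add_add hq'
    rw [show r - s' = r - s - (q - s) + (q - s') by abel]
    exact this.mono_right (by omega)
  have htm : ∀ s ∈ S, t s ≤ m := by
    intro s hs
    refine Finset.sum_le_sum_of_subset_of_nonneg ?_ fun r _ _ => hw r
    intro r hr
    rw [Finset.mem_filter] at hr ⊢
    exact ⟨hr.1, hcap s hs r hr.2⟩
  have hSm : ∑ s ∈ S, w s ≤ m := by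
    refine Finset.sum_le_sum_of_subset_of_nonneg ?_ fun r _ _ => hw r
    intro r hr
    rw [Finset.mem_filter]
    exact ⟨(Finset.mem_filter.1 hr).1, hcap r hr r (by simpa using .zero l)⟩
  constructor
  · calc (T.card : ℝ) * (ε ^ 2 / 2) = ∑ s ∈ T, ε ^ 2 / 2 := by simp
      _ ≤ ∑ s ∈ T, t s := Finset.sum_le_sum fun s hs => (Finset.mem_filter.1 (hTS hs)).2
      _ = ∑ r ∈ T.biUnion fun s => Rᶜ.filter fun r => BoundedSpan Λ l (r - s), w r := by
        rw [Finset.sum_biUnion]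
        intro a ha b hb hab
        refine Finset.disjoint_left.2 fun r hra hrb => ?_
        exact hTD a ha b hb hab r (Finset.mem_filter.1 hra).2 (Finset.mem_filter.1 hrb).2
      _ ≤ m := by
        refine Finset.sum_le_sum_of_subset_of_nonneg ?_ fun r _ _ => hw r
        intro r hr
        simp only [Finset.mem_biUnion, Finset.mem_filter] at hr ⊢
        obtain ⟨s, hs, hrR, hrs⟩ := hr
        exact ⟨hrR, s, hs, hrs.mono_right (by omega)⟩
  · have h1 : ∑ s ∈ Rᶜ, ∑ r ∈ Rᶜ with BoundedSpan Λ l (r - s), w s * w r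
        = ∑ s ∈ S, w s * t s + ∑ s ∈ Rᶜ with ¬ ε ^ 2 / 2 ≤ t s, w s * t s := by
      rw [hS, Finset.sum_filter_add_sum_filter_not]
      exact Finset.sum_congr rfl fun s _ => by rw [ht, Finset.mul_sum]
    have h2 : ∑ s ∈ S, w s * t s ≤ m ^ 2 := by
      calc ∑ s ∈ S, w s * t s ≤ ∑ s ∈ S, w s * m :=
            Finset.sum_le_sum fun s hs => mul_le_mul_of_nonneg_left (htm s hs) (hw s)
        _ = (∑ s ∈ S, w s) * m := by rw [Finset.sum_mul]
        _ ≤ m ^ 2 := by nlinarith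
    have h3 : ∑ s ∈ Rᶜ with ¬ ε ^ 2 / 2 ≤ t s, w s * t s ≤ ε ^ 2 / 2 := by
      calc ∑ s ∈ Rᶜ with ¬ ε ^ 2 / 2 ≤ t s, w s * t s
          ≤ ∑ s ∈ Rᶜ with ¬ ε ^ 2 / 2 ≤ t s, w s * (ε ^ 2 / 2) :=
            Finset.sum_le_sum fun s hs => mul_le_mul_of_nonneg_left
              (not_le.1 (Finset.mem_filter.1 hs).2).le (hw s)
        _ ≤ ∑ s, w s * (ε ^ 2 / 2) :=
            Finset.sum_le_sum_of_subset_of_nonneg (Finset.subset_univ _) fun r _ _ =>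
              mul_nonneg (hw r) (by positivity)
        _ = (∑ s, w s) * (ε ^ 2 / 2) := by rw [Finset.sum_mul]
        _ ≤ ε ^ 2 / 2 := mul_le_of_le_one_left (by positivity) hw1
    linarith

open scoped Classical in
/-- There is a small set `Λ` of frequencies such that the frequencies outside its bounded span have
few weighted coincidences modulo a slightly larger bounded span. -/
lemma exists_few_coincidences {G : Type*} [AddCommGroup G] [Fintype G] (w : G → ℝ)
    (hw : ∀ r, 0 ≤ w r) (hw1 : ∑ r, w r ≤ 1) {ε : ℝ} (hε : 0 < ε) {K D J : ℕ} (hK : 0 < K)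
    (hD0 : 0 < D) (hD : 1 ≤ D * (ε ^ 2 / 2)) (hJ : 1 ≤ J * (ε / 2)) :
    ∃ (Λ : Finset G) (j : ℕ), j ≤ J ∧ Λ.card ≤ D ∧
      ∑ s ∈ (Finset.univ.filter (BoundedSpan Λ ((20 * K * D) ^ j)))ᶜ,
        ∑ r ∈ (Finset.univ.filter (BoundedSpan Λ ((20 * K * D) ^ j)))ᶜ with
          BoundedSpan Λ (6 * (K * (20 * K * D) ^ j) * D) (r - s), w s * w r < ε ^ 2 := by
  have hcard : ∀ (Λ R : Finset G), Λ.card * (ε ^ 2 / 2) ≤ ∑ r ∈ R, w r → Λ.card ≤ D := by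
    intro Λ R h
    have h1 : ∑ r ∈ R, w r ≤ 1 := (Finset.sum_le_sum_of_subset_of_nonneg
      (Finset.subset_univ _) fun r _ _ => hw r).trans hw1
    have h2 : (Λ.card : ℝ) * (ε ^ 2 / 2) ≤ D * (ε ^ 2 / 2) := by linarith
    exact_mod_cast le_of_mul_le_mul_right h2 (by positivity)
  by_contra! hcon
  have key : ∀ j, j ≤ J + 1 → ∃ Λ : Finset G,
      Λ.card * (ε ^ 2 / 2) ≤ ∑ r ∈ Finset.univ.filter (BoundedSpan Λ ((20 * K * D) ^ j)), w r ∧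
      j * (ε / 2) ≤ ∑ r ∈ Finset.univ.filter (BoundedSpan Λ ((20 * K * D) ^ j)), w r := by
    intro j
    induction j with
    | zero => exact fun _ => ⟨∅, by simpa using Finset.sum_nonneg fun r _ => hw r⟩
    | succ j ih =>
      intro hj
      obtain ⟨Λ, h1, h2⟩ := ih (by omega)
      set R := Finset.univ.filter (BoundedSpan Λ ((20 * K * D) ^ j)) with hR
      obtain ⟨T, hT1, hT2⟩ := exists_capturing_translates w hw hw1 R Λ _ ε
        (hcon Λ j (by omega) (hcard Λ R h1))
      set m := ∑ r ∈ Rᶜ with ∃ s ∈ T,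
        BoundedSpan Λ (3 * (6 * (K * (20 * K * D) ^ j) * D)) (r - s), w r with hm
      have hm0 : 0 ≤ m := Finset.sum_nonneg fun r _ => hw r
      have hmε : ε / 2 ≤ m := by nlinarith
      have hL : 1 ≤ (20 * K * D) ^ j := Nat.one_le_pow _ _ (by positivity)
      have hKD : 1 ≤ K * D := Nat.mul_pos hK hD0
      have hmono : ∑ r ∈ R, w r + m ≤
          ∑ r ∈ Finset.univ.filter (BoundedSpan (Λ ∪ T) ((20 * K * D) ^ (j + 1))), w r := by
        rw [hm, ← Finset.sum_union]
        · refine Finset.sum_le_sum_of_subset_of_nonneg ?_ fun r _ _ => hw r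
          intro r hr
          rw [Finset.mem_union] at hr
          rw [Finset.mem_filter]
          refine ⟨Finset.mem_univ _, ?_⟩
          rcases hr with hr | hr
          · refine ((Finset.mem_filter.1 hr).2.mono_left Finset.subset_union_left).mono_right ?_
            exact Nat.pow_le_pow_right (by positivity) (by omega)
          · obtain ⟨s, hs, hrs⟩ := (Finset.mem_filter.1 hr).2
            have := (hrs.mono_left Finset.subset_union_left).add
              (Finset.mem_union_right Λ hs)
            rw [sub_add_cancel] at this
            refine this.mono_right ?_
            rw [pow_succ]
            nlinarith
        · exact Finset.disjoint_left.2 fun r hr hr' =>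
            Finset.mem_compl.1 (Finset.mem_filter.1 hr').1 hr
      refine ⟨Λ ∪ T, ?_, ?_⟩
      · have : ((Λ ∪ T).card : ℝ) ≤ Λ.card + T.card := by exact_mod_cast Finset.card_union_le _ _
        have := mul_le_mul_of_nonneg_right this (by positivity : (0 : ℝ) ≤ ε ^ 2 / 2)
        linarith
      · push_cast
        linarith
  obtain ⟨Λ, -, h2⟩ := key (J + 1) le_rfl
  have h1 : ∑ r ∈ Finset.univ.filter (BoundedSpan Λ ((20 * K * D) ^ (J + 1))), w r ≤ 1 :=
    (Finset.sum_le_sum_of_subset_of_nonneg (Finset.subset_univ _) fun r _ _ => hw r).trans hw1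
  push_cast at h2
  linarith

section Kernel

variable {R : Type*} [CommRing R] [Fintype R] (χ : AddChar R ℂ)

/-- The Fourier transform of `F`, unnormalised, with respect to the pairing `χ (t * y)`. -/
noncomputable def charTransform (F : R → ℝ) (t : R) : ℂ := ∑ y, F y * χ (t * y)

/-- The squared modulus of the Dirichlet kernel of length `M`. -/
noncomputable def fejerKernel (M : ℕ) (θ : R) : ℝ := ‖∑ a ∈ Finset.range M, χ (a * θ)‖ ^ 2

/-- A product of kernels which is concentrated where all the `χ (s * y)`, `s ∈ Λ`, are near `1`,
and whose Fourier transform is supported on a bounded span of `Λ`. -/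
noncomputable def bohrWeight (Λ : Finset R) (M : ℕ) (y : R) : ℝ :=
  ∏ s ∈ Λ, (fejerKernel χ (2 * M) (s * y) * fejerKernel χ M (s * y))

variable {χ}

lemma norm_addChar (x : R) : ‖χ x‖ = 1 := AddChar.norm_apply χ x

omit [Fintype R] in
lemma fejerKernel_nonneg (M : ℕ) (θ : R) : 0 ≤ fejerKernel χ M θ := sq_nonneg _

omit [Fintype R] in
lemma fejerKernel_zero (M : ℕ) : fejerKernel χ M 0 = M ^ 2 := by
  simp [fejerKernel]

lemma ofReal_fejerKernel (M : ℕ) (θ : R) :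
    (fejerKernel χ M θ : ℂ) =
      ∑ a ∈ Finset.range M, ∑ b ∈ Finset.range M, χ (((a : R) - b) * θ) := by
  rw [fejerKernel, ofReal_pow, ← Complex.mul_conj', map_sum, Finset.sum_mul_sum]
  refine Finset.sum_congr rfl fun a _ => Finset.sum_congr rfl fun b _ => ?_
  rw [← AddChar.map_neg_eq_conj, ← AddChar.map_add_eq_mul]
  congr 1
  ring

lemma charTransform_mul_fejerKernel (F : R → ℝ) (s t : R) (M : ℕ) :
    charTransform χ (fun y => F y * fejerKernel χ M (s * y)) t =
      ∑ a ∈ Finset.range M, ∑ b ∈ Finset.range M,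
        charTransform χ F (t + ((a : R) - b) * s) := by
  simp only [charTransform, ofReal_mul, ofReal_fejerKernel, Finset.mul_sum, Finset.sum_mul]
  rw [Finset.sum_comm]
  refine Finset.sum_congr rfl fun a _ => ?_
  rw [Finset.sum_comm]
  refine Finset.sum_congr rfl fun b _ => Finset.sum_congr rfl fun y _ => ?_
  rw [mul_assoc, ← AddChar.map_add_eq_mul]
  congr 2
  ring

lemma sum_eq_re_charTransform (F : R → ℝ) : ∑ y, F y = (charTransform χ F 0).re := by
  simp [charTransform]

lemma re_charTransform_mul_fejerKernel_nonneg {F : R → ℝ}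
    (hF : ∀ t, 0 ≤ (charTransform χ F t).re) (s t : R) (M : ℕ) :
    0 ≤ (charTransform χ (fun y => F y * fejerKernel χ M (s * y)) t).re := by
  rw [charTransform_mul_fejerKernel, re_sum]
  refine Finset.sum_nonneg fun a _ => ?_
  rw [re_sum]
  exact Finset.sum_nonneg fun b _ => hF _

lemma sum_range_add_le_sum_range {f : ℕ → ℝ} (hf : ∀ n, 0 ≤ f n) {M m b : ℕ} (hb : M + b ≤ m) :
    ∑ a ∈ Finset.range M, f (a + b) ≤ ∑ c ∈ Finset.range m, f c := by
  rw [Finset.range_eq_Ico, Finset.sum_Ico_add' f 0 M b]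
  refine Finset.sum_le_sum_of_subset_of_nonneg (fun x hx => ?_) fun x _ _ => hf x
  simp only [Finset.mem_Ico, Finset.mem_range] at hx ⊢
  omega

/-- Multiplying a Fejér kernel of length `M` by one of length `2 * M` increases its mean against a
positive definite weight by a factor of at least `M ^ 2`. -/
lemma sq_mul_sum_fejerKernel_le {F : R → ℝ}
    (hF : ∀ t, 0 ≤ (charTransform χ F t).re) (s : R) (M : ℕ) :
    (M : ℝ) ^ 2 * ∑ y, F y * fejerKernel χ M (s * y) ≤
      ∑ y, F y * (fejerKernel χ (2 * M) (s * y) * fejerKernel χ M (s * y)) := by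
  simp only [← mul_assoc]
  rw [sum_eq_re_charTransform (χ := χ), sum_eq_re_charTransform (χ := χ),
    charTransform_mul_fejerKernel (fun y => F y * fejerKernel χ (2 * M) (s * y))]
  simp only [charTransform_mul_fejerKernel F, re_sum]
  set A := ∑ a ∈ Finset.range M, ∑ b ∈ Finset.range M,
    (charTransform χ F (0 + ((a : R) - b) * s)).re with hA
  have key : ∀ a ∈ Finset.range M, ∀ b ∈ Finset.range M, A ≤
      ∑ c ∈ Finset.range (2 * M), ∑ d ∈ Finset.range (2 * M),
        (charTransform χ F (0 + ((a : R) - b) * s + ((c : R) - d) * s)).re := by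
    intro a ha b hb
    rw [Finset.mem_range] at ha hb
    refine le_trans ?_ (sum_range_add_le_sum_range (M := M) (b := b)
      (fun c => Finset.sum_nonneg fun d _ => hF _) (by omega))
    refine Finset.sum_le_sum fun a' _ => ?_
    refine le_trans (le_of_eq ?_) (sum_range_add_le_sum_range (M := M) (b := a)
      (fun d => hF _) (by omega))
    refine Finset.sum_congr rfl fun b' _ => ?_
    congr 2
    push_cast
    ring
  calc (M : ℝ) ^ 2 * A = ∑ a ∈ Finset.range M, ∑ b ∈ Finset.range M, A := by
        simp; ring
    _ ≤ _ := Finset.sum_le_sum fun a ha => Finset.sum_le_sum fun b hb => key a ha b hb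

lemma norm_sub_sq_mul_fejerKernel_le (M : ℕ) (θ : R) :
    ‖1 - χ θ‖ ^ 2 * fejerKernel χ M θ ≤ 4 := by
  have h : (1 - χ θ) * ∑ a ∈ Finset.range M, χ (a * θ) = 1 - χ θ ^ M := by
    rw [← mul_neg_geom_sum]
    congr 1
    refine Finset.sum_congr rfl fun a _ => ?_
    rw [← AddChar.map_nsmul_eq_pow, nsmul_eq_mul]
  have h2 : ‖1 - χ θ ^ M‖ ≤ 2 := by
    refine (norm_sub_le _ _).trans ?_
    rw [norm_pow, norm_addChar]
    norm_num
  rw [fejerKernel, ← mul_pow, ← norm_mul, h]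
  nlinarith [norm_nonneg (1 - χ θ ^ M)]

omit [Fintype R] in
lemma bohrWeight_nonneg (Λ : Finset R) (M : ℕ) (y : R) : 0 ≤ bohrWeight χ Λ M y :=
  Finset.prod_nonneg fun _ _ => mul_nonneg (fejerKernel_nonneg _ _) (fejerKernel_nonneg _ _)

lemma sum_bohrWeight_pos (Λ : Finset R) {M : ℕ} (hM : 0 < M) : 0 < ∑ y, bohrWeight χ Λ M y := by
  refine Finset.sum_pos' (fun y _ => bohrWeight_nonneg Λ M y) ⟨0, Finset.mem_univ _, ?_⟩
  refine Finset.prod_pos fun s _ => ?_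
  rw [mul_zero, fejerKernel_zero, fejerKernel_zero]
  positivity

omit [Fintype R] in
open scoped Classical in
lemma bohrWeight_insert {Λ : Finset R} {s : R} (hs : s ∉ Λ) (M : ℕ) :
    bohrWeight χ (insert s Λ) M = fun y =>
      bohrWeight χ Λ M y * fejerKernel χ (2 * M) (s * y) * fejerKernel χ M (s * y) := by
  ext y
  rw [bohrWeight, Finset.prod_insert hs, mul_comm, ← mul_assoc]
  rfl

lemma re_charTransform_bohrWeight_nonneg (hχ : χ.IsPrimitive) (Λ : Finset R) (M : ℕ) (t : R) :
    0 ≤ (charTransform χ (bohrWeight χ Λ M) t).re := by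
  classical
  induction Λ using Finset.induction_on generalizing t with
  | empty =>
    have := AddChar.sum_mulShift t hχ
    simp only [charTransform, bohrWeight, Finset.prod_empty, ofReal_one, one_mul, mul_comm t, this]
    split_ifs <;> simp
  | insert s Λ hs ih =>
    rw [bohrWeight_insert hs]
    refine re_charTransform_mul_fejerKernel_nonneg (fun t => ?_) s t M
    exact re_charTransform_mul_fejerKernel_nonneg ih s t (2 * M)

lemma boundedSpan_of_charTransform_ne_zero (hχ : χ.IsPrimitive) (Λ : Finset R) (M : ℕ) (t : R)
    (ht : charTransform χ (bohrWeight χ Λ M) t ≠ 0) : BoundedSpan Λ (6 * M * Λ.card) t := by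
  classical
  induction Λ using Finset.induction_on generalizing t with
  | empty =>
    have := AddChar.sum_mulShift t hχ
    simp only [charTransform, bohrWeight, Finset.prod_empty, ofReal_one, one_mul, mul_comm t,
      this] at ht
    have : t = 0 := by
      by_contra h
      simp [h] at ht
    rw [this]
    exact .zero _
  | insert s Λ hs ih =>
    rw [bohrWeight_insert hs, charTransform_mul_fejerKernel] at ht
    obtain ⟨a, ha, ht⟩ := Finset.exists_ne_zero_of_sum_ne_zero ht
    obtain ⟨b, hb, ht⟩ := Finset.exists_ne_zero_of_sum_ne_zero ht
    rw [charTransform_mul_fejerKernel] at ht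
    obtain ⟨c, hc, ht⟩ := Finset.exists_ne_zero_of_sum_ne_zero ht
    obtain ⟨d, hd, ht⟩ := Finset.exists_ne_zero_of_sum_ne_zero ht
    have h1 := (ih _ ht).mono_left (Finset.subset_insert s Λ)
    have hsm := Finset.mem_insert_self s Λ
    have h2 := ((BoundedSpan.nsmul_mem hsm (a + c)).sub_sub (BoundedSpan.nsmul_mem hsm (b + d)))
    have h3 := h1.sub_sub h2
    simp only [Finset.mem_range] at ha hb hc hd
    rw [Finset.card_insert_of_notMem hs]
    have : t = t + ((a : R) - b) * s + ((c : R) - d) * s - ((a + c) • s - (b + d) • s) := by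
      simp only [nsmul_eq_mul]
      push_cast
      ring
    rw [this]
    refine h3.mono_right ?_
    rw [mul_add]
    omega

lemma norm_charTransform_bohrWeight_le (Λ : Finset R) (M : ℕ) (t : R) :
    ‖charTransform χ (bohrWeight χ Λ M) t‖ ≤ ∑ y, bohrWeight χ Λ M y := by
  refine (norm_sum_le _ _).trans (Finset.sum_le_sum fun y _ => ?_)
  rw [norm_mul, norm_addChar, mul_one, norm_real, Real.norm_of_nonneg (bohrWeight_nonneg Λ M y)]

lemma sq_mul_sum_bohrWeight_mul_le_of_mem (hχ : χ.IsPrimitive) {Λ : Finset R} {s : R}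
    (hs : s ∈ Λ) (M : ℕ) :
    (M : ℝ) ^ 2 * ∑ y, bohrWeight χ Λ M y * ‖1 - χ (s * y)‖ ^ 2 ≤
      4 * ∑ y, bohrWeight χ Λ M y := by
  classical
  have hins := bohrWeight_insert (χ := χ) (Finset.notMem_erase s Λ) M
  rw [Finset.insert_erase hs] at hins
  have h1 := sq_mul_sum_fejerKernel_le (χ := χ)
    (re_charTransform_bohrWeight_nonneg hχ (Λ.erase s) M) s M
  have h2 : ∑ y, bohrWeight χ Λ M y * ‖1 - χ (s * y)‖ ^ 2 ≤
      4 * ∑ y, bohrWeight χ (Λ.erase s) M y * fejerKernel χ M (s * y) := by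
    rw [Finset.mul_sum]
    refine Finset.sum_le_sum fun y _ => ?_
    have h3 := norm_sub_sq_mul_fejerKernel_le (χ := χ) (2 * M) (s * y)
    have h4 := mul_nonneg (bohrWeight_nonneg (χ := χ) (Λ.erase s) M y)
      (fejerKernel_nonneg (χ := χ) M (s * y))
    rw [hins]
    nlinarith [mul_le_mul_of_nonneg_right h3 h4]
  rw [hins] at h2 ⊢
  simp only [← mul_assoc] at h1
  nlinarith [mul_le_mul_of_nonneg_left h2 (sq_nonneg (M : ℝ))]

lemma norm_one_sub_mul_sq_le {z w : ℂ} (hz : ‖z‖ = 1) {L : ℝ} (hL : 0 < L) :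
    ‖1 - z * w‖ ^ 2 ≤ (1 + 1 / L) * ‖1 - z‖ ^ 2 + (1 + L) * ‖1 - w‖ ^ 2 := by
  have h1 : ‖1 - z * w‖ ≤ ‖1 - z‖ + ‖1 - w‖ := by
    calc ‖1 - z * w‖ = ‖(1 - z) + z * (1 - w)‖ := by congr 1; ring
      _ ≤ ‖1 - z‖ + ‖z * (1 - w)‖ := norm_add_le _ _
      _ = _ := by rw [norm_mul, hz, one_mul]
  have h2 : 0 ≤ (‖1 - z‖ - L * ‖1 - w‖) ^ 2 / L := by positivity
  have h3 : (‖1 - z‖ - L * ‖1 - w‖) ^ 2 / L =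
      1 / L * ‖1 - z‖ ^ 2 - 2 * ‖1 - z‖ * ‖1 - w‖ + L * ‖1 - w‖ ^ 2 := by
    field_simp
    ring
  nlinarith [norm_nonneg (1 - z * w), norm_nonneg (1 - z), norm_nonneg (1 - w)]

lemma norm_one_sub_neg (x : R) : ‖1 - χ (-x)‖ = ‖1 - χ x‖ := by
  rw [AddChar.map_neg_eq_conj, ← Complex.norm_conj, map_sub, map_one, conj_conj]

/-- A quadratic functional which is at most `B` on `Λ` grows at most quadratically on the bounded
spans of `Λ`. -/
lemma sum_mul_norm_one_sub_sq_le {Λ : Finset R} {W : R → ℝ} (hW : ∀ y, 0 ≤ W y) {B : ℝ}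
    (hB : ∀ s ∈ Λ, ∑ y, W y * ‖1 - χ (s * y)‖ ^ 2 ≤ B) (hB0 : 0 ≤ B) {n : ℕ} {r : R}
    (hr : BoundedSpan Λ n r) : ∑ y, W y * ‖1 - χ (r * y)‖ ^ 2 ≤ n ^ 2 * B := by
  have step : ∀ (n : ℕ) (r s : R), ∑ y, W y * ‖1 - χ (r * y)‖ ^ 2 ≤ n ^ 2 * B → (n = 0 → r = 0) →
      ∑ y, W y * ‖1 - χ (s * y)‖ ^ 2 ≤ B →
      ∑ y, W y * ‖1 - χ ((r + s) * y)‖ ^ 2 ≤ ((n + 1 : ℕ) : ℝ) ^ 2 * B := by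
    intro n r s hr h0 hs
    rcases Nat.eq_zero_or_pos n with rfl | hn
    · simpa [h0 rfl] using hs
    have hn' : (0 : ℝ) < n := by exact_mod_cast hn
    calc ∑ y, W y * ‖1 - χ ((r + s) * y)‖ ^ 2
        ≤ ∑ y, ((1 + 1 / (n : ℝ)) * (W y * ‖1 - χ (r * y)‖ ^ 2) +
            (1 + (n : ℝ)) * (W y * ‖1 - χ (s * y)‖ ^ 2)) := by
          refine Finset.sum_le_sum fun y _ => ?_
          have := norm_one_sub_mul_sq_le (w := χ (s * y)) (norm_addChar (χ := χ) (r * y)) hn'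
          rw [add_mul, AddChar.map_add_eq_mul]
          nlinarith [mul_le_mul_of_nonneg_left this (hW y)]
      _ = (1 + 1 / (n : ℝ)) * ∑ y, W y * ‖1 - χ (r * y)‖ ^ 2 +
            (1 + (n : ℝ)) * ∑ y, W y * ‖1 - χ (s * y)‖ ^ 2 := by
          rw [Finset.sum_add_distrib, Finset.mul_sum, Finset.mul_sum]
      _ ≤ (1 + 1 / (n : ℝ)) * (n ^ 2 * B) + (1 + (n : ℝ)) * B := by gcongr
      _ = ((n + 1 : ℕ) : ℝ) ^ 2 * B := by push_cast; field_simp; ring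
  have hzero : ∀ {n : ℕ} {r : R}, BoundedSpan Λ n r → n = 0 → r = 0 := by
    intro n r h hn
    cases h with
    | zero => rfl
    | add => omega
    | sub => omega
  induction hr with
  | zero n => simpa using by positivity
  | add hr hs ih => exact step _ _ _ ih (hzero hr) (hB _ hs)
  | sub hr hs ih =>
    rw [sub_eq_add_neg]
    refine step _ _ _ ih (hzero hr) ?_
    simpa only [neg_mul, norm_one_sub_neg] using hB _ hs

lemma norm_one_sub_le_of_boundedSpan {Λ : Finset R} {z : R} {B : ℝ} (hB0 : 0 ≤ B)
    (hB : ∀ s ∈ Λ, ‖1 - χ (s * z)‖ ≤ B) {n : ℕ} {r : R}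
    (hr : BoundedSpan Λ n r) : ‖1 - χ (r * z)‖ ≤ n * B := by
  classical
  have h := sum_mul_norm_one_sub_sq_le (χ := χ) (W := fun y => if y = z then 1 else 0)
    (fun y => by split_ifs <;> simp) (B := B ^ 2)
    (fun s hs => by simpa using pow_le_pow_left₀ (norm_nonneg _) (hB s hs) 2) (sq_nonneg B) hr
  have h' : ‖1 - χ (r * z)‖ ^ 2 ≤ (n * B) ^ 2 := by
    rw [mul_pow]
    simpa using h
  exact (pow_le_pow_iff_left₀ (norm_nonneg _) (by positivity) two_ne_zero).1 h'

end Kernel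

section LocalEstimates

variable {R : Type*} [CommRing R] [Fintype R] {χ : AddChar R ℂ}

lemma ofReal_norm_sum_sq (a : R → ℂ) (S : Finset R) (x : R) :
    ((‖∑ r ∈ S, a r * χ (r * x)‖ ^ 2 : ℝ) : ℂ) =
      ∑ s ∈ S, ∑ r ∈ S, a r * starRingEnd ℂ (a s) * χ ((r - s) * x) := by
  rw [ofReal_pow, ← Complex.mul_conj', map_sum, Finset.sum_mul_sum, Finset.sum_comm]
  refine Finset.sum_congr rfl fun s _ => Finset.sum_congr rfl fun r _ => ?_
  rw [map_mul (starRingEnd ℂ), ← AddChar.map_neg_eq_conj, sub_mul, sub_eq_add_neg, AddChar.map_add_eq_mul]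
  ring

open scoped Classical in
/-- The mean square of an exponential sum against a translate of `bohrWeight` is controlled by the
coincidences of its frequencies modulo a bounded span. -/
lemma sum_bohrWeight_mul_norm_sq_le (hχ : χ.IsPrimitive) (a : R → ℂ) (S Λ : Finset R)
    {M l : ℕ} (hl : 6 * M * Λ.card ≤ l) (x : R) :
    ∑ y, bohrWeight χ Λ M y * ‖∑ r ∈ S, a r * χ (r * (x + y))‖ ^ 2 ≤
      (∑ y, bohrWeight χ Λ M y) *
        ∑ s ∈ S, ∑ r ∈ S with BoundedSpan Λ l (r - s), ‖a s‖ * ‖a r‖ := by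
  set Z := ∑ y, bohrWeight χ Λ M y with hZ
  have hZ0 : 0 ≤ Z := Finset.sum_nonneg fun y _ => bohrWeight_nonneg Λ M y
  have h1 : ((∑ y, bohrWeight χ Λ M y * ‖∑ r ∈ S, a r * χ (r * (x + y))‖ ^ 2 : ℝ) : ℂ) =
      ∑ s ∈ S, ∑ r ∈ S, a r * starRingEnd ℂ (a s) * χ ((r - s) * x) *
        charTransform χ (bohrWeight χ Λ M) (r - s) := by
    rw [ofReal_sum]
    simp only [ofReal_mul, ofReal_norm_sum_sq, Finset.mul_sum, charTransform]
    rw [Finset.sum_comm]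
    refine Finset.sum_congr rfl fun s _ => ?_
    rw [Finset.sum_comm]
    refine Finset.sum_congr rfl fun r _ => Finset.sum_congr rfl fun y _ => ?_
    rw [mul_add, AddChar.map_add_eq_mul]
    ring
  have h2 : 0 ≤ ∑ y, bohrWeight χ Λ M y * ‖∑ r ∈ S, a r * χ (r * (x + y))‖ ^ 2 :=
    Finset.sum_nonneg fun y _ => mul_nonneg (bohrWeight_nonneg Λ M y) (sq_nonneg _)
  rw [← Real.norm_of_nonneg h2, ← norm_real, h1, Finset.mul_sum]
  refine (norm_sum_le _ _).trans (Finset.sum_le_sum fun s _ => ?_)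
  rw [Finset.mul_sum, Finset.sum_filter]
  refine (norm_sum_le _ _).trans (Finset.sum_le_sum fun r _ => ?_)
  rw [norm_mul, norm_mul, norm_mul, norm_addChar, RCLike.norm_conj, mul_one]
  split_ifs with h
  · rw [mul_comm Z, mul_comm ‖a s‖]
    exact mul_le_mul_of_nonneg_left (norm_charTransform_bohrWeight_le Λ M _) (by positivity)
  · have : charTransform χ (bohrWeight χ Λ M) (r - s) = 0 := by
      by_contra h0
      exact h ((boundedSpan_of_charTransform_ne_zero hχ Λ M _ h0).mono_right hl)
    simp [this]

lemma norm_sum_sub_sq_le {a : R → ℂ} (ha : ∑ r, ‖a r‖ ≤ 1) (S : Finset R) (x y : R) :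
    ‖∑ r ∈ S, a r * χ (r * (x + y)) - ∑ r ∈ S, a r * χ (r * x)‖ ^ 2 ≤
      ∑ r ∈ S, ‖a r‖ * ‖1 - χ (r * y)‖ ^ 2 := by
  have h1 : ‖∑ r ∈ S, a r * χ (r * (x + y)) - ∑ r ∈ S, a r * χ (r * x)‖ ≤
      ∑ r ∈ S, ‖a r‖ * ‖1 - χ (r * y)‖ := by
    rw [← Finset.sum_sub_distrib]
    refine (norm_sum_le _ _).trans (le_of_eq (Finset.sum_congr rfl fun r _ => ?_))
    rw [mul_add, AddChar.map_add_eq_mul,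
      show a r * (χ (r * x) * χ (r * y)) - a r * χ (r * x) =
        -(χ (r * x) * (a r * (1 - χ (r * y)))) by ring,
      norm_neg, norm_mul, norm_addChar, one_mul, norm_mul]
  have h2 : (∑ r ∈ S, ‖a r‖ * ‖1 - χ (r * y)‖) ^ 2 ≤
      (∑ r ∈ S, ‖a r‖) * ∑ r ∈ S, ‖a r‖ * ‖1 - χ (r * y)‖ ^ 2 := by
    refine Finset.sum_sq_le_sum_mul_sum_of_sq_le_mul S (fun r _ => norm_nonneg _)
      (fun r _ => by positivity) fun r _ => le_of_eq (by ring)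
  have h3 : ∑ r ∈ S, ‖a r‖ ≤ 1 := (Finset.sum_le_sum_of_subset_of_nonneg
    (Finset.subset_univ _) fun r _ _ => norm_nonneg _).trans ha
  have h4 : 0 ≤ ∑ r ∈ S, ‖a r‖ * ‖1 - χ (r * y)‖ ^ 2 :=
    Finset.sum_nonneg fun r _ => by positivity
  calc _ ≤ (∑ r ∈ S, ‖a r‖ * ‖1 - χ (r * y)‖) ^ 2 := by gcongr
    _ ≤ _ := h2
    _ ≤ _ := mul_le_of_le_one_left h4 h3

lemma norm_sum_sub_le {a : R → ℂ} (ha : ∑ r, ‖a r‖ ≤ 1) {S : Finset R} {z : R} {B : ℝ}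
    (hB : 0 ≤ B) (hz : ∀ r ∈ S, ‖1 - χ (r * z)‖ ≤ B) (x : R) :
    ‖∑ r ∈ S, a r * χ (r * (x + z)) - ∑ r ∈ S, a r * χ (r * x)‖ ≤ B := by
  refine (pow_le_pow_iff_left₀ (norm_nonneg _) hB two_ne_zero).1 ?_
  calc _ ≤ ∑ r ∈ S, ‖a r‖ * ‖1 - χ (r * z)‖ ^ 2 := norm_sum_sub_sq_le ha S x z
    _ ≤ ∑ r ∈ S, ‖a r‖ * B ^ 2 := by gcongr with r hr; exact hz r hr
    _ = (∑ r ∈ S, ‖a r‖) * B ^ 2 := by rw [Finset.sum_mul]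
    _ ≤ B ^ 2 := mul_le_of_le_one_left (sq_nonneg B) <| (Finset.sum_le_sum_of_subset_of_nonneg
        (Finset.subset_univ _) fun r _ _ => norm_nonneg _).trans ha

/-- An exponential sum with frequencies in a bounded span varies slowly, in mean square. -/
lemma sum_bohrWeight_mul_norm_sum_sub_sq_le (hχ : χ.IsPrimitive) {a : R → ℂ}
    (ha : ∑ r, ‖a r‖ ≤ 1) {S Λ : Finset R} {L K : ℕ} (hL : 0 < L) (hK : 0 < K)
    (hS : ∀ r ∈ S, BoundedSpan Λ L r) (x : R) :
    ∑ y, bohrWeight χ Λ (K * L) y *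
        ‖∑ r ∈ S, a r * χ (r * (x + y)) - ∑ r ∈ S, a r * χ (r * x)‖ ^ 2 ≤
      4 / (K : ℝ) ^ 2 * ∑ y, bohrWeight χ Λ (K * L) y := by
  set W := bohrWeight χ Λ (K * L) with hW
  have hW0 : ∀ y, 0 ≤ W y := bohrWeight_nonneg Λ _
  have hZ0 : 0 ≤ ∑ y, W y := Finset.sum_nonneg fun y _ => hW0 y
  have hKL : (0 : ℝ) < ((K * L : ℕ) : ℝ) := by exact_mod_cast Nat.mul_pos hK hL
  have hb : ∀ r ∈ S, ∑ y, W y * ‖1 - χ (r * y)‖ ^ 2 ≤ 4 / (K : ℝ) ^ 2 * ∑ y, W y := by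
    intro r hr
    refine (sum_mul_norm_one_sub_sq_le hW0 (B := 4 / ((K * L : ℕ) : ℝ) ^ 2 * ∑ y, W y)
      (fun s hs => ?_) (by positivity) (hS r hr)).trans (le_of_eq ?_)
    · have := sq_mul_sum_bohrWeight_mul_le_of_mem hχ hs (K * L)
      rw [div_mul_eq_mul_div, le_div_iff₀ (by positivity), mul_comm]
      exact this
    · have : (L : ℝ) ≠ 0 := by positivity
      push_cast
      field_simp
  calc _ ≤ ∑ y, W y * ∑ r ∈ S, ‖a r‖ * ‖1 - χ (r * y)‖ ^ 2 :=
        Finset.sum_le_sum fun y _ =>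
          mul_le_mul_of_nonneg_left (norm_sum_sub_sq_le ha S x y) (hW0 y)
    _ = ∑ r ∈ S, ‖a r‖ * ∑ y, W y * ‖1 - χ (r * y)‖ ^ 2 := by
        simp only [Finset.mul_sum]
        rw [Finset.sum_comm]
        exact Finset.sum_congr rfl fun r _ => Finset.sum_congr rfl fun y _ => by ring
    _ ≤ ∑ r ∈ S, ‖a r‖ * (4 / (K : ℝ) ^ 2 * ∑ y, W y) :=
        Finset.sum_le_sum fun r hr => mul_le_mul_of_nonneg_left (hb r hr) (norm_nonneg _)
    _ = (∑ r ∈ S, ‖a r‖) * (4 / (K : ℝ) ^ 2 * ∑ y, W y) := by rw [Finset.sum_mul]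
    _ ≤ _ := mul_le_of_le_one_left (by positivity) <| (Finset.sum_le_sum_of_subset_of_nonneg
        (Finset.subset_univ _) fun r _ _ => norm_nonneg _).trans ha

end LocalEstimates

section Prime

variable {N : ℕ} [NeZero N]

lemma stdAddChar_eq_exp_val (x : ZMod N) :
    ZMod.stdAddChar x = Complex.exp (I * ((2 * π * (x.val / N : ℝ) : ℝ) : ℂ)) := by
  conv_lhs => rw [← ZMod.natCast_zmod_val x]
  rw [← Int.cast_natCast, ZMod.stdAddChar_coe]
  congr 1
  push_cast
  ring

lemma norm_one_sub_stdAddChar_sub_le (x y : ZMod N) :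
    ‖1 - (ZMod.stdAddChar (x - y) : ℂ)‖ ≤ 2 * π * |(x.val / N : ℝ) - y.val / N| := by
  rw [sub_eq_add_neg x, AddChar.map_add_eq_mul, AddChar.map_neg_eq_inv, stdAddChar_eq_exp_val,
    stdAddChar_eq_exp_val, ← Complex.exp_neg, ← Complex.exp_add, norm_sub_rev,
    show I * ((2 * π * (x.val / N : ℝ) : ℝ) : ℂ) + -(I * ((2 * π * (y.val / N : ℝ) : ℝ) : ℂ)) =
      I * ((2 * π * ((x.val / N : ℝ) - y.val / N) : ℝ) : ℂ) by push_cast; ring]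
  refine Real.norm_exp_I_mul_ofReal_sub_one_le.trans (le_of_eq ?_)
  rw [Real.norm_eq_abs, abs_mul, abs_of_pos Real.two_pi_pos]

/-- Simultaneous Dirichlet approximation on `ZMod N`. -/
lemma exists_ne_zero_norm_one_sub_le (Λ : Finset (ZMod N)) {M : ℕ} (hM : 0 < M)
    (hN : M ^ Λ.card < N) :
    ∃ z : ZMod N, z ≠ 0 ∧ ∀ s ∈ Λ, ‖1 - (ZMod.stdAddChar (s * z) : ℂ)‖ ≤ 2 * π / M := by
  have hM' : (0 : ℝ) < M := by exact_mod_cast hM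
  have hN' : (0 : ℝ) < N := by exact_mod_cast Nat.pos_of_neZero N
  have hlt : ∀ x : ZMod N, ⌊(M : ℝ) * (x.val / N : ℝ)⌋₊ < M := by
    intro x
    rw [Nat.floor_lt (by positivity)]
    have : (x.val / N : ℝ) < 1 := by
      rw [div_lt_one hN']
      exact_mod_cast ZMod.val_lt x
    nlinarith
  let f : ZMod N → (Λ → Fin M) := fun z s => ⟨_, hlt (s.1 * z)⟩
  obtain ⟨y, z, hyz, hf⟩ := Fintype.exists_ne_map_eq_of_card_lt f (by simpa [ZMod.card] using hN)
  refine ⟨y - z, sub_ne_zero.2 hyz, fun s hs => ?_⟩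
  have hfl : ⌊(M : ℝ) * ((s * y).val / N : ℝ)⌋₊ = ⌊(M : ℝ) * ((s * z).val / N : ℝ)⌋₊ :=
    congrArg Fin.val (congrFun hf ⟨s, hs⟩)
  rw [mul_sub]
  refine (norm_one_sub_stdAddChar_sub_le _ _).trans ?_
  rw [← mul_one_div (2 * π)]
  refine mul_le_mul_of_nonneg_left ?_ Real.two_pi_pos.le
  have h1 := Nat.floor_le (show 0 ≤ (M : ℝ) * ((s * y).val / N : ℝ) by positivity)
  have h2 := Nat.lt_floor_add_one ((M : ℝ) * ((s * y).val / N : ℝ))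
  have h3 := Nat.floor_le (show 0 ≤ (M : ℝ) * ((s * z).val / N : ℝ) by positivity)
  have h4 := Nat.lt_floor_add_one ((M : ℝ) * ((s * z).val / N : ℝ))
  rw [hfl] at h1 h2
  rw [le_div_iff₀' hM', ← abs_of_pos hM', ← abs_mul, mul_sub, abs_le]
  constructor <;> linarith

/-- A real function of mean zero on a cyclic group of prime order which varies by at most `δ` along
a nonzero step takes a value of size at most `δ`. -/
lemma exists_abs_le_of_sum_eq_zero [Fact N.Prime] {g : ZMod N → ℝ} (hg : ∑ x, g x = 0)
    {z : ZMod N} (hz : z ≠ 0) {δ : ℝ} (hδ : ∀ x, |g (x + z) - g x| ≤ δ) : ∃ x, |g x| ≤ δ := by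
  by_contra! hcon
  have hstep : ∀ x, 0 < g x → 0 < g (x + z) := by
    intro x hx
    have h1 := hcon x
    have h2 := (abs_le.1 (hδ x)).1
    rw [abs_of_pos hx] at h1
    linarith
  by_cases h : ∃ x, 0 < g x
  · obtain ⟨x, hx⟩ := h
    have hk : ∀ k : ℕ, 0 < g (x + k * z) := by
      intro k
      induction k with
      | zero => simpa using hx
      | succ k ih =>
        have := hstep _ ih
        rwa [show x + (k : ZMod N) * z + z = x + ((k + 1 : ℕ) : ZMod N) * z by
          push_cast; ring] at this
    refine absurd hg (Finset.sum_pos (fun y _ => ?_) Finset.univ_nonempty).ne'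
    have := hk ((y - x) * z⁻¹).val
    rwa [ZMod.natCast_zmod_val, mul_assoc, inv_mul_cancel₀ hz, mul_one, add_sub_cancel] at this
  · push Not at h
    refine absurd hg (Finset.sum_neg (fun y _ => ?_) Finset.univ_nonempty).ne
    refine lt_of_le_of_ne (h y) fun h0 => ?_
    have h1 := hcon y
    have h2 := (abs_nonneg _).trans (hδ y)
    rw [h0, abs_zero] at h1
    linarith

lemma sum_exponentialSum_eq_zero {a : ZMod N → ℂ} (ha : a 0 = 0) (S : Finset (ZMod N)) :
    ∑ x, ∑ r ∈ S, a r * (ZMod.stdAddChar (r * x) : ℂ) = 0 := by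
  rw [Finset.sum_comm]
  refine Finset.sum_eq_zero fun r _ => ?_
  rw [← Finset.mul_sum]
  rcases eq_or_ne r 0 with rfl | hr
  · rw [ha, zero_mul]
  · have := AddChar.sum_mulShift r (ZMod.isPrimitive_stdAddChar N)
    simp only [mul_comm r, this, if_neg hr, Nat.cast_zero, mul_zero]

end Prime

section IntermediateValue

/-- A quantitative approximate intermediate value theorem: a real function on `ZMod N` of mean zero
whose Fourier coefficients have total mass at most `1` takes a value smaller than `1 / n`, unless
`N` is bounded in terms of `n`. -/
theorem card_le_of_one_div_le_abs_re_sum {N : ℕ} [NeZero N] [Fact N.Prime] {n : ℕ} (hn : 0 < n)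
    {a : ZMod N → ℂ} (ha0 : a 0 = 0) (ha : ∑ r, ‖a r‖ ≤ 1)
    (hf : ∀ x, 1 / (n : ℝ) ≤ |(∑ r, a r * (ZMod.stdAddChar (r * x) : ℂ)).re|) :
    N ≤ (30 * n * (20 * (30 * n) * (8 * n ^ 2)) ^ (4 * n)) ^ (8 * n ^ 2) := by
  classical
  by_contra! hN
  have hn' : (0 : ℝ) < n := by exact_mod_cast hn
  set K := 30 * n with hK
  set D := 8 * n ^ 2 with hD
  have hK0 : 0 < K := by positivity
  have hD0 : 0 < D := by positivity
  obtain ⟨Λ, j, hj, hΛ, hQ⟩ := exists_few_coincidences (fun r => ‖a r‖) (fun r => norm_nonneg _) ha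
    (ε := 1 / (2 * n)) (by positivity) hK0 hD0 (J := 4 * n)
    (by rw [hD]; push_cast; field_simp; norm_num) (by push_cast; field_simp; norm_num)
  set L := (20 * K * D) ^ j with hL
  have hL0 : 0 < L := by positivity
  set S := Finset.univ.filter (BoundedSpan Λ L) with hS
  set Q := ∑ s ∈ Sᶜ, ∑ r ∈ Sᶜ with BoundedSpan Λ (6 * (K * L) * D) (r - s), ‖a s‖ * ‖a r‖
  replace hQ : Q < (1 / (2 * n)) ^ 2 := by convert hQ
  set g : ZMod N → ℂ := fun x => ∑ r ∈ S, a r * (ZMod.stdAddChar (r * x) : ℂ) with hg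
  let h : ZMod N → ℂ := fun x => ∑ r ∈ Sᶜ, a r * (ZMod.stdAddChar (r * x) : ℂ)
  have hgh : ∀ x, ∑ r, a r * (ZMod.stdAddChar (r * x) : ℂ) = g x + h x := fun x =>
    (Finset.sum_add_sum_compl S _).symm
  have hχ := ZMod.isPrimitive_stdAddChar N
  have hKr : (K : ℝ) = 30 * n := by rw [hK]; push_cast; ring
  obtain ⟨z, hz0, hz⟩ := exists_ne_zero_norm_one_sub_le Λ (M := K * L) (by positivity) <| by
    refine lt_of_le_of_lt ?_ hN
    calc (K * L) ^ Λ.card ≤ (K * L) ^ D := Nat.pow_le_pow_right (by positivity) hΛ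
      _ ≤ _ := by
        refine Nat.pow_le_pow_left (Nat.mul_le_mul_left _ ?_) _
        exact Nat.pow_le_pow_right (by positivity) hj
  have hgz : ∀ x, |(g (x + z)).re - (g x).re| ≤ 7 / K := by
    intro x
    rw [← Complex.sub_re]
    refine (Complex.abs_re_le_norm _).trans (norm_sum_sub_le ha (by positivity) (fun r hr => ?_) x)
    refine (norm_one_sub_le_of_boundedSpan (by positivity) hz
      (Finset.mem_filter.1 hr).2).trans ?_
    have : (L : ℝ) * (2 * π / ((K * L : ℕ) : ℝ)) = 2 * π / K := by
      push_cast
      have : (L : ℝ) ≠ 0 := by positivity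
      field_simp
    rw [this]
    gcongr
    linarith [Real.pi_lt_d2]
  obtain ⟨x, hx⟩ := exists_abs_le_of_sum_eq_zero (g := fun x => (g x).re)
    (by rw [← Complex.re_sum, hg, sum_exponentialSum_eq_zero ha0, zero_re]) hz0 hgz
  set W := bohrWeight (ZMod.stdAddChar : AddChar (ZMod N) ℂ) Λ (K * L) with hW
  have hZ : 0 < ∑ y, W y := sum_bohrWeight_pos Λ (by positivity)
  have hWg : ∑ y, W y * ‖g (x + y) - g x‖ ^ 2 ≤ 4 / (K : ℝ) ^ 2 * ∑ y, W y :=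
    sum_bohrWeight_mul_norm_sum_sub_sq_le hχ ha hL0 hK0 (fun r hr => (Finset.mem_filter.1 hr).2) x
  have hWh : ∑ y, W y * ‖h (x + y)‖ ^ 2 ≤ (∑ y, W y) * Q :=
    sum_bohrWeight_mul_norm_sq_le hχ a Sᶜ Λ (Nat.mul_le_mul_left _ hΛ) x
  have hpt : ∀ y, (1 / (n : ℝ)) ^ 2 ≤
      3 * ((7 / (K : ℝ)) ^ 2 + ‖g (x + y) - g x‖ ^ 2 + ‖h (x + y)‖ ^ 2) := by
    intro y
    have h1 := hf (x + y)
    rw [hgh, show g (x + y) + h (x + y) = g x + (g (x + y) - g x) + h (x + y) by ring,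
      add_re, add_re] at h1
    have h2 := h1.trans ((abs_add_le _ _).trans (add_le_add_left (abs_add_le _ _) _))
    have h3 : 1 / (n : ℝ) ≤ 7 / (K : ℝ) + ‖g (x + y) - g x‖ + ‖h (x + y)‖ :=
      h2.trans (add_le_add (add_le_add hx (abs_re_le_norm _)) (abs_re_le_norm _))
    have h4 := pow_le_pow_left₀ (by positivity) h3 2
    refine h4.trans ?_
    nlinarith [sq_nonneg (7 / (K : ℝ) - ‖g (x + y) - g x‖), sq_nonneg (7 / (K : ℝ) - ‖h (x + y)‖),
      sq_nonneg (‖g (x + y) - g x‖ - ‖h (x + y)‖)]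
  have hsum : (1 / (n : ℝ)) ^ 2 * ∑ y, W y ≤
      3 * ((7 / (K : ℝ)) ^ 2 + 4 / (K : ℝ) ^ 2 + Q) * ∑ y, W y := by
    calc (1 / (n : ℝ)) ^ 2 * ∑ y, W y = ∑ y, W y * (1 / (n : ℝ)) ^ 2 := by
          rw [mul_comm, Finset.sum_mul]
      _ ≤ ∑ y, W y * (3 * ((7 / (K : ℝ)) ^ 2 + ‖g (x + y) - g x‖ ^ 2 + ‖h (x + y)‖ ^ 2)) :=
          Finset.sum_le_sum fun y _ => mul_le_mul_of_nonneg_left (hpt y) (bohrWeight_nonneg _ _ _)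
      _ = 3 * ((7 / (K : ℝ)) ^ 2 * ∑ y, W y + ∑ y, W y * ‖g (x + y) - g x‖ ^ 2 +
            ∑ y, W y * ‖h (x + y)‖ ^ 2) := by
          rw [Finset.mul_sum, ← Finset.sum_add_distrib, ← Finset.sum_add_distrib, Finset.mul_sum]
          exact Finset.sum_congr rfl fun y _ => by ring
      _ ≤ _ := by linarith
  have hfin := le_of_mul_le_mul_right hsum hZ
  have hu : 0 < (1 / (n : ℝ)) ^ 2 := by positivity
  have e1 : (7 / (K : ℝ)) ^ 2 = 49 / 900 * (1 / (n : ℝ)) ^ 2 := by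
    rw [hKr]; field_simp; norm_num
  have e2 : 4 / (K : ℝ) ^ 2 = 4 / 900 * (1 / (n : ℝ)) ^ 2 := by
    rw [hKr]; field_simp; norm_num
  have e3 : (1 / (2 * n : ℝ)) ^ 2 = 1 / 4 * (1 / (n : ℝ)) ^ 2 := by
    field_simp; norm_num
  rw [e1, e2] at hfin
  rw [e3] at hQ
  linarith

lemma log_le_of_one_div_le_abs_re_sum {N : ℕ} [NeZero N] [Fact N.Prime] {n : ℕ} (hn : 2 ≤ n)
    {a : ZMod N → ℂ} (ha0 : a 0 = 0) (ha : ∑ r, ‖a r‖ ≤ 1)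
    (hf : ∀ x, 1 / (n : ℝ) ≤ |(∑ r, a r * (ZMod.stdAddChar (r * x) : ℂ)).re|) :
    Real.log N ≤ 560 * n ^ 3 * Real.log n := by
  have h1 := card_le_of_one_div_le_abs_re_sum (by omega) ha0 ha hf
  have h2 : 30 * n ≤ n ^ 6 := by
    have := Nat.pow_le_pow_left hn 5
    nlinarith
  have h3 : 20 * (30 * n) * (8 * n ^ 2) ≤ n ^ 16 := by
    have := Nat.pow_le_pow_left hn 13
    calc 20 * (30 * n) * (8 * n ^ 2) = 4800 * n ^ 3 := by ring
      _ ≤ n ^ 13 * n ^ 3 := Nat.mul_le_mul_right _ (by omega)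
      _ = n ^ 16 := by ring
  have h4 : N ≤ n ^ (560 * n ^ 3) := by
    calc N ≤ _ := h1
      _ ≤ (n ^ 6 * (n ^ 16) ^ (4 * n)) ^ (8 * n ^ 2) := by gcongr
      _ = n ^ ((6 + 16 * (4 * n)) * (8 * n ^ 2)) := by
        rw [← pow_mul n 16, ← pow_add, ← pow_mul]
      _ ≤ n ^ (560 * n ^ 3) := by
        refine Nat.pow_le_pow_right (by omega) ?_
        nlinarith [Nat.mul_le_mul_right (n ^ 2) hn]
  calc Real.log N ≤ Real.log ((n : ℝ) ^ (560 * n ^ 3)) :=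
        Real.log_le_log (by exact_mod_cast Nat.pos_of_neZero N) (by exact_mod_cast h4)
    _ = _ := by rw [Real.log_pow]; push_cast; ring

end IntermediateValue

section FourierNorm

variable {N : ℕ} [NeZero N]

lemma dftN_eq_dft (g : ZMod N → ℂ) (k : ZMod N) : dftN N g k = (N : ℂ)⁻¹ * ZMod.dft g k := by
  rw [dftN, ZMod.dft_apply, one_div]
  congr 1
  refine Finset.sum_congr rfl fun j _ => ?_
  have : -(j * k) = ((-((j.val : ℤ) * k.val) : ℤ) : ZMod N) := by
    push_cast
    rw [ZMod.natCast_zmod_val, ZMod.natCast_zmod_val]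
  rw [this, ZMod.stdAddChar_coe, smul_eq_mul, mul_comm]
  congr 2
  push_cast
  ring

lemma sum_dftN_mul_stdAddChar (g : ZMod N → ℂ) (x : ZMod N) :
    ∑ k, dftN N g k * (ZMod.stdAddChar (k * x) : ℂ) = g x := by
  conv_rhs => rw [← LinearEquiv.symm_apply_apply ZMod.dft g, ZMod.invDFT_apply]
  rw [smul_eq_mul, Finset.mul_sum]
  refine Finset.sum_congr rfl fun k _ => ?_
  rw [dftN_eq_dft, smul_eq_mul]
  ring

lemma dftN_indicator_zero (E : Finset (ZMod N)) :
    dftN N (fun j => if j ∈ E then (1 : ℂ) else 0) 0 = ((E.card / N : ℝ) : ℂ) := by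
  rw [dftN_eq_dft, ZMod.dft_apply_zero]
  simp [div_eq_inv_mul]

lemma norm_dftN_le_normAN (g : ZMod N → ℂ) (k : ZMod N) : ‖dftN N g k‖ ≤ normAN N g :=
  Finset.single_le_sum (f := fun k => ‖dftN N g k‖) (fun _ _ => norm_nonneg _) (Finset.mem_univ k)

lemma card_div_le_normAN (E : Finset (ZMod N)) :
    (E.card : ℝ) / N ≤ normAN N (fun j => if j ∈ E then (1 : ℂ) else 0) := by
  refine le_trans ?_ (norm_dftN_le_normAN _ 0)
  rw [dftN_indicator_zero, norm_real]
  exact le_abs_self _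

/-- If `1_E` minus its mean is at least `‖1_E‖ / n` in absolute value, then `N` is bounded in terms
of `n`. -/
lemma log_le_of_normAN_div_le [Fact N.Prime] {n : ℕ} (hn : 2 ≤ n) (E : Finset (ZMod N))
    (hA : 0 < normAN N (fun j => if j ∈ E then (1 : ℂ) else 0))
    (h : normAN N (fun j => if j ∈ E then (1 : ℂ) else 0) / n ≤
      min ((E.card : ℝ) / N) (1 - (E.card : ℝ) / N)) :
    Real.log N ≤ 560 * n ^ 3 * Real.log n := by
  set f : ZMod N → ℂ := fun j => if j ∈ E then (1 : ℂ) else 0 with hf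
  set A := normAN N f with hAdef
  set a : ZMod N → ℂ := fun r => if r = 0 then 0 else dftN N f r / A with ha
  have hA' : (A : ℂ) ≠ 0 := by exact_mod_cast hA.ne'
  refine log_le_of_one_div_le_abs_re_sum hn (a := a) (by simp [ha]) ?_ fun x => ?_
  · calc ∑ r, ‖a r‖ ≤ ∑ r, ‖dftN N f r‖ / A := by
          refine Finset.sum_le_sum fun r _ => ?_
          simp only [ha]
          split_ifs
          · rw [norm_zero]; positivity
          · rw [norm_div, norm_real, Real.norm_of_nonneg hA.le]
      _ = 1 := by rw [← Finset.sum_div]; exact div_self hA.ne'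
  · have h1 : ∑ r, a r * (ZMod.stdAddChar (r * x) : ℂ) =
        (((if x ∈ E then 1 else 0) - E.card / N : ℝ) / A : ℝ) := by
      have h2 : ∑ r, a r * (ZMod.stdAddChar (r * x) : ℂ) =
          (∑ r, dftN N f r * (ZMod.stdAddChar (r * x) : ℂ) - dftN N f 0) / A := by
        rw [← Finset.add_sum_erase _ _ (Finset.mem_univ (0 : ZMod N)),
          ← Finset.add_sum_erase (a := (0 : ZMod N)) (f := fun r => dftN N f r * _) _
            (Finset.mem_univ _)]
        simp only [ha, zero_mul, AddChar.map_zero_eq_one, mul_one, add_sub_cancel_left, if_true,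
          zero_add]
        rw [Finset.sum_div]
        refine Finset.sum_congr rfl fun r hr => ?_
        rw [if_neg (Finset.ne_of_mem_erase hr)]
        ring
      rw [h2, sum_dftN_mul_stdAddChar, dftN_indicator_zero]
      simp only [hf]
      split_ifs <;> push_cast <;> rfl
    rw [h1, ofReal_re, abs_div, abs_of_pos hA, le_div_iff₀ hA, one_div_mul_eq_div]
    refine h.trans ?_
    split_ifs
    · exact (min_le_right _ _).trans (le_abs_self _)
    · rw [zero_sub, abs_neg]
      exact (min_le_left _ _).trans (le_abs_self _)

end FourierNorm

theorem green_konyagin :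
    ∃ c : ℝ, 0 < c ∧ ∃ N₀ : ℕ, ∀ (N : ℕ) [NeZero N], N.Prime → N₀ ≤ N →
      ∀ E : Finset (ZMod N),
        min ((E.card : ℝ) / N) (1 - (E.card : ℝ) / N) ≤
          c * (Real.log (Real.log N) / Real.log N) ^ ((1 : ℝ) / 3) *
            normAN N (fun j : ZMod N => if j ∈ E then (1 : ℂ) else 0) := by
  refine ⟨30, by norm_num, ⌈Real.exp (Real.exp 1)⌉₊, fun N _ hp hN₀ E => ?_⟩
  have : Fact N.Prime := ⟨hp⟩
  have hNexp : Real.exp (Real.exp 1) ≤ N := Nat.ceil_le.1 hN₀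
  set l := Real.log N with hl
  have hl1 : Real.exp 1 ≤ l := by
    rw [hl, Real.le_log_iff_exp_le (by exact_mod_cast hp.pos)]
    exact hNexp
  have hl0 : 0 < l := (Real.exp_pos 1).trans_le hl1
  have hll : 1 ≤ Real.log l := (Real.le_log_iff_exp_le hl0).2 hl1
  set q := (Real.log l / l) ^ ((1 : ℝ) / 3) with hq
  have hq0 : 0 < q := Real.rpow_pos_of_pos (by positivity) _
  have hq3 : q ^ 3 = Real.log l / l := by
    rw [hq, ← Real.rpow_natCast, ← Real.rpow_mul (by positivity)]
    norm_num
  by_contra! hcon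
  have hEA := card_div_le_normAN E
  set A := normAN N (fun j : ZMod N => if j ∈ E then (1 : ℂ) else 0) with hA
  have hA0' : 0 ≤ A := le_trans (by positivity) hEA
  have hlt : 30 * q * A < A := hcon.trans_le ((min_le_left _ _).trans hEA)
  have hA0 : 0 < A := lt_of_le_of_ne hA0' fun h => by simp [← h] at hlt
  have hη1 : 30 * q < 1 := by
    by_contra! h
    nlinarith
  set n := ⌈1 / (30 * q)⌉₊ + 1 with hn
  have hn1 : 1 / (30 * q) ≤ n := by
    rw [hn]; push_cast
    linarith [Nat.le_ceil (1 / (30 * q))]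
  have hn2 : (n : ℝ) ≤ 3 * (1 / (30 * q)) := by
    have h1 := Nat.ceil_lt_add_one (show 0 ≤ 1 / (30 * q) by positivity)
    have h2 : 1 ≤ 1 / (30 * q) := by
      rw [le_div_iff₀ (by positivity)]; linarith
    rw [hn]; push_cast
    linarith
  have hn3 : 2 ≤ n := by
    have : 0 < ⌈1 / (30 * q)⌉₊ := Nat.ceil_pos.2 (by positivity)
    omega
  have hn0 : (0 : ℝ) < n := by positivity
  have hbound := log_le_of_normAN_div_le hn3 E hA0 <| by
    refine le_trans ?_ hcon.le
    rw [div_le_iff₀ hn0]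
    rw [div_le_iff₀ (by positivity)] at hn1
    nlinarith
  have hcube : (n : ℝ) ^ 3 ≤ l / (1000 * Real.log l) := by
    calc (n : ℝ) ^ 3 ≤ (3 * (1 / (30 * q))) ^ 3 := by gcongr
      _ = 1 / (1000 * q ^ 3) := by field_simp; norm_num
      _ = l / (1000 * Real.log l) := by
        have : Real.log l ≠ 0 := by positivity
        rw [hq3]; field_simp
  have hnl : (n : ℝ) ≤ l := by
    have h1 : (n : ℝ) ≤ n ^ 3 := le_self_pow₀ (by exact_mod_cast (by omega : 1 ≤ n)) (by norm_num)
    refine h1.trans (hcube.trans (div_le_self hl0.le (by linarith)))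
  have hlogn : Real.log n ≤ Real.log l := Real.log_le_log hn0 hnl
  have : l ≤ 560 / 1000 * l := by
    calc l ≤ 560 * n ^ 3 * Real.log n := hbound
      _ ≤ 560 * (l / (1000 * Real.log l)) * Real.log l := by
        have : 0 ≤ Real.log n := Real.log_natCast_nonneg n
        gcongr
      _ = 560 / 1000 * l := by
        have : Real.log l ≠ 0 := by positivity
        field_simp
  linarith
end
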